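/- Assume [H1] and [H2], and let ψ : [0,T_max) → W^{σ,p}(𝕋ⁿ) be the maximal L^p-solution of the nonlocal Fokker–Planck equation. Then: (a) there exists a constant C_F > 0 such that ‖F(ψ(t))‖_{L^p} ≤ C_F ‖ψ(t)‖_{W^{σ,p}} for all t ∈ [0,T_max) (polynomial bound); (b) ψ ∈ L^∞((0,T_max), W^{σ,p}(𝕋ⁿ)); and (c) more generally, if u, ζ ∈ C([0,T_max), ℝ₊) and γ ∈ L¹((0,T_max), ℝ₊) is decreasing with u(t) ≤ ζ(t) + ∫₀ᵗ γ(t−s) u(s) ds for all t ∈ [0,T_max), then there is a constant δ > 0 depending only on γ such that u(t) ≤ 2 ζ*(t) e^{δt} for 0 ≤ t < T_max, where ζ*(t) := max{ζ(s) : 0 ≤ s ≤ t}. -/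

import Mathlib

open MeasureTheory ENNReal Set Filter

noncomputable section

/-- Ambient space `ℝ × ℝ^m`: the universal cover of the torus `𝕋^{m+1}` (so `n = m + 1`). -/
abbrev Spc (m : ℕ) : Type := ℝ × (Fin m → ℝ)

/-- Unit cube in the last `m` coordinates: a fundamental domain for `𝕋^m`. -/
def cube1 (m : ℕ) : Set (Fin m → ℝ) := Set.pi Set.univ fun _ => Set.Ico (0 : ℝ) 1

/-- A fundamental domain for the torus `𝕋^{m+1}`. -/
def cube (m : ℕ) : Set (Spc m) := Set.Ico (0 : ℝ) 1 ×ˢ cube1 m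

/-- The measure of the torus: Lebesgue measure restricted to a fundamental domain. -/
def μT (m : ℕ) : Measure (Spc m) := volume.restrict (cube m)

/-- `ℤ^{m+1}`-periodicity: `f` is a function on the torus `𝕋^{m+1}`. -/
def IsPeriodic {m : ℕ} (f : Spc m → ℝ) : Prop :=
  ∀ (x : Spc m) (k : ℤ) (j : Fin m → ℤ), f (x.1 + k, fun i => x.2 i + j i) = f x

/-- The first coordinate direction. -/
def e1 (m : ℕ) : Spc m := (1, 0)

/-- The remaining coordinate directions. -/
def eC (m : ℕ) (i : Fin m) : Spc m := (0, Pi.single i 1)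

/-- Partial derivative in the direction `v`. -/
def pd {m : ℕ} (v : Spc m) (f : Spc m → ℝ) (x : Spc m) : ℝ := fderiv ℝ f x v

/-- `∇f ⋅ ∇g`. -/
def gradDot {m : ℕ} (f g : Spc m → ℝ) (x : Spc m) : ℝ :=
  pd (e1 m) f x * pd (e1 m) g x + ∑ i, pd (eC m i) f x * pd (eC m i) g x

/-- The Laplacian. -/
def lap {m : ℕ} (f : Spc m → ℝ) (x : Spc m) : ℝ :=
  pd (e1 m) (pd (e1 m) f) x + ∑ i, pd (eC m i) (pd (eC m i) f) x

/-- The marginal `ψ̄(x₁) = ∫_{𝕋^m} ψ(x₁, ⋅)`. -/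
def marg {m : ℕ} (ψ : Spc m → ℝ) (x1 : ℝ) : ℝ := ∫ y in cube1 m, ψ (x1, y)

/-- The nonlocal coefficient `φ_ψ = (∫ ∂_{x₁}V ψ dx₂…dxₙ) / ψ̄`. -/
def phiF {m : ℕ} (V ψ : Spc m → ℝ) (x1 : ℝ) : ℝ :=
  (∫ y in cube1 m, pd (e1 m) V (x1, y) * ψ (x1, y)) / marg ψ x1

/-- `F(ψ) = ∇V⋅∇ψ + ΔV ψ − ∂_{x₁}(φ_ψ ψ)`. -/
def Fop {m : ℕ} (V ψ : Spc m → ℝ) (x : Spc m) : ℝ :=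
  gradDot V ψ x + lap V x * ψ x - pd (e1 m) (fun z => phiF V ψ z.1 * ψ z) x

/-- `L^p`-norm on the torus. -/
def LpN {m : ℕ} (p : ℝ) (f : Spc m → ℝ) : ℝ≥0∞ := eLpNorm f (ENNReal.ofReal p) (μT m)

/-- Gagliardo (Sobolev–Slobodeckij) seminorm of fractional order `s`. -/
def gagl {m : ℕ} {F : Type*} [NormedAddCommGroup F] (s p : ℝ) (f : Spc m → F) : ℝ≥0∞ :=
  (∫⁻ x in cube m, ∫⁻ y in cube m,
      ENNReal.ofReal (‖f x - f y‖ ^ p / ‖x - y‖ ^ ((m : ℝ) + 1 + s * p))) ^ (1 / p)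

/-- The differential of `f`. -/
def grd {m : ℕ} (f : Spc m → ℝ) (x : Spc m) : Spc m →L[ℝ] ℝ := fderiv ℝ f x

/-- The `W^{σ,p}`-norm on the torus, for `0 ≤ σ ≤ 2`. -/
def WNorm {m : ℕ} (σ p : ℝ) (f : Spc m → ℝ) : ℝ≥0∞ :=
  if σ ≤ 0 then LpN p f
  else if σ < 1 then LpN p f + gagl σ p f
  else if σ < 2 then
    LpN p f + eLpNorm (fun x => ‖grd f x‖) (ENNReal.ofReal p) (μT m)
      + (if σ = 1 then 0 else gagl (σ - 1) p (grd f))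
  else
    LpN p f + eLpNorm (fun x => ‖grd f x‖) (ENNReal.ofReal p) (μT m)
      + eLpNorm (fun x => ‖iteratedFDeriv ℝ 2 f x‖) (ENNReal.ofReal p) (μT m)

/-- Membership in `W^{σ,p}(𝕋^{m+1})`, for `0 ≤ σ ≤ 2`. -/
def MemW {m : ℕ} (σ p : ℝ) (f : Spc m → ℝ) : Prop :=
  IsPeriodic f ∧ Measurable f ∧ (1 ≤ σ → Differentiable ℝ f) ∧
    (2 ≤ σ → Differentiable ℝ (grd f)) ∧ WNorm σ p f < ⊤

/-- Membership in `𝒟^{σ,p}(𝕋^{m+1}) = {ψ ∈ W^{σ,p} | ψ̄ > 0}`. -/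
def MemD {m : ℕ} (σ p : ℝ) (f : Spc m → ℝ) : Prop :=
  MemW σ p f ∧ ∀ x1 : ℝ, 0 < marg f x1

/-- Hypothesis `[H₁]`: `ψ₀ ∈ 𝒟^{σ,p}`, `ψ₀ ≥ 0`, `∫ ψ₀ = 1`. -/
def Hyp1 {m : ℕ} (σ p : ℝ) (ψ0 : Spc m → ℝ) : Prop :=
  MemD σ p ψ0 ∧ (∀ x, 0 ≤ ψ0 x) ∧ (∫ x in cube m, ψ0 x) = 1

/-- Hypothesis `[H₂]`: `n = m + 1 ≥ 2`, `p > n`, `σ ∈ (1 + n/p, 2)`. -/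
def Hyp2 (m : ℕ) (σ p : ℝ) : Prop :=
  1 ≤ m ∧ (m : ℝ) + 1 < p ∧ 1 + ((m : ℝ) + 1) / p < σ ∧ σ < 2

/-- The real interval `[0, Tmax)`, where `Tmax ∈ (0, ∞]`. -/
def Ico0 (Tmax : ℝ≥0∞) : Set ℝ := {t : ℝ | 0 ≤ t ∧ ENNReal.ofReal t < Tmax}

/-- The real interval `(0, Tmax)`, where `Tmax ∈ (0, ∞]`. -/
def Ioo0 (Tmax : ℝ≥0∞) : Set ℝ := {t : ℝ | 0 < t ∧ ENNReal.ofReal t < Tmax}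

/-- Continuity in `W^{σ,p}`-norm of a curve, on a time set `s`. -/
def ContW {m : ℕ} (σ p : ℝ) (s : Set ℝ) (ψ : ℝ → Spc m → ℝ) : Prop :=
  ∀ t ∈ s, ∀ ε : ℝ, 0 < ε → ∃ δ > 0, ∀ t' ∈ s, |t' - t| < δ →
    WNorm σ p (fun x => ψ t' x - ψ t x) < ENNReal.ofReal ε

/-- Hölder continuity (exponent `α`) in `W^{σ,p}`-norm of a curve, on a time set `s`. -/
def HolderW {m : ℕ} (α σ p : ℝ) (s : Set ℝ) (ψ : ℝ → Spc m → ℝ) : Prop :=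
  ∃ C : ℝ, ∀ t ∈ s, ∀ t' ∈ s,
    WNorm σ p (fun x => ψ t' x - ψ t x) ≤ ENNReal.ofReal (C * |t' - t| ^ α)

/-- `ψ` is an `L^p`-solution on `[0, Tmax)` of the nonlocal Fokker–Planck equation
`∂ₜψ = div(∇V ψ + β⁻¹∇ψ) − ∂_{x₁}(φ_ψ ψ) = β⁻¹Δψ + F(ψ)`, `ψ(0) = ψ₀`. -/
structure IsLpSolution {m : ℕ} (V : Spc m → ℝ) (β σ p : ℝ) (ψ0 : Spc m → ℝ)
    (Tmax : ℝ≥0∞) (ψ : ℝ → Spc m → ℝ) : Prop where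
  init : ∀ x, ψ 0 x = ψ0 x
  contLp : ContW 0 p (Ico0 Tmax) ψ
  regW2 : ∀ t ∈ Ioo0 Tmax, MemW 2 p (ψ t)
  regD : ∀ t ∈ Ioo0 Tmax, MemD σ p (ψ t)
  eqn : ∀ t ∈ Ioo0 Tmax,
    Tendsto (fun h : ℝ => LpN p
        (fun x => (ψ (t + h) x - ψ t x) / h - (β⁻¹ * lap (ψ t) x + Fop V (ψ t) x)))
      (nhdsWithin 0 {h : ℝ | h ≠ 0}) (nhds 0)
  derivCont : ContW 0 p (Ioo0 Tmax)
    (fun t x => β⁻¹ * lap (ψ t) x + Fop V (ψ t) x)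

/-- A maximal `L^p`-solution: an `L^p`-solution admitting no proper extension. -/
def IsMaximalLpSolution {m : ℕ} (V : Spc m → ℝ) (β σ p : ℝ) (ψ0 : Spc m → ℝ)
    (Tmax : ℝ≥0∞) (ψ : ℝ → Spc m → ℝ) : Prop :=
  IsLpSolution V β σ p ψ0 Tmax ψ ∧ 0 < Tmax ∧
    ∀ (Tmax' : ℝ≥0∞) (ψ' : ℝ → Spc m → ℝ), IsLpSolution V β σ p ψ0 Tmax' ψ' →
      (∀ t ∈ Ico0 Tmax, ψ' t = ψ t) → Tmax' ≤ Tmax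

/-- The Euclidean quadratic form on `Spc m`. -/
def qd {m : ℕ} (z : Spc m) : ℝ := z.1 ^ 2 + ∑ i, z.2 i ^ 2

/-- The heat semigroup `e^{β⁻¹ t Δ}` on the torus, realized by convolution with the Gaussian
heat kernel on the universal cover (and the identity for `t ≤ 0`). -/
def heatSG {m : ℕ} (β t : ℝ) (f : Spc m → ℝ) (x : Spc m) : ℝ :=
  if t ≤ 0 then f x
  else ∫ y : Spc m, (4 * Real.pi * (t / β)) ^ (-((m : ℝ) + 1) / 2) *
      Real.exp (-qd (x - y) / (4 * (t / β))) * f y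

/-- `ψ` is a mild solution of the nonlocal Fokker–Planck equation on `[0, Tmax)`:
`ψ ∈ C([0,Tmax), 𝒟^{σ,p})` and `ψ(t) = e^{β⁻¹tΔ}ψ₀ + ∫₀ᵗ e^{β⁻¹(t−s)Δ} F(ψ(s)) ds`. -/
def IsMildSolution {m : ℕ} (V : Spc m → ℝ) (β σ p : ℝ) (ψ0 : Spc m → ℝ)
    (Tmax : ℝ≥0∞) (ψ : ℝ → Spc m → ℝ) : Prop :=
  (∀ x, ψ 0 x = ψ0 x) ∧ (∀ t ∈ Ico0 Tmax, MemD σ p (ψ t)) ∧ ContW σ p (Ico0 Tmax) ψ ∧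
    ∀ t ∈ Ico0 Tmax, ∀ᵐ x ∂(volume : Measure (Spc m)),
      ψ t x = heatSG β t ψ0 x + ∫ s in Set.Ioc (0 : ℝ) t, heatSG β (t - s) (Fop V (ψ s)) x

/-- A maximal mild solution. -/
def IsMaximalMildSolution {m : ℕ} (V : Spc m → ℝ) (β σ p : ℝ) (ψ0 : Spc m → ℝ)
    (Tmax : ℝ≥0∞) (ψ : ℝ → Spc m → ℝ) : Prop :=
  IsMildSolution V β σ p ψ0 Tmax ψ ∧ 0 < Tmax ∧
    ∀ (Tmax' : ℝ≥0∞) (ψ' : ℝ → Spc m → ℝ), IsMildSolution V β σ p ψ0 Tmax' ψ' →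
      (∀ t ∈ Ico0 Tmax, ψ' t = ψ t) → Tmax' ≤ Tmax

/-- `L^p`-norm on the one-dimensional torus `𝕋`. -/
def LpN1 (p : ℝ) (g : ℝ → ℝ) : ℝ≥0∞ :=
  eLpNorm g (ENNReal.ofReal p) (volume.restrict (Set.Ico (0 : ℝ) 1))

/-- Membership in `L^p₀(𝕋^{m+1})`: periodic, `L^p` and of mean zero. -/
def MemL0 {m : ℕ} (p : ℝ) (f : Spc m → ℝ) : Prop :=
  IsPeriodic f ∧ Measurable f ∧ LpN p f < ⊤ ∧ (∫ x in cube m, f x) = 0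


instance instHaarSpc (m : ℕ) : (volume : Measure (Spc m)).IsAddHaarMeasure := by
  rw [Measure.volume_eq_prod]; infer_instance

open ENNReal (ofReal ofReal_add ofReal_le_ofReal ofReal_le_ofReal_iff ofReal_le_one ofReal_lt_ofReal_iff ofReal_lt_top ofReal_mul ofReal_natCast ofReal_ne_top ofReal_one ofReal_rpow_of_nonneg ofReal_rpow_of_pos ofReal_sum_of_nonneg ofReal_toReal)
open scoped Pointwise

lemma meas_cube1 (m : ℕ) : MeasurableSet (cube1 m) :=
  MeasurableSet.univ_pi fun _ => measurableSet_Ico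

lemma meas_cube (m : ℕ) : MeasurableSet (cube m) := measurableSet_Ico.prod (meas_cube1 m)

lemma vol_cube1 (m : ℕ) : volume (cube1 m) = 1 := by
  unfold cube1; rw [Real.volume_pi_Ico]; simp

lemma vol_cube (m : ℕ) : volume (cube m) = 1 := by
  unfold cube; rw [Measure.volume_eq_prod, Measure.prod_prod, vol_cube1]; simp

instance instProbT (m : ℕ) : IsProbabilityMeasure (μT m) :=
  ⟨by simp [μT, vol_cube]⟩

instance instProb1 (m : ℕ) : IsProbabilityMeasure (volume.restrict (cube1 m)) :=
  ⟨by simp [vol_cube1]⟩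

def lat {m : ℕ} : (ℤ × (Fin m → ℤ)) →+ Spc m where
  toFun k := ((k.1 : ℝ), fun i => (k.2 i : ℝ))
  map_zero' := by ext <;> simp
  map_add' a b := by ext <;> simp

def Lam (m : ℕ) : AddSubgroup (Spc m) := (lat (m := m)).range

instance (m : ℕ) : Countable (Lam m) := by
  unfold Lam
  have : Function.Surjective (lat (m := m)).rangeRestrict := AddMonoidHom.rangeRestrict_surjective _
  exact this.countable

lemma fd_cube (m : ℕ) : IsAddFundamentalDomain (Lam m) (cube m) volume := by
  refine IsAddFundamentalDomain.mk' (meas_cube m).nullMeasurableSet ?_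
  intro x
  refine ⟨⟨lat (-⌊x.1⌋, fun i => -⌊x.2 i⌋), _, rfl⟩, ?_, ?_⟩
  · simp only [AddSubgroup.vadd_def, vadd_eq_add, cube, cube1, lat, mem_prod]
    simp only [AddMonoidHom.coe_mk, ZeroHom.coe_mk, Prod.fst_add, Prod.snd_add, mem_Ico, mem_univ_pi,
      Pi.add_apply]
    refine ⟨⟨?_, ?_⟩, fun i => ⟨?_, ?_⟩⟩
    · push_cast; linarith [Int.floor_le x.1]
    · push_cast; linarith [Int.lt_floor_add_one x.1]
    · push_cast; linarith [Int.floor_le (x.2 i)]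
    · push_cast; linarith [Int.lt_floor_add_one (x.2 i)]
  · rintro ⟨_, ⟨k, rfl⟩⟩ hk
    simp only [AddSubgroup.vadd_def, vadd_eq_add, cube, cube1, lat, mem_prod] at hk
    simp only [AddMonoidHom.coe_mk, ZeroHom.coe_mk, Prod.fst_add, Prod.snd_add, mem_Ico, mem_univ_pi,
      Pi.add_apply] at hk
    obtain ⟨⟨h1, h2⟩, h3⟩ := hk
    congr 2
    refine Prod.ext ?_ (funext fun i => ?_)
    · have : ⌊x.1⌋ = -k.1 := by
        rw [Int.floor_eq_iff]; push_cast; constructor <;> linarith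
      simp [this]
    · have : ⌊x.2 i⌋ = -k.2 i := by
        rw [Int.floor_eq_iff]; push_cast; have := h3 i; constructor <;> linarith [(h3 i).1, (h3 i).2]
      simp [this]

def Per {m : ℕ} {α : Type*} (f : Spc m → α) : Prop := ∀ (g : Lam m) (x : Spc m), f (x + g) = f x

lemma per_iff {m : ℕ} (f : Spc m → ℝ) : IsPeriodic f ↔ Per f := by
  constructor
  · rintro h ⟨_, ⟨k, rfl⟩⟩ x
    exact h x k.1 k.2
  · intro h x k j
    exact h ⟨lat (k, j), _, rfl⟩ x

lemma lint_per {m : ℕ} {f : Spc m → ℝ≥0∞} (hf : Per f) (z : Spc m) :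
    ∫⁻ x in cube m, f (x + z) = ∫⁻ x in cube m, f x := by
  have h2 : IsAddFundamentalDomain (Lam m) (z +ᵥ cube m) volume :=
    (fd_cube m).vadd_of_comm z
  have h3 := (fd_cube m).setLIntegral_eq h2 f
    (fun g x => by rw [AddSubgroup.vadd_def, vadd_eq_add, add_comm]; exact hf g x)
  rw [h3]
  have : z +ᵥ cube m = (fun x => x + z) '' cube m := by
    rw [← Set.image_vadd]; exact image_congr fun x _ => add_comm _ _
  rw [this]
  rw [← (measurePreserving_add_right volume z).setLIntegral_comp_emb
    (measurableEmbedding_addRight z)]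

lemma int_per {m : ℕ} {E : Type*} [NormedAddCommGroup E] [NormedSpace ℝ E] {f : Spc m → E}
    (hf : Per f) (z : Spc m) :
    ∫ x in cube m, f (x + z) = ∫ x in cube m, f x := by
  have h2 : IsAddFundamentalDomain (Lam m) (z +ᵥ cube m) volume :=
    (fd_cube m).vadd_of_comm z
  have h3 := (fd_cube m).setIntegral_eq h2 (f := f)
    (fun g x => by rw [AddSubgroup.vadd_def, vadd_eq_add, add_comm]; exact hf g x)
  rw [h3]
  have : z +ᵥ cube m = (fun x => x + z) '' cube m := by
    rw [← Set.image_vadd]; exact image_congr fun x _ => add_comm _ _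
  rw [this]
  rw [← (measurePreserving_add_right volume z).setIntegral_image_emb
    (measurableEmbedding_addRight z)]

lemma Per.shift {m : ℕ} {α : Type*} {f : Spc m → α} (hf : Per f) (z : Spc m) :
    Per (fun x => f (x + z)) := fun g x => by
  show f (x + g + z) = f (x + z)
  rw [add_right_comm]; exact hf g _

lemma Per.comp {m : ℕ} {α β : Type*} {f : Spc m → α} (hf : Per f) (F : α → β) :
    Per (fun x => F (f x)) := fun g x => congrArg F (hf g x)

lemma Per.op {m : ℕ} {α β δ : Type*} {f : Spc m → α} {g : Spc m → β} (hf : Per f) (hg : Per g)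
    (F : α → β → δ) : Per (fun x => F (f x) (g x)) := fun k x => by
  show F _ _ = F _ _
  rw [hf k x, hg k x]

lemma Per.fderiv {m : ℕ} {f : Spc m → ℝ} (hf : Per f) : Per (fderiv ℝ f) := fun g x => by
  have : (fun y => f (y + g)) = f := funext fun y => hf g y
  rw [← fderiv_comp_add_right (f := f) (x := x) (g : Spc m), this]

lemma Per.pd {m : ℕ} {f : Spc m → ℝ} (hf : Per f) (v : Spc m) : Per (pd v f) := fun g x => by
  show _root_.fderiv ℝ f _ v = _root_.fderiv ℝ f _ v
  rw [hf.fderiv g x]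

lemma exists_rep {m : ℕ} (x : Spc m) : ∃ g : Lam m, x + g ∈ cube m := by
  refine ⟨⟨lat (-⌊x.1⌋, fun i => -⌊x.2 i⌋), _, rfl⟩, ?_⟩
  simp only [cube, cube1, lat, mem_prod]
  simp only [AddMonoidHom.coe_mk, ZeroHom.coe_mk, Prod.fst_add, Prod.snd_add, mem_Ico, mem_univ_pi,
      Pi.add_apply]
  refine ⟨⟨?_, ?_⟩, fun i => ⟨?_, ?_⟩⟩
  · push_cast; linarith [Int.floor_le x.1]
  · push_cast; linarith [Int.lt_floor_add_one x.1]
  · push_cast; linarith [Int.floor_le (x.2 i)]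
  · push_cast; linarith [Int.lt_floor_add_one (x.2 i)]

lemma cube_sub (m : ℕ) : cube m ⊆ Icc (0 : Spc m) 1 := by
  rintro ⟨a, b⟩ ⟨h1, h2⟩
  simp only [cube1, mem_univ_pi] at h2
  exact ⟨⟨h1.1, fun i => (h2 i).1⟩, ⟨h1.2.le, fun i => (h2 i).2.le⟩⟩

lemma per_bdd {m : ℕ} {E : Type*} [NormedAddCommGroup E] {f : Spc m → E} (hf : Per f)
    (hc : Continuous f) : ∃ C : ℝ, 0 ≤ C ∧ ∀ x, ‖f x‖ ≤ C := by
  obtain ⟨C, hC⟩ := (isCompact_Icc (a := (0 : Spc m)) (b := 1)).exists_bound_of_continuousOn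
    hc.continuousOn
  refine ⟨C, (norm_nonneg _).trans (hC 0 ⟨le_rfl, zero_le_one⟩), fun x => ?_⟩
  obtain ⟨g, hg⟩ := exists_rep x
  rw [← hf g x]
  exact hC _ (cube_sub m hg)

def dir {m : ℕ} : Option (Fin m) → Spc m
  | none => e1 m
  | some i => eC m i

def co {m : ℕ} : Option (Fin m) → Spc m →L[ℝ] ℝ
  | none => ContinuousLinearMap.fst ℝ ℝ (Fin m → ℝ)
  | some i => (ContinuousLinearMap.proj i).comp (ContinuousLinearMap.snd ℝ ℝ (Fin m → ℝ))

lemma sum_co {m : ℕ} (x : Spc m) : ∑ k, co k x • dir k = x := by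
  rw [Fintype.sum_option]
  refine Prod.ext ?_ (funext fun i => ?_)
  · simp [co, dir, e1, eC, Prod.fst_sum]
  · simp [co, dir, e1, eC, Prod.snd_sum, Pi.single_apply]

lemma abs_co_le {m : ℕ} (k : Option (Fin m)) (x : Spc m) : |co k x| ≤ ‖x‖ := by
  cases k with
  | none => exact norm_fst_le x
  | some i => exact (norm_le_pi_norm x.2 i).trans (norm_snd_le x)

lemma norm_dir {m : ℕ} (k : Option (Fin m)) : ‖(dir k : Spc m)‖ ≤ 1 := by
  cases k with
  | none => simp [dir, e1, Prod.norm_def]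
  | some i =>
    have : ‖(Pi.single i 1 : Fin m → ℝ)‖ ≤ 1 :=
      (pi_norm_le_iff_of_nonneg zero_le_one).2 fun j => by
        by_cases h : j = i <;> simp [h]
    simpa [dir, eC, Prod.norm_def] using this

lemma co_dir {m : ℕ} (k l : Option (Fin m)) : co k (dir l) = if k = l then 1 else 0 := by
  cases k <;> cases l <;> simp [co, dir, e1, eC, Pi.single_apply]

lemma clm_eq_sum {m : ℕ} (L : Spc m →L[ℝ] ℝ) (x : Spc m) : L x = ∑ k, co k x * L (dir k) := by
  conv_lhs => rw [← sum_co x]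
  simp [map_sum]

lemma clm_norm_le {m : ℕ} (L : Spc m →L[ℝ] ℝ) : ‖L‖ ≤ ∑ k, |L (dir k)| := by
  refine L.opNorm_le_bound (Finset.sum_nonneg fun _ _ => abs_nonneg _) fun x => ?_
  rw [clm_eq_sum L x, Finset.sum_mul]
  refine (norm_sum_le _ _).trans (Finset.sum_le_sum fun k _ => ?_)
  rw [Real.norm_eq_abs, abs_mul, mul_comm]
  exact mul_le_mul_of_nonneg_left (abs_co_le k x) (abs_nonneg _)

lemma abs_clm_dir_le {m : ℕ} (L : Spc m →L[ℝ] ℝ) (k : Option (Fin m)) : |L (dir k)| ≤ ‖L‖ := by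
  have := L.le_opNorm (dir k)
  calc |L (dir k)| ≤ ‖L‖ * ‖(dir k : Spc m)‖ := this
    _ ≤ ‖L‖ * 1 := by gcongr; exact norm_dir k
    _ = ‖L‖ := mul_one _

lemma finrank_spc (m : ℕ) : Module.finrank ℝ (Spc m) = m + 1 := by
  simp [Spc, Module.finrank_prod, add_comm]

lemma gradDot_eq {m : ℕ} (f g : Spc m → ℝ) (x : Spc m) :
    gradDot f g x = ∑ k, pd (dir k) f x * pd (dir k) g x := by
  rw [Fintype.sum_option]; rfl

lemma lap_eq {m : ℕ} (f : Spc m → ℝ) (x : Spc m) :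
    lap f x = ∑ k, pd (dir k) (pd (dir k) f) x := by
  rw [Fintype.sum_option]; rfl

lemma qd_eq {m : ℕ} (z : Spc m) : qd z = ∑ k, co k z ^ 2 := by
  rw [Fintype.sum_option]; rfl

lemma norm_sq_le_qd {m : ℕ} (z : Spc m) : ‖z‖ ^ 2 ≤ qd z := by
  have h0 : 0 ≤ qd z := by unfold qd; positivity
  have hs := Real.sq_sqrt h0
  rw [← hs]
  apply pow_le_pow_left₀ (norm_nonneg _)
  rw [Prod.norm_def]
  apply max_le
  · apply Real.le_sqrt_of_sq_le
    rw [Real.norm_eq_abs, sq_abs]; unfold qd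
    have : 0 ≤ ∑ i, z.2 i ^ 2 := by positivity
    linarith
  · rw [pi_norm_le_iff_of_nonneg (Real.sqrt_nonneg _)]
    intro i
    apply Real.le_sqrt_of_sq_le
    rw [Real.norm_eq_abs, sq_abs]; unfold qd
    have := Finset.single_le_sum (f := fun i => z.2 i ^ 2) (fun _ _ => sq_nonneg _)
      (Finset.mem_univ i)
    nlinarith [sq_nonneg z.1]

lemma qd_cont (m : ℕ) : Continuous (qd (m := m)) := by unfold qd; fun_prop

lemma qd_nonneg {m : ℕ} (z : Spc m) : 0 ≤ qd z := by unfold qd; positivity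

lemma int_exp_qd (m : ℕ) {c : ℝ} (hc : 0 < c) :
    Integrable (fun z : Spc m => Real.exp (-c * qd z)) := by
  have h1 := integrable_exp_neg_mul_sq hc
  have h2 : Integrable (fun y : Fin m → ℝ => ∏ i, Real.exp (-c * y i ^ 2)) :=
    Integrable.fintype_prod (f := fun _ x => Real.exp (-c * x ^ 2)) fun i => h1
  have h3 := h1.mul_prod h2
  refine h3.congr (Eventually.of_forall fun z => ?_)
  simp only
  rw [← Real.exp_sum, ← Real.exp_add, qd, mul_add, Finset.mul_sum]

def gk {m : ℕ} (z : Spc m) : ℝ := Real.exp (-(1/2) * qd z)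

lemma gk_int (m : ℕ) : Integrable (gk (m := m)) := int_exp_qd m (by norm_num)

lemma gk_pos {m : ℕ} (z : Spc m) : 0 < gk z := Real.exp_pos _

lemma gk_cont (m : ℕ) : Continuous (gk (m := m)) := by
  unfold gk; have := qd_cont m; fun_prop

def Zc (m : ℕ) : ℝ := ∫ z : Spc m, gk z

lemma Zc_pos (m : ℕ) : 0 < Zc m :=
  integral_pos_of_integrable_nonneg_nonzero (x := 0) (gk_cont m) (gk_int m)
    (fun z => (gk_pos z).le) (gk_pos _).ne'

def rho {m : ℕ} (z : Spc m) : ℝ := gk z / Zc m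

lemma rho_pos {m : ℕ} (z : Spc m) : 0 < rho z := div_pos (gk_pos z) (Zc_pos m)

lemma rho_cont (m : ℕ) : Continuous (rho (m := m)) := (gk_cont m).div_const _

lemma rho_int (m : ℕ) : Integrable (rho (m := m)) := (gk_int m).div_const _

lemma rho_one (m : ℕ) : ∫ z : Spc m, rho z = 1 := by
  unfold rho; rw [integral_div]; exact div_self (Zc_pos m).ne'

def gam (m : ℕ) : Measure (Spc m) := volume.withDensity fun z => ofReal (rho z)

lemma meas_rho (m : ℕ) : Measurable fun z : Spc m => ofReal (rho z) :=
  (rho_cont m).measurable.ennreal_ofReal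

instance instGam (m : ℕ) : IsProbabilityMeasure (gam m) := by
  constructor
  rw [gam, withDensity_apply _ MeasurableSet.univ, Measure.restrict_univ,
    ← ofReal_integral_eq_lintegral_ofReal (rho_int m) (Eventually.of_forall fun z => (rho_pos z).le),
    rho_one, ofReal_one]

lemma gam_int {m : ℕ} (f : Spc m → ℝ) : ∫ z, f z ∂(gam m) = ∫ z, rho z * f z := by
  rw [gam, integral_withDensity_eq_integral_toReal_smul (meas_rho m)
    (Eventually.of_forall fun _ => ofReal_lt_top)]
  refine integral_congr_ae (Eventually.of_forall fun z => ?_)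
  simp only [ENNReal.toReal_ofReal (rho_pos z).le, smul_eq_mul]

lemma gam_integrable {m : ℕ} (f : Spc m → ℝ) :
    Integrable f (gam m) ↔ Integrable (fun z => rho z * f z) := by
  rw [gam, integrable_withDensity_iff_integrable_smul' (meas_rho m)
    (Eventually.of_forall fun _ => ofReal_lt_top)]
  refine integrable_congr (Eventually.of_forall fun z => ?_)
  simp only [ENNReal.toReal_ofReal (rho_pos z).le, smul_eq_mul]

lemma gam_pow (m k : ℕ) : Integrable (fun z : Spc m => ‖z‖ ^ k) (gam m) := by
  rw [gam_integrable]
  have h := (int_exp_qd m (c := 1/4) (by norm_num)).const_mul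
    ((1 + k.factorial * 4 ^ k) / Zc m)
  refine h.mono' (((rho_cont m).mul (by fun_prop)).aestronglyMeasurable)
    (Eventually.of_forall fun z => ?_)
  have hq := qd_nonneg z
  have h1 : ‖z‖ ^ k ≤ 1 + qd z ^ k := by
    rcases le_total ‖z‖ 1 with h | h
    · have := pow_le_one₀ (n := k) (norm_nonneg z) h
      have : 0 ≤ qd z ^ k := by positivity
      linarith
    · have h2 : ‖z‖ ≤ qd z := le_trans (by nlinarith) (norm_sq_le_qd z)
      have := pow_le_pow_left₀ (norm_nonneg z) h2 k
      linarith
  have h2 := Real.pow_div_factorial_le_exp (qd z / 4) (by positivity) k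
  have h3 : qd z ^ k ≤ k.factorial * 4 ^ k * Real.exp (qd z / 4) := by
    rw [div_pow, div_div, div_le_iff₀ (by positivity)] at h2
    linarith
  have h4 : (1:ℝ) ≤ Real.exp (qd z / 4) := Real.one_le_exp (by positivity)
  have h5 : ‖z‖ ^ k ≤ (1 + k.factorial * 4 ^ k) * Real.exp (qd z / 4) := by nlinarith
  rw [Real.norm_eq_abs, abs_of_nonneg (mul_nonneg (rho_pos z).le (by positivity))]
  calc rho z * ‖z‖ ^ k ≤ rho z * ((1 + k.factorial * 4 ^ k) * Real.exp (qd z / 4)) := by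
        gcongr; exact (rho_pos z).le
    _ = _ := by
      unfold rho gk
      have : Real.exp (-(1/4) * qd z) = Real.exp (-(1/2) * qd z) * Real.exp (qd z / 4) := by
        rw [← Real.exp_add]; congr 1; ring
      rw [this]; ring

lemma gam_poly {m : ℕ} {f : Spc m → ℝ} (hf : AEStronglyMeasurable f (gam m)) {C : ℝ} {k : ℕ}
    (h : ∀ z, |f z| ≤ C * (1 + ‖z‖ ^ k)) : Integrable f (gam m) :=
  ((((integrable_const 1).add (gam_pow m k)).const_mul C)).mono' hf (Eventually.of_forall h)

lemma gk_hasFDeriv {m : ℕ} (z : Spc m) (k : Option (Fin m)) :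
    DifferentiableAt ℝ (rho (m := m)) z ∧ fderiv ℝ rho z (dir k) = - (co k z * rho z) := by
  have h1 : HasFDerivAt (qd (m := m)) (∑ l, (2 * co l z) • (co l : Spc m →L[ℝ] ℝ)) z := by
    have : (qd (m := m)) = fun z => ∑ l, co l z ^ 2 := funext qd_eq
    rw [this]
    refine HasFDerivAt.fun_sum fun l _ => ?_
    have := ((co l).hasFDerivAt (x := z)).pow 2
    have e : (2 * co l z) • (co l : Spc m →L[ℝ] ℝ) = (2 • (co l) z ^ (2 - 1)) • co l := by simp
    rw [e]; exact this
  have h2 : HasFDerivAt (rho (m := m)) ((Zc m)⁻¹ • (Real.exp (-(1/2) * qd z) •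
      ((-(1/2) : ℝ) • ∑ l, (2 * co l z) • (co l : Spc m →L[ℝ] ℝ)))) z := by
    have := ((h1.const_mul (-(1/2))).exp).const_mul (Zc m)⁻¹
    refine this.congr_of_eventuallyEq (Eventually.of_forall fun y => ?_)
    simp only [rho, gk]; ring
  refine ⟨h2.differentiableAt, ?_⟩
  rw [h2.fderiv]
  have : (∑ l, (2 * co l z) • (co l : Spc m →L[ℝ] ℝ)) (dir k) = 2 * co k z := by
    rw [sum_apply]
    simp only [smul_apply, co_dir, smul_eq_mul, mul_ite, mul_one, mul_zero, Finset.sum_ite_eq',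
      Finset.mem_univ, if_true]
  simp only [smul_apply, this, smul_eq_mul, rho, gk]
  ring

lemma stein {m : ℕ} {f : Spc m → ℝ} (hf : Differentiable ℝ f) (k : Option (Fin m))
    (hc : Continuous fun z => fderiv ℝ f z (dir k)) {C : ℝ} {N : ℕ}
    (h1 : ∀ z, |f z| ≤ C * (1 + ‖z‖ ^ N)) (h2 : ∀ z, |fderiv ℝ f z (dir k)| ≤ C * (1 + ‖z‖ ^ N)) :
    ∫ z, co k z * f z ∂(gam m) = ∫ z, fderiv ℝ f z (dir k) ∂(gam m) := by
  have i1 : Integrable f (gam m) := gam_poly hf.continuous.aestronglyMeasurable h1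
  have i2 : Integrable (fun z => fderiv ℝ f z (dir k)) (gam m) :=
    gam_poly hc.aestronglyMeasurable h2
  have hC : 0 ≤ C := by
    have := (abs_nonneg _).trans (h1 0)
    exact nonneg_of_mul_nonneg_left this (by positivity)
  have i3 : Integrable (fun z => co k z * f z) (gam m) := by
    refine (((gam_pow m 1).add (gam_pow m (N+1))).const_mul C).mono'
      ((co k).continuous.mul hf.continuous).aestronglyMeasurable (Eventually.of_forall fun z => ?_)
    rw [norm_mul]
    calc _ ≤ ‖z‖ * (C * (1 + ‖z‖ ^ N)) := by
          gcongr
          · exact abs_co_le k z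
          · exact h1 z
      _ = _ := by simp only [Pi.add_apply]; ring
  rw [gam_int, gam_int]
  rw [gam_integrable] at i1 i2 i3
  rw [integral_mul_fderiv_eq_neg_fderiv_mul_of_integrable _ i2 i1
    (fun z _ => (gk_hasFDeriv z k).1) (fun z _ => hf z)]
  · rw [← integral_neg]
    congr 1; ext z
    rw [(gk_hasFDeriv z k).2]; ring
  · refine i3.neg.congr (Eventually.of_forall fun z => ?_)
    simp only [Pi.neg_apply]
    rw [(gk_hasFDeriv z k).2]; ring

lemma gam_avg (m : ℕ) : ∃ C : ℝ, 0 < C ∧ ∀ (a : ℝ), 0 < a → a ≤ 1 → ∀ (h : Spc m → ℝ≥0∞),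
    Measurable h → Per h → ∀ y : Spc m,
    ∫⁻ z, h (y + a • z) ∂(gam m) ≤ ofReal (C * a ^ (-((m:ℝ) + 1))) *
      ∫⁻ x in cube m, h x := by
  have hqd : ∀ z v : Spc m, v ∈ cube m → qd (z - v) ≤ 2 * qd z + 2 * (m + 1) := by
    intro z v hv
    have hb := cube_sub m hv
    rw [qd_eq, qd_eq, Finset.mul_sum]
    have : (2 * (m + 1) : ℝ) = ∑ k : Option (Fin m), 2 := by simp [mul_comm]
    rw [this, ← Finset.sum_add_distrib]
    refine Finset.sum_le_sum fun k _ => ?_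
    rw [map_sub]
    have h1 : 0 ≤ co k v ∧ co k v ≤ 1 := by
      cases k with
      | none => exact ⟨hb.1.1, hb.2.1⟩
      | some i => exact ⟨hb.1.2 i, hb.2.2 i⟩
    nlinarith [sq_nonneg (co k z + co k v)]
  set K : ℝ := Real.exp ((m+1)/2) / Zc m with hK
  have hKpos : 0 < K := div_pos (Real.exp_pos _) (Zc_pos m)
  have hrho : ∀ z v : Spc m, v ∈ cube m → rho z ≤ K * Real.exp (-(1/4) * qd (z - v)) := by
    intro z v hv
    have := hqd z v hv
    unfold rho gk
    rw [hK, div_mul_eq_mul_div, ← Real.exp_add]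
    gcongr
    · exact (Zc_pos m).le
    · linarith
  set I : ℝ := ∫ z : Spc m, Real.exp (-(1/4) * qd z)
  have hI : 0 ≤ I := integral_nonneg fun z => (Real.exp_pos _).le
  refine ⟨K * I + 1, by positivity, fun a ha ha1 h hm hp y => ?_⟩
  have hE : ∫⁻ z : Spc m, ofReal (Real.exp (-(1/4) * qd z)) = ofReal I :=
    (ofReal_integral_eq_lintegral_ofReal (int_exp_qd m (by norm_num))
      (Eventually.of_forall fun z => (Real.exp_pos _).le)).symm
  have hmc : Measurable fun z : Spc m => ofReal (Real.exp (-(1/4) * qd z)) := by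
    have := (qd_cont m).measurable
    fun_prop
  have hsc : ∀ z : Spc m, ∫⁻ v in cube m, h (y + a • z + a • v) ≤
      ofReal (a ^ (-((m:ℝ) + 1))) * ∫⁻ x in cube m, h x := by
    intro z
    set c := y + a • z
    have e1 : ∀ v, v ∈ cube m → a • v ∈ cube m := by
      rintro ⟨v1, v2⟩ ⟨h1, h2⟩
      simp only [cube1, mem_univ_pi] at h2
      refine ⟨⟨mul_nonneg ha.le h1.1, ?_⟩, ?_⟩
      · exact lt_of_le_of_lt (mul_le_of_le_one_left h1.1 ha1) h1.2
      · simp only [cube1, mem_univ_pi]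
        exact fun i => ⟨mul_nonneg ha.le (h2 i).1,
          lt_of_le_of_lt (mul_le_of_le_one_left (h2 i).1 ha1) (h2 i).2⟩
    set G : Spc m → ℝ≥0∞ := (cube m).indicator fun w => h (c + w)
    have hG : Measurable G := Measurable.indicator (by fun_prop) (meas_cube m)
    calc ∫⁻ v in cube m, h (c + a • v) ≤ ∫⁻ v in cube m, G (a • v) := by
          refine setLIntegral_mono' (meas_cube m) fun v hv => ?_
          simp only [G, indicator_of_mem (e1 v hv)]; exact le_rfl
      _ ≤ ∫⁻ v, G (a • v) := setLIntegral_le_lintegral _ _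
      _ = ∫⁻ w, G w ∂(Measure.map (a • ·) volume) := by
          rw [lintegral_map hG (by fun_prop)]
      _ = _ := by
          rw [Measure.map_addHaar_smul _ ha.ne', lintegral_smul_measure, finrank_spc,
            lintegral_indicator (meas_cube m)]
          congr 1
          · rw [abs_of_pos (by positivity), Real.rpow_neg ha.le, ← Real.rpow_natCast]; norm_cast
          · rw [← lint_per hp c]; congr 1; ext w; rw [add_comm]
  calc ∫⁻ z, h (y + a • z) ∂(gam m)
      = ∫⁻ z, ofReal (rho z) * h (y + a • z) := by
        rw [gam, lintegral_withDensity_eq_lintegral_mul _ (meas_rho m) (by fun_prop)]; rfl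
    _ = ∫⁻ z, ∫⁻ v in cube m, ofReal (rho z) * h (y + a • z) := by
        congr 1; ext z
        rw [lintegral_const, Measure.restrict_apply_univ, vol_cube, mul_one]
    _ ≤ ∫⁻ z, ∫⁻ v in cube m, ofReal (K * Real.exp (-(1/4) * qd (z - v))) * h (y + a • z) := by
        refine lintegral_mono fun z => setLIntegral_mono' (meas_cube m) fun v hv => ?_
        gcongr
        exact hrho z v hv
    _ = ∫⁻ v in cube m, ∫⁻ z, ofReal (K * Real.exp (-(1/4) * qd (z - v))) * h (y + a • z) := by
        rw [lintegral_lintegral_swap]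
        have := (qd_cont m).measurable
        fun_prop
    _ = ∫⁻ v in cube m, ∫⁻ z, ofReal (K * Real.exp (-(1/4) * qd z)) *
          h (y + a • z + a • v) := by
        congr 1; ext v
        rw [← lintegral_add_right_eq_self (fun z => ofReal (K * Real.exp (-(1/4) * qd (z - v)))
          * h (y + a • z)) v]
        congr 1; ext z
        rw [add_sub_cancel_right, smul_add, add_assoc]
    _ = ∫⁻ z, ofReal (K * Real.exp (-(1/4) * qd z)) *
          ∫⁻ v in cube m, h (y + a • z + a • v) := by
        have := (qd_cont m).measurable
        rw [lintegral_lintegral_swap (by fun_prop)]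
        congr 1; ext z
        rw [lintegral_const_mul _ (by fun_prop)]
    _ ≤ ∫⁻ z, ofReal (K * Real.exp (-(1/4) * qd z)) *
          (ofReal (a ^ (-((m:ℝ) + 1))) * ∫⁻ x in cube m, h x) := by
        gcongr with z; exact hsc z
    _ ≤ _ := by
        have := (qd_cont m).measurable
        rw [lintegral_mul_const _ (by fun_prop)]
        simp_rw [ofReal_mul hKpos.le]
        rw [lintegral_const_mul _ hmc, hE, ← mul_assoc, ← ofReal_mul hKpos.le,
          ← ofReal_mul (by positivity)]
        gcongr
        linarith

open scoped Topology Convolution ContDiff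

def Tst {m : ℕ} (η : Spc m → ℝ) : Prop := ContDiff ℝ ∞ η ∧ Per η

lemma Tst.cont {m : ℕ} {η : Spc m → ℝ} (h : Tst η) : Continuous η := h.1.continuous

lemma Tst.diff {m : ℕ} {η : Spc m → ℝ} (h : Tst η) : Differentiable ℝ η :=
  h.1.differentiable (by simp)

lemma Tst.pd {m : ℕ} {η : Spc m → ℝ} (h : Tst η) (v : Spc m) : Tst (pd v η) := by
  refine ⟨?_, h.2.pd v⟩
  have h1 : ContDiff ℝ ∞ (fderiv ℝ η) := h.1.fderiv_right (by simp)
  exact h1.clm_apply contDiff_const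

lemma Tst.shift {m : ℕ} {η : Spc m → ℝ} (h : Tst η) (v : Spc m) : Tst (fun x => η (x + v)) :=
  ⟨h.1.comp (by fun_prop), h.2.shift v⟩

lemma Tst.sub {m : ℕ} {η ζ : Spc m → ℝ} (h : Tst η) (h' : Tst ζ) : Tst (fun x => η x - ζ x) :=
  ⟨h.1.sub h'.1, h.2.op h'.2 _⟩

def np {m : ℕ} (q : ℝ) (f : Spc m → ℝ) : ℝ := (∫ x in cube m, |f x| ^ q) ^ (1 / q)

lemma np_nonneg {m : ℕ} (q : ℝ) (f : Spc m → ℝ) : 0 ≤ np q f :=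
  Real.rpow_nonneg (integral_nonneg fun _ => by positivity) _

lemma np_shift {m : ℕ} (q : ℝ) {f : Spc m → ℝ} (hf : Per f) (z : Spc m) :
    np q (fun x => f (x + z)) = np q f := by
  unfold np; rw [int_per (hf.comp fun t => |t| ^ q) z]

lemma per_int {m : ℕ} {f : Spc m → ℝ} (hf : Per f) (hc : Continuous f) :
    IntegrableOn f (cube m) := by
  obtain ⟨C, _, hC⟩ := per_bdd hf hc
  have : Integrable f (μT m) := Integrable.of_bound hc.aestronglyMeasurable C (Eventually.of_forall hC)
  exact this

lemma per_memLp {m : ℕ} {f : Spc m → ℝ} (hf : Per f) (hc : Continuous f) (r : ℝ≥0∞) :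
    MemLp f r (volume.restrict (cube m)) := by
  obtain ⟨C, _, hC⟩ := per_bdd hf hc
  have : MemLp f r (μT m) := MemLp.of_bound hc.aestronglyMeasurable C (Eventually.of_forall hC)
  exact this

lemma holder' {m : ℕ} {p q : ℝ} (hpq : p.HolderConjugate q) {w η : Spc m → ℝ}
    (hw : MemLp w (ofReal p) (volume.restrict (cube m)))
    (h2 : MemLp η (ofReal q) (volume.restrict (cube m))) :
    |∫ x in cube m, w x * η x| ≤ np p w * np q η := by
  calc |∫ x in cube m, w x * η x| ≤ ∫ x in cube m, |w x| * |η x| := by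
        rw [← Real.norm_eq_abs]
        refine (norm_integral_le_integral_norm _).trans_eq ?_
        simp only [norm_mul, Real.norm_eq_abs]
    _ ≤ _ := integral_mul_le_Lp_mul_Lq_of_nonneg hpq (Eventually.of_forall fun _ => abs_nonneg _)
        (Eventually.of_forall fun _ => abs_nonneg _) hw.abs h2.abs

lemma holder {m : ℕ} {p q : ℝ} (hpq : p.HolderConjugate q) {w η : Spc m → ℝ}
    (hw : MemLp w (ofReal p) (volume.restrict (cube m))) (hη : Per η) (hc : Continuous η) :
    |∫ x in cube m, w x * η x| ≤ np p w * np q η :=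
  holder' hpq hw (per_memLp hη hc _)

lemma per_unif {m : ℕ} {g : Spc m → ℝ} (hg : Per g) (hc : Continuous g) {ε : ℝ} (hε : 0 < ε) :
    ∃ δ > 0, ∀ x y, dist y x < δ → dist (g y) (g x) < ε := by
  have hK := isCompact_Icc (a := (-1 : Spc m)) (b := 2)
  have hu := hK.uniformContinuousOn_of_continuous hc.continuousOn
  rw [Metric.uniformContinuousOn_iff] at hu
  obtain ⟨δ, hδ, h⟩ := hu ε hε
  refine ⟨min δ 1, by positivity, fun x y hxy => ?_⟩
  obtain ⟨k, hk⟩ := exists_rep x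
  rw [← hg k x, ← hg k y]
  have hd : dist (y + k) (x + k) < min δ 1 := by rwa [dist_add_right]
  have hx := cube_sub m hk
  set X : Spc m := x + k
  set Y : Spc m := y + k
  have hYX : ‖Y - X‖ < 1 := by rw [← dist_eq_norm]; exact hd.trans_le (min_le_right _ _)
  refine h _ ?_ _ ?_ (hd.trans_le (min_le_left _ _))
  · have h1 : ‖Y.1 - X.1‖ < 1 := lt_of_le_of_lt (norm_fst_le (Y - X)) hYX
    have h2 : ∀ i, ‖Y.2 i - X.2 i‖ < 1 := fun i =>
      lt_of_le_of_lt ((norm_le_pi_norm (Y.2 - X.2) i).trans (norm_snd_le (Y - X))) hYX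
    simp only [Real.norm_eq_abs, abs_lt] at h1 h2
    obtain ⟨⟨a1, a2⟩, ⟨b1, b2⟩⟩ := hx
    simp only [Prod.fst_zero, Prod.snd_zero, Prod.fst_one, Prod.snd_one] at a1 a2 b1 b2
    refine ⟨⟨?_, fun i => ?_⟩, ⟨?_, fun i => ?_⟩⟩
    · show (-1 : ℝ) ≤ Y.1
      linarith [h1.1]
    · show (-1 : ℝ) ≤ Y.2 i
      have := a2 i; simp only [Pi.zero_apply] at this; linarith [(h2 i).1]
    · show Y.1 ≤ (2:ℝ)
      linarith [h1.2]
    · show Y.2 i ≤ (2:ℝ)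
      have := b2 i; simp only [Pi.one_apply] at this; linarith [(h2 i).2]
  · refine ⟨le_trans ?_ hx.1, hx.2.trans ?_⟩
    · exact neg_nonpos.2 zero_le_one
    · exact one_le_two

lemma moll {m : ℕ} {g : Spc m → ℝ} (hg : Per g) (hc : Continuous g) {ε : ℝ} (hε : 0 < ε) :
    ∃ η, Tst η ∧ (∀ x, |η x - g x| ≤ ε) ∧ ((∀ x, 0 ≤ g x) → ∀ x, 0 ≤ η x) ∧
      ∀ v, (∀ x, g (x + v) = g x) → ∀ x, η (x + v) = η x := by
  obtain ⟨δ, hδ, hu⟩ := per_unif hg hc hε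
  let φ : ContDiffBump (0 : Spc m) := ⟨δ/2, δ, by positivity, by linarith⟩
  set η : Spc m → ℝ := φ.normed volume ⋆[ContinuousLinearMap.lsmul ℝ ℝ, volume] g with hη
  have hinv : ∀ v, (∀ x, g (x + v) = g x) → ∀ x, η (x + v) = η x := by
    intro v hv x
    simp only [hη, convolution_def]
    congr 1; ext t
    rw [← hv (x - t)]; congr 2; abel
  refine ⟨η, ⟨?_, fun k => hinv k (hg k)⟩, fun x => ?_, fun h0 x => ?_, hinv⟩
  · exact HasCompactSupport.contDiff_convolution_left _ φ.hasCompactSupport_normed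
      φ.contDiff_normed hc.locallyIntegrable
  · rw [← Real.dist_eq]
    exact φ.dist_normed_convolution_le hc.aestronglyMeasurable fun y hy => (hu x y hy).le
  · exact integral_nonneg fun t => mul_nonneg (φ.nonneg_normed t) (h0 _)

lemma ext_test {m : ℕ} {q C : ℝ} (hq : 1 ≤ q) {f : Spc m → ℝ} (hf : Per f) (hfc : Continuous f)
    (h : ∀ η, Tst η → ∫ x in cube m, f x * η x ≤ C * np q η) {g : Spc m → ℝ} (hg : Per g)
    (hgc : Continuous g) : ∫ x in cube m, f x * g x ≤ C * np q g := by
  choose η h1 h2 _ _ using fun n : ℕ => moll hg hgc (ε := 1 / ((n : ℝ) + 1)) (by positivity)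
  obtain ⟨Kf, hKf0, hKf⟩ := per_bdd hf hfc
  obtain ⟨Kg, hKg0, hKg⟩ := per_bdd hg hgc
  have hle : ∀ n : ℕ, 1 / ((n : ℝ) + 1) ≤ 1 := fun n => by
    rw [div_le_one (by positivity)]; linarith [(Nat.cast_nonneg n : (0:ℝ) ≤ n)]
  have hb : ∀ n x, |η n x| ≤ Kg + 1 := fun n x => by
    have := h2 n x
    have h3 := hKg x
    rw [Real.norm_eq_abs] at h3
    have := abs_sub_abs_le_abs_sub (η n x) (g x)
    linarith [hle n, h2 n x]
  have hlim : ∀ x, Tendsto (fun n => η n x) atTop (𝓝 (g x)) := fun x => by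
    rw [tendsto_iff_dist_tendsto_zero]
    exact squeeze_zero (fun _ => dist_nonneg) (fun n => h2 n x) tendsto_one_div_add_atTop_nhds_zero_nat
  have : IsFiniteMeasure (volume.restrict (cube m)) := (inferInstance : IsFiniteMeasure (μT m))
  have t1 : Tendsto (fun n => ∫ x in cube m, f x * η n x) atTop (𝓝 (∫ x in cube m, f x * g x)) := by
    refine tendsto_integral_of_dominated_convergence (fun _ => Kf * (Kg + 1))
      (fun n => (hfc.mul (h1 n).cont).aestronglyMeasurable) (integrable_const _)
      (fun n => Eventually.of_forall fun x => ?_) (Eventually.of_forall fun x => ?_)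
    · rw [norm_mul]; gcongr; exacts [hKf x, hb n x]
    · exact (hlim x).const_mul _
  have t2 : Tendsto (fun n => C * np q (η n)) atTop (𝓝 (C * np q g)) := by
    refine Tendsto.const_mul _ (Tendsto.rpow_const ?_ (Or.inr (by positivity)))
    refine tendsto_integral_of_dominated_convergence (fun _ => (Kg + 1) ^ q)
      (fun n => ?_) (integrable_const _)
      (fun n => Eventually.of_forall fun x => ?_) (Eventually.of_forall fun x => ?_)
    · exact ((h1 n).cont.abs.rpow_const fun _ => Or.inr (by positivity)).aestronglyMeasurable
    · rw [Real.norm_eq_abs, abs_of_nonneg (by positivity)]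
      gcongr; exact hb n x
    · exact (hlim x).abs.rpow_const (Or.inr (by positivity))
  exact le_of_tendsto_of_tendsto' t1 t2 fun n => h _ (h1 n)

lemma dual_p {m : ℕ} {p q C : ℝ} (hpq : p.HolderConjugate q) (hC : 0 ≤ C)
    {f : Spc m → ℝ} (hf : Per f) (hfc : Continuous f)
    (h : ∀ η, Tst η → ∫ x in cube m, f x * η x ≤ C * np q η) : np p f ≤ C := by
  have hp := hpq.lt
  set g : Spc m → ℝ := fun x => |f x| ^ (p - 1) * SignType.sign (f x) with hg
  have hfg : ∀ x, f x * g x = |f x| ^ p := fun x => by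
    simp only [hg]
    rw [mul_left_comm, self_mul_sign, mul_comm]
    rcases eq_or_ne (f x) 0 with h0 | h0
    · simp [h0, hpq.ne_zero]
    · nth_rw 1 [← Real.rpow_one |f x|]
      rw [← Real.rpow_add (by positivity)]; ring_nf
  have hgq : ∀ x, |g x| ^ q = |f x| ^ p := fun x => by
    rcases eq_or_ne (f x) 0 with h0 | h0
    · simp [hg, h0, hpq.ne_zero, hpq.symm.ne_zero]
    · simp only [hg]
      have : |((SignType.sign (f x) : SignType) : ℝ)| = 1 := by
        rcases lt_or_gt_of_ne h0 with h | h <;> simp [h]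
      rw [abs_mul, this, mul_one, abs_of_nonneg (by positivity), ← Real.rpow_mul (abs_nonneg _),
        hpq.sub_one_mul_conj]
  have hgc : Continuous g := by
    rw [continuous_iff_continuousAt]
    intro x
    rcases eq_or_ne (f x) 0 with h0 | h0
    · have e0 : g x = 0 := by simp [hg, h0]
      unfold ContinuousAt
      rw [e0]
      have : Tendsto (fun y => |f y| ^ (p-1)) (𝓝 x) (𝓝 0) := by
        have := (hfc.abs.rpow_const (p := p - 1) fun _ => Or.inr (by linarith)).tendsto x
        simpa [h0, (by linarith : p - 1 ≠ 0)] using this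
      refine squeeze_zero_norm (fun y => ?_) this
      simp only [hg]
      rw [norm_mul, Real.norm_eq_abs, abs_of_nonneg (by positivity : 0 ≤ |f y| ^ (p-1))]
      refine mul_le_of_le_one_right (by positivity) ?_
      rcases lt_trichotomy (f y) 0 with h | h | h <;> simp [h]
    · refine ContinuousAt.mul ?_ ?_
      · exact (hfc.abs.rpow_const (p := p - 1) fun _ => Or.inr (by linarith)).continuousAt
      · have : ContinuousAt (fun y => (SignType.sign (f y))) x :=
          (continuousAt_sign_of_ne_zero h0).comp hfc.continuousAt
        exact (continuous_of_discreteTopology (f := fun s : SignType => (s : ℝ))).continuousAt.comp this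
  have hgp : Per g := hf.comp fun t => |t| ^ (p - 1) * SignType.sign t
  have key := ext_test hpq.symm.lt.le hf hfc h hgp hgc
  simp only [np, hfg, hgq] at key ⊢
  set I := ∫ x in cube m, |f x| ^ p
  have hI : 0 ≤ I := integral_nonneg fun x => by positivity
  rcases hI.eq_or_lt with h0 | h0
  · rw [← h0, Real.zero_rpow (by have := hpq.pos; positivity)]; exact hC
  · have e : I = I ^ (1/p) * I ^ (1/q) := by
      rw [← Real.rpow_add h0]
      have := hpq.inv_add_inv_eq_one
      rw [one_div, one_div, this, Real.rpow_one]
    have key' : I ^ (1/p) * I ^ (1/q) ≤ C * I ^ (1/q) := by rw [← e]; exact key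
    exact le_of_mul_le_mul_right key' (by positivity)

lemma per_zero {m : ℕ} {f : Spc m → ℝ} (hf : Per f) (hfc : Continuous f) (h0 : ∀ x, 0 ≤ f x)
    (h : ∫ x in cube m, f x ≤ 0) (x : Spc m) : f x = 0 := by
  by_contra hx
  have hpos : 0 < f x := lt_of_le_of_ne (h0 x) (Ne.symm hx)
  obtain ⟨δ, hδ, hu⟩ := per_unif hf hfc (half_pos hpos)
  have h1 : ∫ y in cube m, f y = 0 := le_antisymm h (integral_nonneg h0)
  rw [← int_per hf x] at h1
  rw [integral_eq_zero_iff_of_nonneg (fun y => h0 _) (per_int (hf.shift x) (by fun_prop))] at h1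
  have hsub : Ioo (0:ℝ) (min δ 1) ×ˢ (Set.pi univ fun _ : Fin m => Ioo (0:ℝ) (min δ 1)) ⊆
      {y | ¬ (fun y => f (y + x)) y = (0 : Spc m → ℝ) y} ∩ cube m := by
    rintro ⟨y1, y2⟩ ⟨hy1, hy2⟩
    simp only [mem_univ_pi] at hy2
    refine ⟨?_, ⟨⟨hy1.1.le, hy1.2.trans_le (min_le_right _ _)⟩, ?_⟩⟩
    · have hd : dist ((y1, y2) + x) x < δ := by
        rw [dist_eq_norm, add_sub_cancel_right, Prod.norm_def, max_lt_iff]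
        refine ⟨?_, ?_⟩
        · simp only [Real.norm_eq_abs, abs_of_pos hy1.1]; exact hy1.2.trans_le (min_le_left _ _)
        · simp only
          rw [pi_norm_lt_iff hδ]
          intro i
          rw [Real.norm_eq_abs, abs_of_pos (hy2 i).1]; exact (hy2 i).2.trans_le (min_le_left _ _)
      have := hu x _ hd
      rw [Real.dist_eq, abs_lt] at this
      simp only [mem_ofPred_eq, Pi.zero_apply]
      intro h; rw [h] at this; linarith [this.1]
    · simp only [cube1, mem_univ_pi]
      exact fun i => ⟨(hy2 i).1.le, (hy2 i).2.trans_le (min_le_right _ _)⟩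
  have hz := measure_mono_null hsub (by
    rw [← Measure.restrict_apply' (meas_cube m)]; exact h1)
  have hop : IsOpen (Ioo (0:ℝ) (min δ 1) ×ˢ (Set.pi univ fun _ : Fin m => Ioo (0:ℝ) (min δ 1))) :=
    isOpen_Ioo.prod (isOpen_set_pi finite_univ fun _ _ => isOpen_Ioo)
  refine (hop.measure_pos volume ⟨(min δ 1 / 2, fun _ => min δ 1 / 2), ?_⟩).ne' hz
  have : 0 < min δ 1 := by positivity
  exact ⟨⟨by simp only; linarith, by simp only; linarith⟩, fun i _ => ⟨by simp only; linarith, by simp only; linarith⟩⟩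

lemma dual_inf {m : ℕ} {C : ℝ} {f : Spc m → ℝ} (hf : Per f) (hfc : Continuous f)
    (h : ∀ η, Tst η → ∫ x in cube m, f x * η x ≤ C * np 1 η) (x : Spc m) : f x ≤ C := by
  set g : Spc m → ℝ := fun x => max (f x - C) 0 with hg
  have hgp : Per g := hf.comp fun t => max (t - C) 0
  have hgc : Continuous g := by fun_prop
  have h1 := ext_test le_rfl hf hfc h hgp hgc
  have e : np 1 g = ∫ x in cube m, g x := by
    simp only [np, Real.rpow_one, div_one]
    congr 1; ext x; exact abs_of_nonneg (le_max_right _ _)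
  rw [e, ← integral_const_mul] at h1
  have h2 : ∫ x in cube m, g x ^ 2 ≤ 0 := by
    have : ∀ x, g x ^ 2 = f x * g x - C * g x := fun x => by
      simp only [hg]
      rcases le_total (f x - C) 0 with h | h
      · rw [max_eq_right h]; ring
      · rw [max_eq_left h]; ring
    simp_rw [this]
    rw [integral_sub (per_int (hf.op hgp _) (by fun_prop)) (per_int (hgp.comp _) (by fun_prop))]
    linarith
  have h3 := per_zero (hgp.comp (· ^ 2)) (by fun_prop) (fun x => by positivity) h2 x
  have h4 : g x = 0 := by simpa using h3
  have : f x - C ≤ g x := le_max_left _ _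
  linarith

lemma ibp0 {m : ℕ} {f : Spc m → ℝ} (hf : Per f) (hd : Differentiable ℝ f) (e : Spc m)
    (hi : IntegrableOn (pd e f) (cube m)) : ∫ x in cube m, pd e f x = 0 := by
  let φ : ContDiffBump (0 : Spc m) := ⟨1, 2, by norm_num, by norm_num⟩
  set r : Spc m → ℝ := φ.normed volume with hr
  have rc : ContDiff ℝ 1 r := φ.contDiff_normed
  have rs : HasCompactSupport r := φ.hasCompactSupport_normed
  have ri : Integrable r := rc.continuous.integrable_of_hasCompactSupport rs
  have rdc : Continuous fun z => fderiv ℝ r z e :=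
    (rc.continuous_fderiv (by norm_num)).clm_apply continuous_const
  have rds : HasCompactSupport fun z => fderiv ℝ r z e := rs.fderiv_apply ℝ e
  have rdi : Integrable fun z => fderiv ℝ r z e := rdc.integrable_of_hasCompactSupport rds
  have hpm : Measurable (pd e f) := measurable_fderiv_apply_const ℝ f e
  have hpp : Per (pd e f) := hf.pd e
  obtain ⟨C, hC0, hC⟩ := per_bdd hf hd.continuous
  have : IsFiniteMeasure (volume.restrict (cube m)) := (inferInstance : IsFiniteMeasure (μT m))
  have i1 : Integrable (fun q : Spc m × Spc m => r q.2 * pd e f (q.1 + q.2))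
      ((volume.restrict (cube m)).prod volume) := by
    have hms : AEStronglyMeasurable (fun q : Spc m × Spc m => r q.2 * pd e f (q.1 + q.2))
        ((volume.restrict (cube m)).prod volume) := by
      have := rc.continuous.measurable
      exact (by fun_prop : Measurable _).aestronglyMeasurable
    rw [integrable_prod_iff' hms]
    have hz : ∀ z : Spc m, IntegrableOn (fun x => pd e f (x + z)) (cube m) := by
      intro z
      refine ⟨(by fun_prop : Measurable _).aestronglyMeasurable, ?_⟩
      rw [HasFiniteIntegral, lint_per (f := fun x => ‖pd e f x‖ₑ) (hpp.comp _) z]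
      exact hi.2
    refine ⟨Eventually.of_forall fun z => (hz z).const_mul (r z), ?_⟩
    have : (fun z => ∫ x, ‖r z * pd e f (x + z)‖ ∂(volume.restrict (cube m))) =
        fun z => ‖r z‖ * ∫ x in cube m, ‖pd e f x‖ := by
      ext z
      simp only [norm_mul]
      rw [integral_const_mul, int_per (hpp.comp fun t => ‖t‖) z]
    show Integrable (fun z => ∫ x, ‖r z * pd e f (x + z)‖ ∂(volume.restrict (cube m))) volume
    rw [this]
    exact ri.norm.mul_const _
  have i2 : Integrable (fun q : Spc m × Spc m => fderiv ℝ r q.2 e * f (q.1 + q.2))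
      ((volume.restrict (cube m)).prod volume) := by
    have h1 : Integrable (fun q : Spc m × Spc m => (1:ℝ) * fderiv ℝ r q.2 e)
      ((volume.restrict (cube m)).prod volume) := (integrable_const (1:ℝ)).mul_prod rdi
    refine (h1.norm.const_mul C).mono' ?_ (Eventually.of_forall fun q => ?_)
    · have := hd.continuous
      exact (by fun_prop : Continuous fun q : Spc m × Spc m =>
        fderiv ℝ r q.2 e * f (q.1 + q.2)).aestronglyMeasurable
    · rw [norm_mul, one_mul, mul_comm]; gcongr; exact hC _
  have hA : ∫ x in cube m, pd e f x = ∫ x in cube m, ∫ z, r z * pd e f (x + z) := by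
    rw [integral_integral_swap i1]
    simp_rw [integral_const_mul, int_per hpp]
    rw [integral_mul_const, hr, φ.integral_normed, one_mul]
  have hB : ∫ x in cube m, ∫ z, r z * pd e f (x + z) =
      ∫ x in cube m, -∫ z, fderiv ℝ r z e * f (x + z) := by
    refine integral_congr_ae ?_
    filter_upwards [i1.prod_right_ae, i2.prod_right_ae] with x hx1 hx2
    have hfd : ∀ z, fderiv ℝ (fun z => f (x + z)) z e = pd e f (x + z) := fun z => by
      rw [fderiv_comp_add_left]; rfl
    have := integral_mul_fderiv_eq_neg_fderiv_mul_of_integrable (μ := volume) (f := r)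
      (g := fun z => f (x + z)) (v := e) hx2 (by simpa only [hfd] using hx1) ?_
      (fun z _ => rc.differentiable (by norm_num) z) (fun z _ => (hd.comp (by fun_prop)) z)
    · simpa only [hfd] using this
    · refine (ri.norm.const_mul C).mono' ?_ (Eventually.of_forall fun q => ?_)
      · have := hd.continuous
        have := rc.continuous
        exact (by fun_prop : Continuous fun z : Spc m => r z * f (x + z)).aestronglyMeasurable
      · rw [norm_mul, mul_comm]; gcongr; exact hC _
  have hD : ∫ z, fderiv ℝ r z e = 0 := by
    have := integral_mul_fderiv_eq_neg_fderiv_mul_of_integrable (μ := volume) (f := fun _ => (1:ℝ))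
      (g := r) (v := e) (by simp) (by simpa using rdi) (by simpa using ri)
      (fun z _ => by fun_prop) (fun z _ => rc.differentiable (by norm_num) z)
    simpa using this
  rw [hA, hB, integral_neg, integral_integral_swap i2]
  simp_rw [integral_const_mul, int_per hf]
  rw [integral_mul_const, hD]; simp

lemma ibp {m : ℕ} {u ξ : Spc m → ℝ} (hu : Per u) (hud : Differentiable ℝ u) (hξ : Per ξ)
    (hξd : Differentiable ℝ ξ) (e : Spc m) (h1 : IntegrableOn (pd e u) (cube m))
    (h2 : IntegrableOn (pd e ξ) (cube m)) :
    ∫ x in cube m, pd e u x * ξ x = - ∫ x in cube m, u x * pd e ξ x := by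
  have e1 : ∀ x, pd e (fun x => u x * ξ x) x = u x * pd e ξ x + pd e u x * ξ x := fun x => by
    unfold pd; rw [fderiv_fun_mul (hud x) (hξd x)]; simp [mul_comm]
  obtain ⟨C, hC0, hC⟩ := per_bdd hu hud.continuous
  obtain ⟨D, hD0, hD⟩ := per_bdd hξ hξd.continuous
  have i1 : IntegrableOn (fun x => u x * pd e ξ x) (cube m) :=
    Integrable.bdd_mul h2 hud.continuous.aestronglyMeasurable (Eventually.of_forall hC)
  have i2 : IntegrableOn (fun x => pd e u x * ξ x) (cube m) :=
    Integrable.mul_bdd (c := D) h1 hξd.continuous.aestronglyMeasurable (Eventually.of_forall hD)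
  have := ibp0 (hu.op hξ (· * ·)) (hud.mul hξd) e (by
    simp_rw [funext e1]; exact i1.add i2)
  have e2 : ∫ x in cube m, (u x * pd e ξ x + pd e u x * ξ x) = 0 := by
    rw [← this]; congr 1; ext x; exact (e1 x).symm
  rw [integral_add i1 i2] at e2
  linarith

def Ph {m : ℕ} (a : ℝ) (η : Spc m → ℝ) (x : Spc m) : ℝ := ∫ z, η (x + a • z) ∂(gam m)

lemma finQ (m : ℕ) : IsProbabilityMeasure (volume.restrict (cube m)) :=
  (inferInstance : IsProbabilityMeasure (μT m))

lemma Tst.bdd {m : ℕ} {η : Spc m → ℝ} (h : Tst η) : ∃ C : ℝ, 0 ≤ C ∧ ∀ x, |η x| ≤ C :=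
  per_bdd h.2 h.cont

lemma Tst.bdd' {m : ℕ} {η : Spc m → ℝ} (h : Tst η) : ∃ C : ℝ, 0 ≤ C ∧ ∀ x, ‖fderiv ℝ η x‖ ≤ C :=
  per_bdd h.2.fderiv (h.1.continuous_fderiv (by simp))

lemma kap_int {m : ℕ} {κ : Spc m → ℝ} (hκ : Integrable κ (gam m)) {f : Spc m → ℝ}
    (hc : Continuous f) {C : ℝ} (hC : ∀ z, |f z| ≤ C) : Integrable (fun z => κ z * f z) (gam m) :=
  Integrable.mul_bdd (c := C) hκ hc.aestronglyMeasurable (Eventually.of_forall hC)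

lemma Ph_per {m : ℕ} (a : ℝ) {η : Spc m → ℝ} (h : Per η) : Per (Ph a η) := fun k x => by
  unfold Ph; congr 1; ext z
  rw [add_right_comm]; exact h k _

lemma Ph_bd {m : ℕ} (a : ℝ) {η : Spc m → ℝ} {C : ℝ} (h : ∀ x, |η x| ≤ C) (x : Spc m) :
    |Ph a η x| ≤ C := by
  have := norm_integral_le_of_norm_le_const (μ := gam m) (f := fun z => η (x + a • z)) (C := C)
    (Eventually.of_forall fun z => h _)
  simpa [Ph] using this

lemma Ph_hasFDeriv {m : ℕ} (a : ℝ) {η : Spc m → ℝ} (h : Tst η) (x : Spc m) :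
    HasFDerivAt (Ph a η) (∫ z, fderiv ℝ η (x + a • z) ∂(gam m)) x := by
  obtain ⟨C, hC0, hC⟩ := h.bdd'
  obtain ⟨D, hD0, hD⟩ := h.bdd
  have hc := h.cont
  have hc' : Continuous (fderiv ℝ η) := h.1.continuous_fderiv (by simp)
  refine hasFDerivAt_integral_of_dominated_of_fderiv_le (μ := gam m) (s := univ)
    (F := fun x z => η (x + a • z)) (F' := fun x z => fderiv ℝ η (x + a • z)) (bound := fun _ => C)
    univ_mem ?_ ?_ ?_ ?_ (integrable_const _) ?_
  · exact Eventually.of_forall fun y => (by fun_prop : Continuous _).aestronglyMeasurable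
  · exact Integrable.of_bound (C := D) (by fun_prop : Continuous _).aestronglyMeasurable
      (Eventually.of_forall fun z => hD _)
  · exact (by fun_prop : Continuous _).aestronglyMeasurable
  · exact Eventually.of_forall fun z y _ => hC _
  · exact Eventually.of_forall fun z y _ => by
      rw [hasFDerivAt_comp_add_right]; exact (h.diff _).hasFDerivAt

lemma Ph_diff {m : ℕ} (a : ℝ) {η : Spc m → ℝ} (h : Tst η) : Differentiable ℝ (Ph a η) :=
  fun x => (Ph_hasFDeriv a h x).differentiableAt

lemma Ph_cont {m : ℕ} (a : ℝ) {η : Spc m → ℝ} (h : Tst η) : Continuous (Ph a η) :=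
  (Ph_diff a h).continuous

lemma Ph_pd {m : ℕ} (a : ℝ) {η : Spc m → ℝ} (h : Tst η) (v : Spc m) :
    pd v (Ph a η) = Ph a (pd v η) := by
  ext x
  obtain ⟨C, hC0, hC⟩ := h.bdd'
  have hc' : Continuous (fderiv ℝ η) := h.1.continuous_fderiv (by simp)
  unfold pd
  rw [(Ph_hasFDeriv a h x).fderiv, ContinuousLinearMap.integral_apply]
  · rfl
  · exact Integrable.of_bound (C := C) (by fun_prop : Continuous _).aestronglyMeasurable
      (Eventually.of_forall fun z => hC _)

lemma fderiv_aff {m : ℕ} (a : ℝ) {η : Spc m → ℝ} (h : Tst η) (x z : Spc m) :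
    HasFDerivAt (fun z => η (x + a • z)) (a • fderiv ℝ η (x + a • z)) z := by
  have h1 : HasFDerivAt (fun z : Spc m => x + a • z) (a • ContinuousLinearMap.id ℝ (Spc m)) z :=
    ((hasFDerivAt_id z).const_smul a).const_add x
  have := (h.diff (x + a • z)).hasFDerivAt.comp z h1
  have e : a • fderiv ℝ η (x + a • z) =
      (fderiv ℝ η (x + a • z)).comp (a • ContinuousLinearMap.id ℝ (Spc m)) := by
    refine ContinuousLinearMap.ext fun v => ?_
    simp
  rw [e]; exact this

lemma stein1 {m : ℕ} (a : ℝ) {η : Spc m → ℝ} (h : Tst η) (k : Option (Fin m)) (x : Spc m) :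
    ∫ z, co k z * η (x + a • z) ∂(gam m) = a * Ph a (pd (dir k) η) x := by
  obtain ⟨C, hC0, hC⟩ := (h.pd (dir k)).bdd
  obtain ⟨D, hD0, hD⟩ := h.bdd
  have e : ∀ z, fderiv ℝ (fun z => η (x + a • z)) z (dir k) = a * pd (dir k) η (x + a • z) :=
    fun z => by rw [(fderiv_aff a h x z).fderiv]; rfl
  have hb : ∀ z : Spc m, D + |a| * C ≤ (D + |a| * C) * (1 + ‖z‖ ^ 0) := fun z => by
    have : 0 ≤ D + |a| * C := by positivity
    rw [pow_zero]; linarith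
  rw [stein (f := fun z => η (x + a • z)) (fun z => (fderiv_aff a h x z).differentiableAt) k ?_
    (C := D + |a| * C) (N := 0) ?_ ?_]
  · simp_rw [e]; rw [integral_const_mul]; rfl
  · simp_rw [e]; have := (h.pd (dir k)).cont; fun_prop
  · intro z
    refine le_trans ?_ (hb z)
    have : 0 ≤ |a| * C := by positivity
    linarith [hD (x + a • z)]
  · intro z
    refine le_trans ?_ (hb z)
    rw [e, abs_mul]
    have : |a| * |pd (dir k) η (x + a • z)| ≤ |a| * C := by gcongr; exact hC _
    linarith

lemma stein2 {m : ℕ} (a : ℝ) {η : Spc m → ℝ} (h : Tst η) (i j : Option (Fin m)) (x : Spc m) :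
    ∫ z, (co i z * co j z - if i = j then 1 else 0) * η (x + a • z) ∂(gam m) =
      a ^ 2 * Ph a (pd (dir j) (pd (dir i) η)) x := by
  obtain ⟨C, hC0, hC⟩ := (h.pd (dir i)).bdd
  obtain ⟨D, hD0, hD⟩ := h.bdd
  have hc := h.cont
  have hc1 := (h.pd (dir i)).cont
  have e : ∀ z, HasFDerivAt (fun z => co j z * η (x + a • z))
      (co j z • (a • fderiv ℝ η (x + a • z)) + η (x + a • z) • co j) z := fun z =>
    ((co j).hasFDerivAt).mul (fderiv_aff a h x z)
  have e' : ∀ z, fderiv ℝ (fun z => co j z * η (x + a • z)) z (dir i) =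
      a * (co j z * pd (dir i) η (x + a • z)) + (if i = j then 1 else 0) * η (x + a • z) := fun z => by
    rw [(e z).fderiv]
    simp only [add_apply, smul_apply, smul_eq_mul, co_dir, pd, eq_comm]
    ring
  have hcoz : ∀ z : Spc m, |co j z| ≤ ‖z‖ := fun z => abs_co_le j z
  set K := D + |a| * C
  have hst := stein (f := fun z => co j z * η (x + a • z)) (fun z => (e z).differentiableAt) i
    (C := K) (N := 1) ?_ ?_ ?_
  rotate_left
  · simp_rw [e']; fun_prop
  · intro z
    rw [abs_mul, pow_one]
    calc |co j z| * |η (x + a • z)| ≤ ‖z‖ * D := by gcongr; exacts [hcoz z, hD _]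
      _ ≤ (1 + ‖z‖) * K := by
        gcongr
        · linarith
        · exact le_add_of_nonneg_right (by positivity)
      _ = _ := by ring
  · intro z
    rw [e', pow_one]
    calc _ ≤ |a * (co j z * pd (dir i) η (x + a • z))| +
          |(if i = j then 1 else 0) * η (x + a • z)| := abs_add_le _ _
      _ ≤ |a| * (‖z‖ * C) + 1 * D := by
        rw [abs_mul, abs_mul, abs_mul]
        gcongr
        · exact hcoz z
        · exact hC _
        · split_ifs <;> simp
        · exact hD _
      _ ≤ K * (1 + ‖z‖) := by
        have : 0 ≤ |a| * C := by positivity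
        have := norm_nonneg z
        simp only [K]; nlinarith
  have hco1 : Integrable (fun z : Spc m => co j z) (gam m) :=
    (gam_pow m 1).mono' (co j).continuous.aestronglyMeasurable
      (Eventually.of_forall fun z => by rw [pow_one]; exact hcoz z)
  have I1 : Integrable (fun z => a * (co j z * pd (dir i) η (x + a • z))) (gam m) :=
    (kap_int hco1 (by fun_prop) fun z => hC _).const_mul a
  have I2 : Integrable (fun z => (if i = j then 1 else 0) * η (x + a • z)) (gam m) :=
    kap_int (integrable_const _) (by fun_prop) fun z => hD _
  have I3 : Integrable (fun z => co i z * co j z * η (x + a • z)) (gam m) := by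
    refine kap_int (κ := fun z => co i z * co j z) ?_ (by fun_prop) fun z => hD _
    refine (gam_pow m 2).mono' (by fun_prop : Continuous _).aestronglyMeasurable
      (Eventually.of_forall fun z => ?_)
    rw [norm_mul, sq]; gcongr; exacts [abs_co_le i z, abs_co_le j z]
  simp_rw [e'] at hst
  rw [integral_add I1 I2, integral_const_mul, stein1 a (h.pd (dir i)) j] at hst
  simp_rw [sub_mul]
  rw [integral_sub I3 I2]
  simp_rw [mul_assoc]
  rw [hst]; ring

lemma Ph_da {m : ℕ} (a : ℝ) {η : Spc m → ℝ} (h : Tst η) (x : Spc m) :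
    HasDerivAt (fun a => Ph a η x) (a * ∑ k, Ph a (pd (dir k) (pd (dir k) η)) x) a := by
  obtain ⟨C, hC0, hC⟩ := h.bdd'
  obtain ⟨D, hD0, hD⟩ := h.bdd
  have hc := h.cont
  have hc' : Continuous (fderiv ℝ η) := h.1.continuous_fderiv (by simp)
  have key := hasDerivAt_integral_of_dominated_loc_of_deriv_le (μ := gam m) (s := univ) (x₀ := a)
    (F := fun a z => η (x + a • z)) (F' := fun a z => fderiv ℝ η (x + a • z) z)
    (bound := fun z => C * ‖z‖ ^ 1)
    univ_mem ?_ ?_ ?_ ?_ ((gam_pow m 1).const_mul C) ?_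
  rotate_left
  · exact Eventually.of_forall fun y => (by fun_prop : Continuous _).aestronglyMeasurable
  · exact Integrable.of_bound (C := D) (by fun_prop : Continuous _).aestronglyMeasurable
      (Eventually.of_forall fun z => hD _)
  · exact (by fun_prop : Continuous _).aestronglyMeasurable
  · exact Eventually.of_forall fun z y _ => by
      rw [pow_one]; exact (ContinuousLinearMap.le_opNorm _ _).trans (by gcongr; exact hC _)
  · refine Eventually.of_forall fun z y _ => ?_
    have h1 : HasDerivAt (fun y : ℝ => x + y • z) z y := by
      have := ((hasDerivAt_id y).smul_const z).const_add x
      simpa using this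
    exact (h.diff _).hasFDerivAt.comp_hasDerivAt y h1
  have e : ∫ z, fderiv ℝ η (x + a • z) z ∂(gam m) = a * ∑ k, Ph a (pd (dir k) (pd (dir k) η)) x := by
    have e1 : ∀ z, fderiv ℝ η (x + a • z) z = ∑ k, co k z * pd (dir k) η (x + a • z) :=
      fun z => clm_eq_sum _ _
    simp_rw [e1]
    rw [integral_finsetSum, Finset.mul_sum]
    · exact Finset.sum_congr rfl fun k _ => stein1 a (h.pd (dir k)) k x
    · intro k _
      obtain ⟨C, hC0, hC⟩ := (h.pd (dir k)).bdd
      have := (h.pd (dir k)).cont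
      refine kap_int ?_ (by fun_prop) fun z => hC _
      exact (gam_pow m 1).mono' (co k).continuous.aestronglyMeasurable
        (Eventually.of_forall fun z => by rw [pow_one]; exact abs_co_le k z)
  rw [e] at key
  exact key.2

lemma abs_int_le {α : Type*} [MeasurableSpace α] {μ : Measure α} {f g : α → ℝ}
    (hg : Integrable g μ) (h : ∀ x, |f x| ≤ g x) : |∫ x, f x ∂μ| ≤ ∫ x, g x ∂μ :=
  norm_integral_le_of_norm_le (f := f) hg (Eventually.of_forall h)

lemma Bswap {m : ℕ} (a : ℝ) {η w κ : Spc m → ℝ} (h : Per η) (hc : Continuous η)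
    (hw : IntegrableOn w (cube m)) (hκ : Integrable κ (gam m)) :
    ∫ x in cube m, w x * ∫ z, κ z * η (x + a • z) ∂(gam m) =
      ∫ z, κ z * (∫ x in cube m, w x * η (x + a • z)) ∂(gam m) := by
  obtain ⟨D, hD0, hD⟩ := per_bdd h hc
  simp_rw [← integral_const_mul]
  rw [integral_integral_swap]
  · congr 1; ext z; congr 1; ext x; ring
  · have := hw.integrable.mul_prod hκ
    refine ((this.mul_bdd (c := D) (g := fun q : Spc m × Spc m => η (q.1 + a • q.2))
      (by fun_prop : Continuous _).aestronglyMeasurable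
      (Eventually.of_forall fun q => hD _))).congr (Eventually.of_forall fun q => ?_)
    simp only [Function.uncurry, mul_assoc]

lemma memLp_int {m : ℕ} {p : ℝ} (hp : 1 ≤ p) {w : Spc m → ℝ}
    (hw : MemLp w (ofReal p) (volume.restrict (cube m))) : IntegrableOn w (cube m) := by
  have := finQ m
  exact hw.integrable (by rw [← ofReal_one]; exact ofReal_le_ofReal hp)

lemma Bbd {m : ℕ} {p q : ℝ} (hpq : p.HolderConjugate q) (a : ℝ) {η w κ : Spc m → ℝ}
    (h : Per η) (hc : Continuous η)
    (hw : MemLp w (ofReal p) (volume.restrict (cube m))) (hκ : Integrable κ (gam m)) :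
    |∫ x in cube m, w x * ∫ z, κ z * η (x + a • z) ∂(gam m)| ≤
      (∫ z, |κ z| ∂(gam m)) * (np p w * np q η) := by
  rw [Bswap a h hc (memLp_int hpq.lt.le hw) hκ, ← integral_mul_const]
  refine abs_int_le (hκ.abs.mul_const _) fun z => ?_
  rw [abs_mul]
  gcongr
  rw [← np_shift q h (a • z)]
  exact holder hpq hw (h.shift _) (by fun_prop)

lemma Ph_one {m : ℕ} (a : ℝ) (η : Spc m → ℝ) (x : Spc m) :
    Ph a η x = ∫ z, 1 * η (x + a • z) ∂(gam m) := by simp [Ph]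

lemma Ph_mass {m : ℕ} (a : ℝ) {η : Spc m → ℝ} (h : Per η) (hc : Continuous η) :
    ∫ x in cube m, Ph a η x = ∫ x in cube m, η x := by
  have := finQ m
  have e := Bswap a h hc (w := fun _ => 1) (κ := fun _ => 1) (integrable_const _) (integrable_const _)
  simp_rw [← Ph_one, one_mul, int_per h] at e
  simpa using e

lemma np1 {m : ℕ} (η : Spc m → ℝ) : np 1 η = ∫ x in cube m, |η x| := by simp [np]

lemma Ph_L1 (m : ℕ) : ∃ C : ℝ, 0 < C ∧ ∀ a : ℝ, 0 < a → a ≤ 1 → ∀ η : Spc m → ℝ, Per η →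
    Continuous η → ∀ x, |Ph a η x| ≤ C * a ^ (-((m:ℝ) + 1)) * np 1 η := by
  obtain ⟨C, hC, h⟩ := gam_avg m
  refine ⟨C, hC, fun a ha ha1 η hp hc x => ?_⟩
  have h1 := h a ha ha1 (fun y => ofReal |η y|) (by fun_prop)
    (hp.comp fun t => ofReal |t|) x
  have h2 : ∫⁻ y in cube m, ofReal |η y| = ofReal (np 1 η) := by
    rw [np1, ofReal_integral_eq_lintegral_ofReal (per_int (hp.comp fun t => |t|) hc.abs)
      (Eventually.of_forall fun _ => abs_nonneg _)]
  rw [h2, ← ofReal_mul (by positivity)] at h1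
  have h3 : |Ph a η x| ≤ ∫ z, |η (x + a • z)| ∂(gam m) :=
    norm_integral_le_integral_norm (μ := gam m) fun z => η (x + a • z)
  refine h3.trans ?_
  rw [integral_eq_lintegral_of_nonneg_ae (Eventually.of_forall fun _ => abs_nonneg _)
    (by fun_prop : Continuous _).aestronglyMeasurable]
  refine ENNReal.toReal_le_of_le_ofReal ?_ h1
  have := np_nonneg 1 η
  positivity

lemma gam_neg {m : ℕ} (f : Spc m → ℝ≥0∞) (hf : Measurable f) :
    ∫⁻ z, f (-z) ∂(gam m) = ∫⁻ z, f z ∂(gam m) := by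
  rw [gam, lintegral_withDensity_eq_lintegral_mul _ (meas_rho m) (by fun_prop),
    lintegral_withDensity_eq_lintegral_mul _ (meas_rho m) hf]
  have := lintegral_neg_eq_self (μ := (volume : Measure (Spc m)))
    (fun z => ofReal (rho z) * f z)
  refine Eq.trans ?_ this
  refine lintegral_congr fun z => ?_
  have e : rho (-z) = rho z := by simp [rho, gk, qd]
  rw [e]; rfl

lemma drift_inf (m : ℕ) {p q : ℝ} (hpq : p.HolderConjugate q) : ∃ C : ℝ, 0 < C ∧ ∀ a : ℝ, 0 < a →
    a ≤ 1 → ∀ η w : Spc m → ℝ, Per η → Continuous η → Per w → Continuous w →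
    ∀ k : Option (Fin m),
    |∫ x in cube m, w x * ∫ z, co k z * η (x + a • z) ∂(gam m)| ≤
      C * a ^ (-((m:ℝ) + 1) / p) * np p w * np 1 η := by
  obtain ⟨C, hC, h⟩ := gam_avg m
  have hp0 := hpq.pos
  set J : ℝ := (∫ z : Spc m, ‖z‖ ^ q ∂(gam m)) ^ (1/q)
  have hJ : 0 ≤ J := by
    refine Real.rpow_nonneg (integral_nonneg fun z => by positivity) _
  have hzq : MemLp (fun z : Spc m => ‖z‖) (ofReal q) (gam m) := by
    obtain ⟨N, hN⟩ := exists_nat_ge q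
    have : MemLp (fun z : Spc m => ‖z‖) (N : ℝ≥0∞) (gam m) := by
      have hN0 : N ≠ 0 := by
        rintro rfl; have := hpq.symm.pos; simp at hN; linarith
      rw [← memLp_norm_rpow_iff (q := (N:ℝ≥0∞)) (by fun_prop) (by exact_mod_cast hN0) (by simp)]
      rw [ENNReal.div_self (by exact_mod_cast hN0) (by simp), memLp_one_iff_integrable]
      simpa using gam_pow m N
    refine this.mono_exponent ?_
    rw [← ofReal_natCast]; exact ofReal_le_ofReal hN
  refine ⟨J * C ^ (1/p) + 1, by positivity, fun a ha ha1 η w hη hηc hw hwc k => ?_⟩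
  have hco1 : Integrable (fun z : Spc m => co k z) (gam m) :=
    (gam_pow m 1).mono' (co k).continuous.aestronglyMeasurable
      (Eventually.of_forall fun z => by rw [pow_one]; exact abs_co_le k z)
  obtain ⟨Kw, hKw0, hKw⟩ := per_bdd hw hwc
  obtain ⟨Kη, hKη0, hKη⟩ := per_bdd hη hηc
  have e1 : ∫ x in cube m, w x * ∫ z, co k z * η (x + a • z) ∂(gam m) =
      ∫ x in cube m, η x * ∫ z, co k z * w (x + (-a) • z) ∂(gam m) := by
    rw [Bswap a hη hηc (per_int hw hwc) hco1, Bswap (-a) hw hwc (per_int hη hηc) hco1]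
    congr 1; ext z; congr 1
    rw [← int_per (hη.op (hw.shift ((-a) • z)) (· * ·)) (a • z)]
    congr 1; ext x
    rw [mul_comm]; congr 2
    rw [neg_smul]; abel
  have hIn : ∀ x, |∫ z, co k z * w (x + (-a) • z) ∂(gam m)| ≤
      J * C ^ (1/p) * a ^ (-((m:ℝ) + 1) / p) * np p w := by
    intro x
    have hwm : MemLp (fun z => |w (x + (-a) • z)|) (ofReal p) (gam m) :=
      MemLp.of_bound (by fun_prop : Continuous _).aestronglyMeasurable Kw
        (Eventually.of_forall fun z => by simpa using hKw _)
    have s1 : |∫ z, co k z * w (x + (-a) • z) ∂(gam m)| ≤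
        ∫ z, ‖z‖ * |w (x + (-a) • z)| ∂(gam m) := by
      refine abs_int_le ?_ fun z => ?_
      · exact kap_int (by simpa using gam_pow m 1) (by fun_prop) fun z => by simpa using hKw _
      · rw [abs_mul]; gcongr; exact abs_co_le k z
    have s2 := integral_mul_le_Lp_mul_Lq_of_nonneg hpq.symm (μ := gam m)
      (f := fun z : Spc m => ‖z‖) (g := fun z => |w (x + (-a) • z)|)
      (Eventually.of_forall fun _ => norm_nonneg _) (Eventually.of_forall fun _ => abs_nonneg _)
      hzq hwm
    refine (s1.trans s2).trans ?_
    have s3 : ∫ z, |w (x + (-a) • z)| ^ p ∂(gam m) ≤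
        C * a ^ (-((m:ℝ) + 1)) * ∫ x in cube m, |w x| ^ p := by
      have hcp : Continuous fun y => |w y| ^ p := hwc.abs.rpow_const fun _ => Or.inr hp0.le
      have h1 := h a ha ha1 (fun y => ofReal (|w y| ^ p)) (by fun_prop)
        (hw.comp fun t => ofReal (|t| ^ p)) x
      rw [← gam_neg _ (by fun_prop), ← ofReal_integral_eq_lintegral_ofReal
        (per_int (hw.comp fun t => |t| ^ p) hcp) (Eventually.of_forall fun _ => by positivity),
        ← ofReal_mul (by positivity)] at h1
      have hcc : Continuous fun z => |w (x + (-a) • z)| ^ p :=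
        hcp.comp (by fun_prop : Continuous fun z => x + (-a) • z)
      rw [integral_eq_lintegral_of_nonneg_ae
        (Eventually.of_forall fun z => Real.rpow_nonneg (abs_nonneg _) _) hcc.aestronglyMeasurable]
      refine ENNReal.toReal_le_of_le_ofReal ?_ ?_
      · have : 0 ≤ ∫ x in cube m, |w x| ^ p := integral_nonneg fun _ => by positivity
        positivity
      · simpa only [neg_smul, smul_neg] using h1
    calc J * (∫ z, |w (x + (-a) • z)| ^ p ∂(gam m)) ^ (1/p)
        ≤ J * (C * a ^ (-((m:ℝ) + 1)) * ∫ x in cube m, |w x| ^ p) ^ (1/p) := by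
          gcongr
      _ = _ := by
          rw [Real.mul_rpow (by positivity) (integral_nonneg fun _ => by positivity),
            Real.mul_rpow hC.le (by positivity), ← Real.rpow_mul ha.le]
          simp only [np]
          rw [mul_one_div]; ring
  rw [e1, np1, ← integral_const_mul]
  refine abs_int_le ((per_int (hη.comp fun t => |t|) hηc.abs).const_mul _) fun x => ?_
  rw [abs_mul, mul_comm]
  gcongr
  · refine (hIn x).trans ?_
    gcongr
    · exact np_nonneg _ _
    · linarith

lemma e1_line {m : ℕ} (x1 : ℝ) (y : Fin m → ℝ) :
    HasDerivAt (fun s : ℝ => ((s, y) : Spc m)) (e1 m) x1 :=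
  (hasDerivAt_id x1).prodMk (hasDerivAt_const x1 y)

lemma marg_per {m : ℕ} {g : Spc m → ℝ} (hg : Per g) : Per (fun x : Spc m => marg g x.1) := by
  rw [← per_iff]; rw [← per_iff] at hg
  intro x k j
  simp only [marg]
  congr 1; ext y
  simpa using hg (x.1, y) k 0

lemma marg_cont {m : ℕ} {g : Spc m → ℝ} (hg : Per g) (hc : Continuous g) : Continuous (marg g) := by
  obtain ⟨C, _, hC⟩ := per_bdd hg hc
  refine continuous_of_dominated (bound := fun _ => C) (fun x => ?_) (fun x => ?_) (integrable_const _) ?_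
  · exact (by fun_prop : Continuous _).aestronglyMeasurable
  · exact Eventually.of_forall fun y => hC _
  · exact Eventually.of_forall fun y => by fun_prop

lemma marg_deriv {m : ℕ} {g : Spc m → ℝ} (hg : Per g) (hd : ContDiff ℝ 1 g) (x1 : ℝ) :
    HasDerivAt (marg g) (marg (pd (e1 m) g) x1) x1 := by
  obtain ⟨C, _, hC⟩ := per_bdd hg hd.continuous
  have hc := hd.continuous
  have hpc : Continuous (pd (e1 m) g) := (hd.continuous_fderiv (by simp)).clm_apply continuous_const
  obtain ⟨D, _, hD⟩ := per_bdd (hg.pd (e1 m)) hpc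
  exact (hasDerivAt_integral_of_dominated_loc_of_deriv_le (s := univ)
    (μ := volume.restrict (cube1 m)) (F := fun s y => g (s, y))
    (F' := fun s y => pd (e1 m) g (s, y)) (bound := fun _ => D) univ_mem
    (Eventually.of_forall fun s => (by fun_prop : Continuous _).aestronglyMeasurable)
    (Integrable.of_bound (C := C) (by fun_prop : Continuous _).aestronglyMeasurable
      (Eventually.of_forall fun y => hC _))
    (by fun_prop : Continuous _).aestronglyMeasurable
    (Eventually.of_forall fun y s _ => hD _) (integrable_const _)
    (Eventually.of_forall fun y s _ =>
      ((hd.differentiable (by simp)) (s, y)).hasFDerivAt.comp_hasDerivAt s (e1_line s y))).2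

lemma marg_C1 {m : ℕ} {g : Spc m → ℝ} (hg : Per g) (hd : ContDiff ℝ 1 g) :
    ContDiff ℝ 1 (marg g) := by
  rw [contDiff_one_iff_deriv]
  refine ⟨fun x => (marg_deriv hg hd x).differentiableAt, ?_⟩
  have : deriv (marg g) = marg (pd (e1 m) g) := funext fun x => (marg_deriv hg hd x).deriv
  rw [this]
  exact marg_cont (hg.pd _) ((hd.continuous_fderiv (by simp)).clm_apply continuous_const)

structure Snap {m : ℕ} (p : ℝ) (u : Spc m → ℝ) : Prop where
  per : Per u
  diff : Differentiable ℝ u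
  diff2 : Differentiable ℝ (fderiv ℝ u)
  d2 : MemLp (fun x => ‖fderiv ℝ (fderiv ℝ u) x‖) (ofReal p) (volume.restrict (cube m))
  pos : ∀ x1, 0 < marg u x1

lemma Snap.c1 {m : ℕ} {p : ℝ} {u : Spc m → ℝ} (h : Snap p u) : ContDiff ℝ 1 u :=
  contDiff_one_iff_fderiv.2 ⟨h.diff, h.diff2.continuous⟩

lemma snap_of {m : ℕ} {p σ : ℝ} {u : Spc m → ℝ} (h : MemW 2 p u) (h' : MemD σ p u) : Snap p u where
  per := (per_iff u).1 h.1
  diff := h.2.2.1 (by norm_num)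
  diff2 := h.2.2.2.1 le_rfl
  pos := h'.2
  d2 := by
    have h5 := h.2.2.2.2
    simp only [WNorm] at h5
    norm_num at h5
    have h6 := h5.2
    have e : ∀ x, ‖iteratedFDeriv ℝ 2 u x‖ = ‖fderiv ℝ (fderiv ℝ u) x‖ := fun x => by
      rw [show (2:ℕ) = 1 + 1 from rfl, ← norm_iteratedFDeriv_fderiv, norm_iteratedFDeriv_one]
    refine ⟨(measurable_fderiv ℝ (fderiv ℝ u)).norm.aestronglyMeasurable, ?_⟩
    simp_rw [← e]
    exact (eLpNorm_norm (iteratedFDeriv ℝ 2 u)).trans_lt h6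

def Wd {m : ℕ} (V u : Spc m → ℝ) (k : Option (Fin m)) (x : Spc m) : ℝ :=
  pd (dir k) V x * u x - if k = none then phiF V u x.1 * u x else 0

def Aop {m : ℕ} (V : Spc m → ℝ) (β : ℝ) (u : Spc m → ℝ) (x : Spc m) : ℝ :=
  β⁻¹ * lap u x + Fop V u x

lemma pd_C1 {m : ℕ} {V : Spc m → ℝ} (hV : ContDiff ℝ 2 V) (v : Spc m) : ContDiff ℝ 1 (pd v V) := by
  have h1 : ContDiff ℝ 1 (fderiv ℝ V) := hV.fderiv_right (by norm_num)
  exact h1.clm_apply contDiff_const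

lemma phi_C1 {m : ℕ} {V u : Spc m → ℝ} (hV : ContDiff ℝ 2 V) (hVp : Per V) (hu : Per u)
    (hd : ContDiff ℝ 1 u) (hpos : ∀ x1, 0 < marg u x1) : ContDiff ℝ 1 (phiF V u) := by
  have h1 := marg_C1 ((hVp.pd (e1 m)).op hu (· * ·)) ((pd_C1 hV (e1 m)).mul hd)
  exact h1.div (marg_C1 hu hd) fun x => (hpos x).ne'

lemma phi_per {m : ℕ} {V u : Spc m → ℝ} (hVp : Per V) (hu : Per u) :
    Per (fun x : Spc m => phiF V u x.1) :=
  (marg_per ((hVp.pd (e1 m)).op hu (· * ·))).op (marg_per hu) (· / ·)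

lemma Wd_per {m : ℕ} {V u : Spc m → ℝ} (hVp : Per V) (hu : Per u) (k : Option (Fin m)) :
    Per (Wd V u k) := by
  have h1 := (hVp.pd (dir k)).op hu (· * ·)
  have h2 := ((phi_per hVp hu).op hu (· * ·)).comp fun t => if k = none then t else 0
  exact h1.op h2 (· - ·)

lemma Wd_C1 {m : ℕ} {V u : Spc m → ℝ} (hV : ContDiff ℝ 2 V) (hVp : Per V) (hu : Per u)
    (hd : ContDiff ℝ 1 u) (hpos : ∀ x1, 0 < marg u x1) (k : Option (Fin m)) :
    ContDiff ℝ 1 (Wd V u k) := by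
  have h1 := (pd_C1 hV (dir k)).mul hd
  have h2 := ((phi_C1 hV hVp hu hd hpos).comp contDiff_fst).mul hd
  by_cases hk : k = none
  · unfold Wd; simp only [hk, if_true]; rw [hk] at h1; exact h1.sub h2
  · unfold Wd; simp only [hk, if_false, sub_zero]; exact h1

lemma pd_mul' {m : ℕ} {f g : Spc m → ℝ} {x : Spc m} (hf : DifferentiableAt ℝ f x)
    (hg : DifferentiableAt ℝ g x) (v : Spc m) :
    pd v (fun x => f x * g x) x = f x * pd v g x + pd v f x * g x := by
  unfold pd; rw [fderiv_fun_mul hf hg]; simp [mul_comm]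

lemma C1_pd_cont {m : ℕ} {f : Spc m → ℝ} (h : ContDiff ℝ 1 f) (v : Spc m) : Continuous (pd v f) :=
  (h.continuous_fderiv (by simp)).clm_apply continuous_const

section
variable {m : ℕ} {p β : ℝ} {V u : Spc m → ℝ}

lemma Snap.pd_diff (h : Snap p u) (v : Spc m) : Differentiable ℝ (pd v u) :=
  fun x => (h.diff2 x).clm_apply (differentiableAt_const v)

lemma Snap.pd2 (h : Snap p u) (v w : Spc m) (x : Spc m) :
    pd v (pd w u) x = fderiv ℝ (fderiv ℝ u) x v w := by
  have := ((h.diff2 x).hasFDerivAt.clm_apply (hasFDerivAt_const w x)).fderiv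
  unfold pd; rw [this]; simp

lemma Snap.pd2_memLp (h : Snap p u) (k l : Option (Fin m)) :
    MemLp (pd (dir k) (pd (dir l) u)) (ofReal p) (volume.restrict (cube m)) := by
  refine h.d2.mono (measurable_fderiv_apply_const ℝ _ _).aestronglyMeasurable
    (Eventually.of_forall fun x => ?_)
  rw [h.pd2]
  refine le_trans ?_ (le_abs_self _)
  refine (abs_clm_dir_le _ l).trans ?_
  refine ((fderiv ℝ (fderiv ℝ u) x).le_opNorm (dir k)).trans ?_
  exact mul_le_of_le_one_right (norm_nonneg _) (norm_dir k)

lemma A_div (h : Snap p u) (hV : ContDiff ℝ 2 V) (hVp : Per V) (x : Spc m) :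
    Aop V β u x = ∑ k, (β⁻¹ * pd (dir k) (pd (dir k) u) x + pd (dir k) (Wd V u k) x) := by
  have hWk : ∀ k, pd (dir k) (Wd V u k) x = pd (dir k) V x * pd (dir k) u x +
      pd (dir k) (pd (dir k) V) x * u x -
      if k = none then pd (e1 m) (fun z => phiF V u z.1 * u z) x else 0 := by
    intro k
    have d1 : DifferentiableAt ℝ (pd (dir k) V) x := (pd_C1 hV (dir k)).differentiable (by simp) x
    have d2 : DifferentiableAt ℝ (fun z : Spc m => phiF V u z.1 * u z) x :=
      (((phi_C1 hV hVp h.per h.c1 h.pos).comp contDiff_fst).mul h.c1).differentiable (by simp) x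
    rw [← pd_mul' d1 (h.diff x)]
    by_cases hk : k = none
    · subst hk
      simp only [if_true]
      have : Wd V u none = (fun x => pd (dir none) V x * u x) - (fun x => phiF V u x.1 * u x) := by
        ext y; simp [Wd]
      rw [this]
      exact congrArg (fun L => L (e1 m)) (fderiv_sub (d1.fun_mul (h.diff x)) d2)
    · simp only [hk, if_false, sub_zero]
      have : Wd V u k = (fun x => pd (dir k) V x * u x) := by
        ext y; simp [Wd, hk]
      rw [this]
  simp_rw [hWk]
  unfold Aop Fop
  rw [lap_eq, gradDot_eq, lap_eq, Finset.sum_add_distrib, Finset.sum_sub_distrib,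
    Finset.sum_add_distrib, Finset.mul_sum, Finset.sum_mul]
  simp

lemma A_memLp (h : Snap p u) (hV : ContDiff ℝ 2 V) (hVp : Per V) :
    MemLp (Aop V β u) (ofReal p) (volume.restrict (cube m)) := by
  rw [show Aop V β u = fun x => ∑ k, (β⁻¹ * pd (dir k) (pd (dir k) u) x + pd (dir k) (Wd V u k) x)
    from funext fun x => A_div h hV hVp x]
  refine memLp_finsetSum _ fun k _ => ?_
  refine ((h.pd2_memLp k k).const_mul _).add ?_
  exact per_memLp ((Wd_per hVp h.per k).pd _)
    (C1_pd_cont (Wd_C1 hV hVp h.per h.c1 h.pos k) _) _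

lemma A_test (hp : 1 ≤ p) (h : Snap p u) (hV : ContDiff ℝ 2 V) (hVp : Per V) {ξ : Spc m → ℝ}
    (hξ : Per ξ) (hξd : ContDiff ℝ 1 ξ) :
    ∫ x in cube m, Aop V β u x * ξ x =
      - ∑ k, ∫ x in cube m, (β⁻¹ * pd (dir k) u x + Wd V u k x) * pd (dir k) ξ x := by
  have hWC := fun k => Wd_C1 hV hVp h.per h.c1 h.pos k
  have hq : ∀ k x, pd (dir k) (fun x => β⁻¹ * pd (dir k) u x + Wd V u k x) x =
      β⁻¹ * pd (dir k) (pd (dir k) u) x + pd (dir k) (Wd V u k) x := by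
    intro k x
    have d1 := (h.pd_diff (dir k) x)
    have d2 := (hWC k).differentiable (by simp) x
    exact congrArg (fun L => L (dir k)) ((d1.hasFDerivAt.const_mul β⁻¹).add d2.hasFDerivAt).fderiv
  have hint : ∀ k, IntegrableOn (pd (dir k) (fun x => β⁻¹ * pd (dir k) u x + Wd V u k x)) (cube m) := by
    intro k
    rw [show pd (dir k) (fun x => β⁻¹ * pd (dir k) u x + Wd V u k x) = fun x =>
      β⁻¹ * pd (dir k) (pd (dir k) u) x + pd (dir k) (Wd V u k) x from funext (hq k)]
    refine ((memLp_int hp (h.pd2_memLp k k)).const_mul _).add ?_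
    exact per_int ((Wd_per hVp h.per k).pd _) (C1_pd_cont (hWC k) _)
  obtain ⟨K, _, hK⟩ := per_bdd hξ hξd.continuous
  simp_rw [A_div h hV hVp, ← hq, Finset.sum_mul]
  rw [integral_finsetSum, ← Finset.sum_neg_distrib]
  · refine Finset.sum_congr rfl fun k _ => ?_
    refine ibp ?_ ?_ hξ (hξd.differentiable (by simp)) _ (hint k)
      (per_int (hξ.pd _) (C1_pd_cont hξd _))
    · exact (h.per.pd (dir k)).op (Wd_per hVp h.per k) fun a b => β⁻¹ * a + b
    · exact ((h.pd_diff _).const_mul _).add ((hWC k).differentiable (by simp))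
  · intro k _
    exact Integrable.mul_bdd (c := K) (hint k) hξd.continuous.aestronglyMeasurable
      (Eventually.of_forall hK)

lemma Tst.c1 {η : Spc m → ℝ} (h : Tst η) : ContDiff ℝ 1 η := h.1.of_le (by exact_mod_cast le_top)

lemma Ph_C1 (a : ℝ) {η : Spc m → ℝ} (h : Tst η) : ContDiff ℝ 1 (Ph a η) := by
  rw [contDiff_one_iff_fderiv]
  refine ⟨Ph_diff a h, ?_⟩
  rw [continuous_clm_apply]
  intro v
  have : (fun x => fderiv ℝ (Ph a η) x v) = Ph a (pd v η) := Ph_pd a h v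
  rw [this]; exact Ph_cont a (h.pd v)

lemma A_Ph (hp : 1 ≤ p) (h : Snap p u) (hV : ContDiff ℝ 2 V) (hVp : Per V) {η : Spc m → ℝ}
    (hη : Tst η) (a : ℝ) :
    ∫ x in cube m, Aop V β u x * Ph a η x =
      β⁻¹ * (∫ x in cube m, u x * ∑ k, Ph a (pd (dir k) (pd (dir k) η)) x) -
       ∑ k, ∫ x in cube m, Wd V u k x * Ph a (pd (dir k) η) x := by
  rw [A_test hp h hV hVp (Ph_per a hη.2) (Ph_C1 a hη)]
  have hWC := fun k => Wd_C1 hV hVp h.per h.c1 h.pos k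
  have e1 : ∀ k, ∫ x in cube m, (β⁻¹ * pd (dir k) u x + Wd V u k x) * pd (dir k) (Ph a η) x =
      - (β⁻¹ * ∫ x in cube m, u x * Ph a (pd (dir k) (pd (dir k) η)) x) +
      ∫ x in cube m, Wd V u k x * Ph a (pd (dir k) η) x := by
    intro k
    rw [Ph_pd a hη]
    have hd := hη.pd (dir k)
    have := ibp h.per h.diff (Ph_per a hd.2) (Ph_diff a hd) (dir k)
      (per_int (h.per.pd _) (C1_pd_cont h.c1 _)) (by
        rw [Ph_pd a hd]; exact per_int (Ph_per a (hd.pd _).2) (Ph_cont a (hd.pd _)))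
    rw [Ph_pd a hd] at this
    rw [← mul_neg, ← this, ← integral_const_mul, ← integral_add]
    · congr 1; ext x; ring
    · refine Integrable.const_mul (per_int ((h.per.pd _).op (Ph_per a hd.2) (· * ·)) ?_) _
      exact (C1_pd_cont h.c1 _).mul (Ph_cont a hd)
    · exact per_int ((Wd_per hVp h.per k).op (Ph_per a hd.2) (· * ·))
        ((hWC k).continuous.mul (Ph_cont a hd))
  simp_rw [e1, Finset.sum_add_distrib, Finset.sum_neg_distrib, ← Finset.mul_sum]
  have e2 : ∫ x in cube m, u x * ∑ k, Ph a (pd (dir k) (pd (dir k) η)) x =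
      ∑ k, ∫ x in cube m, u x * Ph a (pd (dir k) (pd (dir k) η)) x := by
    simp_rw [Finset.mul_sum]
    rw [integral_finsetSum]
    intro k _
    have hd := (hη.pd (dir k)).pd (dir k)
    exact per_int (h.per.op (Ph_per a hd.2) (· * ·)) (h.diff.continuous.mul (Ph_cont a hd))
  rw [e2]; ring

end

structure Ctx (m : ℕ) (V : Spc m → ℝ) (β σ p : ℝ) (ψ0 : Spc m → ℝ)
    (Tmax : ℝ≥0∞) (ψ : ℝ → Spc m → ℝ) : Prop where
  hV : ContDiff ℝ 2 V
  hVp : Per V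
  hβ : 0 < β
  h1 : Hyp1 σ p ψ0
  h2 : Hyp2 m σ p
  sol : IsLpSolution V β σ p ψ0 Tmax ψ

lemma LpN_eq {m : ℕ} {p : ℝ} (hp : 0 < p) {f : Spc m → ℝ}
    (hf : MemLp f (ofReal p) (volume.restrict (cube m))) :
    LpN p f = ofReal (np p f) := by
  unfold LpN np μT
  rw [hf.eLpNorm_eq_integral_rpow_norm (by simpa using hp) (by simp), ENNReal.toReal_ofReal hp.le,
    one_div]
  rfl

lemma np_le_bd {m : ℕ} {q : ℝ} (hq : 0 < q) {f : Spc m → ℝ} {C : ℝ} (hC : 0 ≤ C)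
    (h : ∀ x, |f x| ≤ C) : np q f ≤ C := by
  have := finQ m
  have h1 : ∫ x in cube m, |f x| ^ q ≤ C ^ q := by
    have := norm_integral_le_of_norm_le_const (μ := volume.restrict (cube m))
      (f := fun x => |f x| ^ q) (C := C ^ q) (Eventually.of_forall fun x => by
        rw [Real.norm_eq_abs, abs_of_nonneg (by positivity)]; gcongr; exact h x)
    simp only [probReal_univ, mul_one] at this
    exact (le_abs_self _).trans this
  calc np q f ≤ (C ^ q) ^ (1 / q) :=
        Real.rpow_le_rpow (integral_nonneg fun x => by positivity) h1 (by positivity)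
    _ = C := by rw [← Real.rpow_mul hC, mul_one_div_cancel hq.ne', Real.rpow_one]

lemma Ph_lip {m : ℕ} {η : Spc m → ℝ} (h : Tst η) : ∃ C : ℝ, 0 ≤ C ∧ ∀ a b x,
    |Ph a η x - Ph b η x| ≤ C * |a - b| := by
  obtain ⟨C, hC0, hC⟩ := h.bdd'
  obtain ⟨D, hD0, hD⟩ := h.bdd
  have hI := gam_pow m 1
  have hc := h.cont
  refine ⟨C * ∫ z, ‖z‖ ^ 1 ∂(gam m), mul_nonneg hC0 (integral_nonneg fun z => by positivity),
    fun a b x => ?_⟩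
  unfold Ph
  have i1 : ∀ a : ℝ, Integrable (fun z => η (x + a • z)) (gam m) := fun a =>
    Integrable.of_bound (C := D) (by fun_prop : Continuous _).aestronglyMeasurable
      (Eventually.of_forall fun z => hD _)
  rw [← integral_sub (i1 a) (i1 b)]
  have e : C * (∫ z : Spc m, ‖z‖ ^ 1 ∂(gam m)) * |a - b| =
    ∫ z : Spc m, C * |a - b| * ‖z‖ ^ 1 ∂(gam m) := by rw [integral_const_mul]; ring
  rw [e]
  refine abs_int_le (hI.const_mul _) fun z => ?_
  have := Convex.norm_image_sub_le_of_norm_fderiv_le (f := η) (𝕜 := ℝ) (s := univ) (C := C)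
    (fun y _ => h.diff y) (fun y _ => hC y) convex_univ (mem_univ (x + b • z)) (mem_univ (x + a • z))
  refine (le_of_eq (Real.norm_eq_abs _).symm).trans (this.trans (le_of_eq ?_))
  rw [add_sub_add_left_eq_sub, ← sub_smul, norm_smul, Real.norm_eq_abs]; ring

namespace Ctx
variable {m : ℕ} {V : Spc m → ℝ} {β σ p : ℝ} {ψ0 : Spc m → ℝ} {Tmax : ℝ≥0∞} {ψ : ℝ → Spc m → ℝ}
  (H : Ctx m V β σ p ψ0 Tmax ψ)

lemma p1 (H : Ctx m V β σ p ψ0 Tmax ψ) : 1 < p := by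
  have := H.h2.2.1
  have : (0:ℝ) ≤ m := by positivity
  linarith [H.h2.2.1]

lemma p0 (H : Ctx m V β σ p ψ0 Tmax ψ) : 0 < p := zero_lt_one.trans H.p1

lemma snap (H : Ctx m V β σ p ψ0 Tmax ψ) {t : ℝ} (ht : t ∈ Ioo0 Tmax) : Snap p (ψ t) :=
  snap_of (H.sol.regW2 t ht) (H.sol.regD t ht)

lemma psi0_eq (H : Ctx m V β σ p ψ0 Tmax ψ) : ψ 0 = ψ0 := funext H.sol.init

lemma sig1 (H : Ctx m V β σ p ψ0 Tmax ψ) : 1 < σ := by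
  have h := H.h2.2.2.1
  have : 0 < ((m:ℝ) + 1) / p := div_pos (by positivity) H.p0
  linarith

lemma per (H : Ctx m V β σ p ψ0 Tmax ψ) {t : ℝ} (ht : t ∈ Ico0 Tmax) : Per (ψ t) := by
  rcases eq_or_lt_of_le ht.1 with h | h
  · rw [← h, H.psi0_eq]; exact (per_iff _).1 H.h1.1.1.1
  · exact (H.snap ⟨h, ht.2⟩).per

lemma diff (H : Ctx m V β σ p ψ0 Tmax ψ) {t : ℝ} (ht : t ∈ Ico0 Tmax) : Differentiable ℝ (ψ t) := by
  rcases eq_or_lt_of_le ht.1 with h | h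
  · rw [← h, H.psi0_eq]; exact H.h1.1.1.2.2.1 H.sig1.le
  · exact (H.snap ⟨h, ht.2⟩).diff

lemma cont (H : Ctx m V β σ p ψ0 Tmax ψ) {t : ℝ} (ht : t ∈ Ico0 Tmax) : Continuous (ψ t) :=
  (H.diff ht).continuous

lemma sub_mem {t : ℝ} (ht : t ∈ Ioo0 Tmax) : t ∈ Ico0 Tmax := ⟨ht.1.le, ht.2⟩

lemma conv (H : Ctx m V β σ p ψ0 Tmax ψ) {t : ℝ} (ht : t ∈ Ico0 Tmax) {ε : ℝ} (hε : 0 < ε) :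
    ∃ δ > 0, ∀ t' ∈ Ico0 Tmax, |t' - t| < δ → np p (fun x => ψ t' x - ψ t x) < ε := by
  obtain ⟨δ, hδ, h⟩ := H.sol.contLp t ht ε hε
  refine ⟨δ, hδ, fun t' ht' h' => ?_⟩
  have h3 := h t' ht' h'
  have hm : MemLp (fun x => ψ t' x - ψ t x) (ofReal p) (volume.restrict (cube m)) :=
    per_memLp ((H.per ht').op (H.per ht) (· - ·)) ((H.cont ht').sub (H.cont ht)) _
  simp only [WNorm, le_refl, if_true] at h3
  rw [LpN_eq H.p0 hm] at h3
  exact (ofReal_lt_ofReal_iff hε).1 h3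

lemma nhds_mem {t : ℝ} (ht : t ∈ Ioo0 Tmax) : ∀ᶠ s in 𝓝 t, s ∈ Ioo0 Tmax := by
  have h1 : ∀ᶠ s in 𝓝 t, ofReal s < Tmax :=
    ENNReal.continuous_ofReal.continuousAt.eventually (gt_mem_nhds ht.2)
  filter_upwards [lt_mem_nhds ht.1, h1] with s a b using ⟨a, b⟩

lemma holder_bd (H : Ctx m V β σ p ψ0 Tmax ψ) {w g : Spc m → ℝ}
    (hw : MemLp w (ofReal p) (volume.restrict (cube m))) (hg : Measurable g)
    {K : ℝ} (hK0 : 0 ≤ K) (hK : ∀ x, |g x| ≤ K) : |∫ x in cube m, w x * g x| ≤ np p w * K := by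
  have hpq := Real.HolderConjugate.conjExponent H.p1
  have := finQ m
  refine (holder' hpq hw (MemLp.of_bound hg.aestronglyMeasurable K
    (Eventually.of_forall hK))).trans ?_
  exact mul_le_mul_of_nonneg_left (np_le_bd hpq.symm.pos hK0 hK) (np_nonneg _ _)

lemma pair_deriv' (H : Ctx m V β σ p ψ0 Tmax ψ) {s : ℝ} (hs : s ∈ Ioo0 Tmax) {g : Spc m → ℝ}
    (hg : Measurable g) {K : ℝ} (hK0 : 0 ≤ K) (hK : ∀ x, |g x| ≤ K) :
    HasDerivAt (fun r => ∫ x in cube m, ψ r x * g x) (∫ x in cube m, Aop V β (ψ s) x * g x) s := by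
  rw [hasDerivAt_iff_tendsto_slope_zero, tendsto_iff_norm_sub_tendsto_zero]
  have h0 : Tendsto (fun h => s + h) (𝓝[≠] 0) (𝓝 s) := by
    have : Tendsto (fun h => s + h) (𝓝 0) (𝓝 (s + 0)) := (continuous_const.add continuous_id).tendsto 0
    rw [add_zero] at this
    exact this.mono_left nhdsWithin_le_nhds
  have hev := h0.eventually (nhds_mem hs)
  have hE : Tendsto (fun h : ℝ => LpN p
        (fun x => (ψ (s + h) x - ψ s x) / h - (β⁻¹ * lap (ψ s) x + Fop V (ψ s) x)))
      (𝓝[≠] 0) (𝓝 0) := H.sol.eqn s hs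
  have hA := A_memLp (β := β) (H.snap hs) H.hV H.hVp
  have key : ∀ᶠ h in 𝓝[≠] (0:ℝ),
      ‖h⁻¹ • ((∫ x in cube m, ψ (s + h) x * g x) - ∫ x in cube m, ψ s x * g x) -
        ∫ x in cube m, Aop V β (ψ s) x * g x‖ ≤ (LpN p
        (fun x => (ψ (s + h) x - ψ s x) / h - (β⁻¹ * lap (ψ s) x + Fop V (ψ s) x))).toReal * K := by
    filter_upwards [hev] with h hh
    have hp := H.per (sub_mem hh); have hpc := H.cont (sub_mem hh)
    have hp' := H.per (sub_mem hs); have hpc' := H.cont (sub_mem hs)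
    have hm : MemLp (fun x => (ψ (s + h) x - ψ s x) / h - (β⁻¹ * lap (ψ s) x + Fop V (ψ s) x))
        (ofReal p) (volume.restrict (cube m)) := by
      refine MemLp.sub ?_ hA
      exact per_memLp (hp.op hp' fun a b => (a - b) / h) ((hpc.sub hpc').div_const _) _
    rw [LpN_eq H.p0 hm, ENNReal.toReal_ofReal (np_nonneg _ _)]
    refine le_trans (le_of_eq ?_) (H.holder_bd hm hg hK0 hK)
    rw [Real.norm_eq_abs]
    congr 1
    have I1 : IntegrableOn (fun x => ψ (s+h) x * g x) (cube m) := Integrable.mul_bdd (c := K)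
      (per_int hp hpc) hg.aestronglyMeasurable (Eventually.of_forall hK)
    have I2 : IntegrableOn (fun x => ψ s x * g x) (cube m) := Integrable.mul_bdd (c := K)
      (per_int hp' hpc') hg.aestronglyMeasurable (Eventually.of_forall hK)
    rw [← integral_sub I1 I2, smul_eq_mul, ← integral_const_mul, ← integral_sub]
    · congr 1; ext x; simp only [Aop]; ring
    · exact Integrable.const_mul (I1.sub I2) _
    · exact Integrable.mul_bdd (c := K) (memLp_int H.p1.le hA) hg.aestronglyMeasurable
        (Eventually.of_forall hK)
  refine tendsto_of_tendsto_of_tendsto_of_le_of_le' tendsto_const_nhds ?_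
    (Eventually.of_forall fun _ => norm_nonneg _) key
  have := ((ENNReal.tendsto_toReal (by simp : (0:ℝ≥0∞) ≠ ⊤)).comp hE).mul_const K
  rw [ENNReal.toReal_zero, zero_mul] at this
  exact this

lemma pair_deriv (H : Ctx m V β σ p ψ0 Tmax ψ) {s : ℝ} (hs : s ∈ Ioo0 Tmax) {g : Spc m → ℝ}
    (hg : Per g) (hc : Continuous g) :
    HasDerivAt (fun r => ∫ x in cube m, ψ r x * g x) (∫ x in cube m, Aop V β (ψ s) x * g x) s := by
  obtain ⟨K, hK0, hK⟩ := per_bdd hg hc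
  exact H.pair_deriv' hs hc.measurable hK0 hK

def kf (ψ : ℝ → Spc m → ℝ) (β t : ℝ) (η : Spc m → ℝ) (a : ℝ) : ℝ :=
  ∫ x in cube m, ψ (t - β * a ^ 2 / 2) x * Ph a η x

lemma Ph_pair_deriv {u η : Spc m → ℝ} (hu : Per u) (huc : Continuous u) (hη : Tst η) (a : ℝ) :
    HasDerivAt (fun b => ∫ x in cube m, u x * Ph b η x)
      (∫ x in cube m, u x * (a * ∑ k, Ph a (pd (dir k) (pd (dir k) η)) x)) a := by
  have := finQ m
  obtain ⟨K, hK0, hK⟩ := per_bdd hu huc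
  choose C hC0 hC using fun k : Option (Fin m) => ((hη.pd (dir k)).pd (dir k)).bdd
  have hcS : ∀ b, Continuous fun x => u x * (b * ∑ k, Ph b (pd (dir k) (pd (dir k) η)) x) := fun b =>
    huc.mul (continuous_const.mul (continuous_finsetSum _ fun k _ => Ph_cont b ((hη.pd _).pd _)))
  refine (hasDerivAt_integral_of_dominated_loc_of_deriv_le (s := Metric.ball a 1)
    (μ := volume.restrict (cube m)) (F := fun b x => u x * Ph b η x)
    (F' := fun b x => u x * (b * ∑ k, Ph b (pd (dir k) (pd (dir k) η)) x))
    (bound := fun _ => K * ((|a| + 1) * ∑ k, C k)) (Metric.ball_mem_nhds a one_pos)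
    ?_ ?_ ?_ ?_ (integrable_const _) ?_).2
  · exact Eventually.of_forall fun b => (huc.mul (Ph_cont b hη)).aestronglyMeasurable
  · exact per_int (hu.op (Ph_per a hη.2) (· * ·)) (huc.mul (Ph_cont a hη))
  · exact (hcS a).aestronglyMeasurable
  · refine Eventually.of_forall fun x b hb => ?_
    rw [norm_mul, norm_mul]
    have hb' : ‖b‖ ≤ |a| + 1 := by
      rw [Metric.mem_ball, Real.dist_eq] at hb
      rw [Real.norm_eq_abs]
      have := abs_sub_abs_le_abs_sub b a
      linarith
    gcongr
    · exact hK x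
    · exact (norm_sum_le _ _).trans (Finset.sum_le_sum fun k _ => Ph_bd b (hC k) x)
  · exact Eventually.of_forall fun x b _ => (Ph_da b hη x).const_mul (u x)

lemma kf_split (H : Ctx m V β σ p ψ0 Tmax ψ) {t a b : ℝ} {η : Spc m → ℝ} (hη : Tst η)
    (ha : t - β * a ^ 2 / 2 ∈ Ico0 Tmax) (hb : t - β * b ^ 2 / 2 ∈ Ico0 Tmax) :
    kf ψ β t η b = (∫ x in cube m, ψ (t - β * b ^ 2 / 2) x * Ph a η x)
      + (∫ x in cube m, ψ (t - β * a ^ 2 / 2) x * Ph b η x)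
      - (∫ x in cube m, ψ (t - β * a ^ 2 / 2) x * Ph a η x)
      + ∫ x in cube m, (ψ (t - β * b ^ 2 / 2) x - ψ (t - β * a ^ 2 / 2) x) * (Ph b η x - Ph a η x) := by
  set u := ψ (t - β * a ^ 2 / 2)
  set v := ψ (t - β * b ^ 2 / 2) with hv
  have hi : ∀ {s} (_ : s ∈ Ico0 Tmax) (c : ℝ), IntegrableOn (fun x => ψ s x * Ph c η x) (cube m) :=
    fun hs c => per_int ((H.per hs).op (Ph_per c hη.2) (· * ·)) ((H.cont hs).mul (Ph_cont c hη))
  have e : ∀ x, (v x - u x) * (Ph b η x - Ph a η x) =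
    (v x * Ph b η x - v x * Ph a η x) - (u x * Ph b η x - u x * Ph a η x) := fun x => by ring
  simp_rw [e]
  have j1 : IntegrableOn (fun x => v x * Ph b η x - v x * Ph a η x) (cube m) := (hi hb b).sub (hi hb a)
  have j2 : IntegrableOn (fun x => u x * Ph b η x - u x * Ph a η x) (cube m) := (hi ha b).sub (hi ha a)
  rw [integral_sub j1 j2,
    integral_sub (hi hb b) (hi hb a), integral_sub (hi ha b) (hi ha a)]
  unfold kf; rw [← hv]; ring

lemma kf_rem (H : Ctx m V β σ p ψ0 Tmax ψ) {t : ℝ} {η : Spc m → ℝ} (hη : Tst η) :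
    ∃ C : ℝ, 0 ≤ C ∧ ∀ a b, t - β * a ^ 2 / 2 ∈ Ico0 Tmax → t - β * b ^ 2 / 2 ∈ Ico0 Tmax →
    |∫ x in cube m, (ψ (t - β * b ^ 2 / 2) x - ψ (t - β * a ^ 2 / 2) x) * (Ph b η x - Ph a η x)| ≤
      np p (fun x => ψ (t - β * b ^ 2 / 2) x - ψ (t - β * a ^ 2 / 2) x) * (C * |b - a|) := by
  obtain ⟨C, hC0, hC⟩ := Ph_lip hη
  refine ⟨C, hC0, fun a b ha hb => ?_⟩
  refine H.holder_bd (g := fun x => Ph b η x - Ph a η x)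
    (per_memLp ((H.per hb).op (H.per ha) (· - ·)) ((H.cont hb).sub (H.cont ha)) _)
    ((Ph_cont b hη).sub (Ph_cont a hη)).measurable (by positivity)
    fun x => hC b a x

lemma tt_tend (t β a : ℝ) : Tendsto (fun b : ℝ => t - β * b ^ 2 / 2) (𝓝 a) (𝓝 (t - β * a ^ 2 / 2)) :=
  (by fun_prop : Continuous fun b : ℝ => t - β * b ^ 2 / 2).tendsto a

lemma kf_deriv (H : Ctx m V β σ p ψ0 Tmax ψ) {t a : ℝ} {η : Spc m → ℝ} (hη : Tst η)
    (ha : t - β * a ^ 2 / 2 ∈ Ioo0 Tmax) :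
    HasDerivAt (kf ψ β t η) (β * a * ∑ k, ∫ x in cube m,
      Wd V (ψ (t - β * a ^ 2 / 2)) k x * Ph a (pd (dir k) η) x) a := by
  have hs := sub_mem ha
  have d1 := H.pair_deriv ha (Ph_per a hη.2) (Ph_cont a hη)
  have d0 : HasDerivAt (fun b : ℝ => t - β * b ^ 2 / 2) (- (β * a)) a := by
    have := (((hasDerivAt_pow 2 a).const_mul β).div_const 2).const_sub t
    refine this.congr_deriv ?_
    push_cast; ring
  have d1' := HasDerivAt.comp a d1 d0
  have d2 := Ph_pair_deriv (H.per hs) (H.cont hs) hη a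
  obtain ⟨C, hC0, hC⟩ := H.kf_rem (t := t) hη
  have hev : ∀ᶠ b in 𝓝 a, t - β * b ^ 2 / 2 ∈ Ioo0 Tmax := (tt_tend t β a).eventually (nhds_mem ha)
  have d3 : HasDerivAt (fun b => ∫ x in cube m,
      (ψ (t - β * b ^ 2 / 2) x - ψ (t - β * a ^ 2 / 2) x) * (Ph b η x - Ph a η x)) 0 a := by
    rw [hasDerivAt_iff_isLittleO]
    have z0 : ∫ x in cube m, (ψ (t - β * a ^ 2 / 2) x - ψ (t - β * a ^ 2 / 2) x) *
        (Ph a η x - Ph a η x) = 0 := by simp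
    rw [Asymptotics.isLittleO_iff]
    intro c hc
    obtain ⟨δ, hδ, h⟩ := H.conv hs (ε := c / (C + 1)) (by positivity)
    have h4 : ∀ᶠ b in 𝓝 a, |t - β * b ^ 2 / 2 - (t - β * a ^ 2 / 2)| < δ :=
      (tt_tend t β a).eventually (Metric.ball_mem_nhds _ hδ)
    filter_upwards [hev, h4] with b hb hb4
    rw [Real.norm_eq_abs, Real.norm_eq_abs, z0, smul_zero, sub_zero, sub_zero]
    refine (hC a b hs (sub_mem hb)).trans ?_
    have h5 := (h _ (sub_mem hb) hb4).le
    calc _ ≤ c / (C + 1) * (C * |b - a|) := by gcongr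
      _ ≤ c / (C + 1) * ((C + 1) * |b - a|) := by gcongr; linarith
      _ = c * |b - a| := by field_simp
  have d4 := ((d1'.add d2).sub_const
    (∫ x in cube m, ψ (t - β * a ^ 2 / 2) x * Ph a η x)).add d3
  have d5 := d4.congr_of_eventuallyEq (f₁ := kf ψ β t η) (by
    filter_upwards [hev] with b hb
    rw [H.kf_split hη hs (sub_mem hb)]; rfl)
  refine d5.congr_deriv ?_
  have e : ∫ x in cube m, ψ (t - β * a ^ 2 / 2) x * (a * ∑ k, Ph a (pd (dir k) (pd (dir k) η)) x) =
      a * ∫ x in cube m, ψ (t - β * a ^ 2 / 2) x * ∑ k, Ph a (pd (dir k) (pd (dir k) η)) x := by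
    rw [← integral_const_mul]; congr 1; ext x; ring
  rw [e, A_Ph H.p1.le (H.snap ha) H.hV H.hVp hη a]
  have := H.hβ
  field_simp
  ring

lemma kf_cont (H : Ctx m V β σ p ψ0 Tmax ψ) {t a0 : ℝ} {η : Spc m → ℝ} (hη : Tst η)
    (ht : t ∈ Ico0 Tmax) (ha0 : β * a0 ^ 2 / 2 ≤ t) :
    ContinuousOn (kf ψ β t η) (Icc 0 a0) := by
  have hβ := H.hβ
  have hmem : ∀ b ∈ Icc 0 a0, t - β * b ^ 2 / 2 ∈ Ico0 Tmax := fun b hb => by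
    have h1 : b ^ 2 ≤ a0 ^ 2 := pow_le_pow_left₀ hb.1 hb.2 2
    have h2 : β * b ^ 2 ≤ β * a0 ^ 2 := by gcongr
    refine ⟨by linarith, lt_of_le_of_lt (ofReal_le_ofReal ?_) ht.2⟩
    have : 0 ≤ β * b ^ 2 := by positivity
    linarith
  intro a ha
  have hs := hmem a ha
  obtain ⟨C, hC0, hC⟩ := H.kf_rem (t := t) hη
  obtain ⟨K, hK0, hK⟩ := hη.bdd
  have hconv : Tendsto (fun b => np p (fun x => ψ (t - β * b ^ 2 / 2) x - ψ (t - β * a ^ 2 / 2) x))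
      (𝓝[Icc 0 a0] a) (𝓝 0) := by
    rw [Metric.tendsto_nhds]
    intro ε hε
    obtain ⟨δ, hδ, h⟩ := H.conv hs hε
    have h4 : ∀ᶠ b in 𝓝[Icc 0 a0] a, |t - β * b ^ 2 / 2 - (t - β * a ^ 2 / 2)| < δ :=
      ((tt_tend t β a).mono_left nhdsWithin_le_nhds).eventually (Metric.ball_mem_nhds _ hδ)
    filter_upwards [h4, self_mem_nhdsWithin] with b hb hbm
    rw [Real.dist_eq, sub_zero, abs_of_nonneg (np_nonneg _ _)]
    exact h _ (hmem b hbm) hb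
  have t1 : Tendsto (fun b => ∫ x in cube m, ψ (t - β * b ^ 2 / 2) x * Ph a η x) (𝓝[Icc 0 a0] a)
      (𝓝 (∫ x in cube m, ψ (t - β * a ^ 2 / 2) x * Ph a η x)) := by
    rw [tendsto_iff_norm_sub_tendsto_zero]
    refine tendsto_of_tendsto_of_tendsto_of_le_of_le' tendsto_const_nhds
      (by simpa using hconv.mul_const K) (Eventually.of_forall fun _ => norm_nonneg _) ?_
    filter_upwards [self_mem_nhdsWithin] with b hb
    have hsb := hmem b hb
    rw [← integral_sub (per_int ((H.per hsb).op (Ph_per a hη.2) (· * ·))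
      ((H.cont hsb).mul (Ph_cont a hη))) (per_int ((H.per hs).op (Ph_per a hη.2) (· * ·))
      ((H.cont hs).mul (Ph_cont a hη)))]
    simp_rw [← sub_mul]
    exact H.holder_bd (per_memLp ((H.per hsb).op (H.per hs) (· - ·)) ((H.cont hsb).sub (H.cont hs)) _)
      (Ph_cont a hη).measurable hK0 (Ph_bd a hK)
  have t2 := ((Ph_pair_deriv (H.per hs) (H.cont hs) hη a).continuousAt.tendsto).mono_left
    (nhdsWithin_le_nhds (s := Icc 0 a0))
  have t3 : Tendsto (fun b => ∫ x in cube m,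
      (ψ (t - β * b ^ 2 / 2) x - ψ (t - β * a ^ 2 / 2) x) * (Ph b η x - Ph a η x))
      (𝓝[Icc 0 a0] a) (𝓝 0) := by
    have hb : Tendsto (fun b : ℝ => C * |b - a|) (𝓝[Icc 0 a0] a) (𝓝 (C * |a - a|)) :=
      ((by fun_prop : Continuous fun b : ℝ => C * |b - a|).tendsto a).mono_left nhdsWithin_le_nhds
    rw [tendsto_zero_iff_norm_tendsto_zero]
    refine tendsto_of_tendsto_of_tendsto_of_le_of_le' tendsto_const_nhds
      (by simpa using hconv.mul hb) (Eventually.of_forall fun _ => norm_nonneg _) ?_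
    filter_upwards [self_mem_nhdsWithin] with b hb
    exact hC a b hs (hmem b hb)
  have t4 := ((t1.add t2).sub_const (∫ x in cube m, ψ (t - β * a ^ 2 / 2) x * Ph a η x)).add t3
  have e : kf ψ β t η a = (∫ x in cube m, ψ (t - β * a ^ 2 / 2) x * Ph a η x) +
      (∫ x in cube m, ψ (t - β * a ^ 2 / 2) x * Ph a η x) -
      (∫ x in cube m, ψ (t - β * a ^ 2 / 2) x * Ph a η x) + 0 := by simp [kf]
  unfold ContinuousWithinAt
  rw [e]
  refine t4.congr' ?_
  filter_upwards [self_mem_nhdsWithin] with b hb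
  rw [H.kf_split hη hs (hmem b hb)]

end Ctx

lemma mv_pow {k k' : ℝ → ℝ} {a0 C θ : ℝ} (ha0 : 0 ≤ a0) (hθ : 0 < θ)
    (hc : ContinuousOn k (Icc 0 a0)) (hd : ∀ a ∈ Ioo 0 a0, HasDerivAt k (k' a) a)
    (hb : ∀ a ∈ Ioo 0 a0, |k' a| ≤ C * a ^ (θ - 1)) : |k a0 - k 0| ≤ C * a0 ^ θ / θ := by
  have hcp : ContinuousOn (fun a : ℝ => C * a ^ θ / θ) (Icc 0 a0) :=
    (((Real.continuous_rpow_const hθ.le).const_mul C |>.div_const θ)).continuousOn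
  have hdp : ∀ a ∈ Ioo 0 a0, HasDerivAt (fun a : ℝ => C * a ^ θ / θ) (C * a ^ (θ - 1)) a := by
    intro a ha
    have := ((Real.hasDerivAt_rpow_const (x := a) (p := θ) (Or.inl ha.1.ne')).const_mul C).div_const θ
    refine this.congr_deriv ?_; field_simp
  have m1 : ∀ ε : ℝ, |ε| = 1 → MonotoneOn (fun a => C * a ^ θ / θ + ε * k a) (Icc 0 a0) := by
    intro ε hε
    refine monotoneOn_of_hasDerivWithinAt_nonneg (convex_Icc 0 a0)
      (f' := fun a => C * a ^ (θ - 1) + ε * k' a) (hcp.add (hc.const_mul ε)) ?_ ?_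
    · intro a ha; rw [interior_Icc] at ha
      exact ((hdp a ha).add ((hd a ha).const_mul ε)).hasDerivWithinAt
    · intro a ha; rw [interior_Icc] at ha
      have h1 := hb a ha
      have h2 : -(ε * k' a) ≤ |k' a| := by
        refine (neg_le_abs _).trans ?_; rw [abs_mul, hε, one_mul]
      linarith
  have z : (0:ℝ) ^ θ = 0 := Real.zero_rpow hθ.ne'
  have h1 := m1 1 (by simp) ⟨le_rfl, ha0⟩ ⟨ha0, le_rfl⟩ ha0
  have h2 := m1 (-1) (by simp) ⟨le_rfl, ha0⟩ ⟨ha0, le_rfl⟩ ha0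
  simp only [z, mul_zero, zero_div] at h1 h2
  rw [abs_le]; constructor <;> linarith

lemma Ph_zero {m : ℕ} (η : Spc m → ℝ) : Ph 0 η = η := by
  ext x; simp [Ph]

namespace Ctx
variable {m : ℕ} {V : Spc m → ℝ} {β σ p : ℝ} {ψ0 : Spc m → ℝ} {Tmax : ℝ≥0∞} {ψ : ℝ → Spc m → ℝ}

lemma tmem {t a a0 : ℝ} (hβ : 0 < β) (ht : t ∈ Ico0 Tmax) (ha0 : β * a0 ^ 2 / 2 ≤ t)
    (ha : a ∈ Ioo 0 a0) : t - β * a ^ 2 / 2 ∈ Ioo0 Tmax ∧ t - β * a ^ 2 / 2 ≤ t := by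
  have h1 : a ^ 2 < a0 ^ 2 := pow_lt_pow_left₀ ha.2 ha.1.le (by simp)
  have h2 : β * a ^ 2 < β * a0 ^ 2 := by gcongr
  have : 0 ≤ β * a ^ 2 := by positivity
  refine ⟨⟨by linarith, lt_of_le_of_lt (ofReal_le_ofReal ?_) ht.2⟩, ?_⟩ <;>
  linarith

lemma flow (H : Ctx m V β σ p ψ0 Tmax ψ) {t a0 C θ : ℝ} {η : Spc m → ℝ} (hη : Tst η)
    (ht : t ∈ Ico0 Tmax) (h0 : 0 ≤ a0) (ha0 : β * a0 ^ 2 / 2 ≤ t) (hθ : 0 < θ)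
    (hb : ∀ a ∈ Ioo 0 a0, ∀ s ∈ Ioo0 Tmax, s ≤ t → |β * a * ∑ k, ∫ x in cube m,
      Wd V (ψ s) k x * Ph a (pd (dir k) η) x| ≤ C * a ^ (θ - 1)) :
    |(∫ x in cube m, ψ t x * η x) - ∫ x in cube m, ψ (t - β * a0 ^ 2 / 2) x * Ph a0 η x| ≤
      C * a0 ^ θ / θ := by
  have := mv_pow h0 hθ (H.kf_cont hη ht ha0) (fun a ha => H.kf_deriv hη (tmem H.hβ ht ha0 ha).1)
    (fun a ha => hb a ha _ (tmem H.hβ ht ha0 ha).1 (tmem H.hβ ht ha0 ha).2)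
  rw [abs_sub_comm] at this
  simpa [kf, Ph_zero] using this

end Ctx

lemma fub {m : ℕ} {f : Spc m → ℝ} {G : ℝ → ℝ} (hf : Per f) (hc : Continuous f)
    (hG : Per (fun x : Spc m => G x.1)) (hGc : Continuous G) :
    ∫ x in cube m, f x * G x.1 = ∫ x in cube m, marg f x.1 * G x.1 := by
  have i1 := per_int (hf.op hG (· * ·)) (hc.mul (hGc.comp continuous_fst))
  have i2 := per_int ((marg_per hf).op hG (· * ·))
    (((marg_cont hf hc).comp continuous_fst).mul (hGc.comp continuous_fst))
  unfold cube at *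
  rw [Measure.volume_eq_prod] at *
  rw [setIntegral_prod _ i1, setIntegral_prod _ i2]
  refine setIntegral_congr_fun measurableSet_Ico fun x hx => ?_
  simp only [integral_mul_const, integral_const, probReal_univ, one_smul]
  rfl

def Inv1 {m : ℕ} (η : Spc m → ℝ) : Prop := ∀ v : Spc m, v.1 = 0 → ∀ x, η (x + v) = η x

lemma Inv1.eq {m : ℕ} {η : Spc m → ℝ} (h : Inv1 η) (x : Spc m) : η x = η (x.1, 0) := by
  have := h (0, x.2) rfl (x.1, 0)
  rw [← this]; simp

lemma Inv1.Ph {m : ℕ} {η : Spc m → ℝ} (h : Inv1 η) (a : ℝ) : Inv1 (Ph a η) := fun v hv x => by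
  unfold _root_.Ph; congr 1; ext z
  rw [add_right_comm]; exact h v hv _

lemma Inv1.pd {m : ℕ} {η : Spc m → ℝ} (h : Inv1 η) (w : Spc m) : Inv1 (pd w η) := fun v hv x => by
  have : (fun y => η (y + v)) = η := funext fun y => h v hv y
  show fderiv ℝ η _ w = fderiv ℝ η _ w
  rw [← fderiv_comp_add_right (f := η) (x := x) v, this]

lemma Inv1.pd_zero {m : ℕ} {η : Spc m → ℝ} (h : Inv1 η) (hd : Differentiable ℝ η) (w : Spc m)
    (hw : w.1 = 0) (x : Spc m) : _root_.pd w η x = 0 := by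
  have h1 : HasDerivAt (fun s : ℝ => x + s • w) w 0 := by
    have := ((hasDerivAt_id (0:ℝ)).smul_const w).const_add x
    simpa using this
  have h2 : HasFDerivAt η (fderiv ℝ η x) (x + (0:ℝ) • w) := by
    simpa using (hd x).hasFDerivAt
  have h3 := h2.comp_hasDerivAt (0:ℝ) h1
  have h4 : (η ∘ fun s : ℝ => x + s • w) = fun _ => η x := funext fun s => h (s • w) (by simp [hw]) x
  rw [h4] at h3
  exact h3.unique (hasDerivAt_const _ _)

lemma drift_inv {m : ℕ} {p : ℝ} {V u η : Spc m → ℝ} (hV : ContDiff ℝ 2 V) (hVp : Per V)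
    (h : Snap p u) (hη : Tst η) (hi : Inv1 η) (a : ℝ) :
    ∑ k, ∫ x in cube m, Wd V u k x * Ph a (pd (dir k) η) x = 0 := by
  refine Finset.sum_eq_zero fun k _ => ?_
  cases k with
  | some i =>
    have : ∀ x, Ph a (pd (dir (some i)) η) x = 0 := fun x => by
      simp [Ph, hi.pd_zero hη.diff (dir (some i)) rfl]
    simp [this]
  | none =>
    set g := Ph a (pd (dir none) η) with hg
    have hgt : Inv1 g := (hi.pd _).Ph a
    have hgp : Per g := Ph_per a (hη.pd _).2
    have hgc : Continuous g := Ph_cont a (hη.pd _)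
    simp_rw [hgt.eq]
    have hW := (Wd_C1 hV hVp h.per h.c1 h.pos none).continuous
    have e1 : (fun x : Spc m => g (x.1, 0)) = g := funext fun x => (hgt.eq x).symm
    have := fub (f := Wd V u none) (G := fun s => g (s, 0)) (Wd_per hVp h.per none) hW
      (by rw [e1]; exact hgp) (by fun_prop)
    rw [this]
    have hz : ∀ x1, marg (Wd V u none) x1 = 0 := by
      intro x1
      unfold marg Wd
      simp only [if_true]
      have c1 : Continuous (pd (dir none) V) := (pd_C1 hV _).continuous
      have c2 := h.diff.continuous
      have bI : ∀ f : Spc m → ℝ, Per f → Continuous f →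
          Integrable (fun y => f (x1, y)) (volume.restrict (cube1 m)) := fun f hf hc => by
        obtain ⟨K, _, hK⟩ := per_bdd hf hc
        exact Integrable.of_bound (C := K) (by fun_prop : Continuous _).aestronglyMeasurable
          (Eventually.of_forall fun y => hK _)
      rw [integral_sub (bI _ ((hVp.pd (dir none)).op h.per (· * ·)) (c1.mul c2))
        ((bI _ h.per c2).const_mul _), integral_const_mul]
      unfold phiF
      have := (h.pos x1).ne'
      unfold marg at this ⊢
      rw [div_mul_cancel₀ _ this]
      simp [dir]
    simp [hz]

lemma Tst_const {m : ℕ} (c : ℝ) : Tst (fun _ : Spc m => c) := ⟨contDiff_const, fun _ _ => rfl⟩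

lemma Ph_nonneg {m : ℕ} (a : ℝ) {η : Spc m → ℝ} (h : ∀ x, 0 ≤ η x) (x : Spc m) : 0 ≤ Ph a η x :=
  integral_nonneg fun _ => h _

lemma per_min {m : ℕ} {f : Spc m → ℝ} (hf : Per f) (hc : Continuous f) (h : ∀ x, 0 < f x) :
    ∃ c > 0, ∀ x, c ≤ f x := by
  obtain ⟨y, -, hy⟩ := (isCompact_Icc (a := (0 : Spc m)) (b := 1)).exists_isMinOn
    ⟨0, le_rfl, zero_le_one⟩ hc.continuousOn
  refine ⟨f y, h y, fun x => ?_⟩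
  obtain ⟨g, hg⟩ := exists_rep x
  rw [← hf g x]
  exact hy (cube_sub m hg)

namespace Ctx
variable {m : ℕ} {V : Spc m → ℝ} {β σ p : ℝ} {ψ0 : Spc m → ℝ} {Tmax : ℝ≥0∞} {ψ : ℝ → Spc m → ℝ}

lemma a0_sq (hβ : 0 < β) {t : ℝ} (ht : 0 ≤ t) : β * √(2 * t / β) ^ 2 / 2 = t := by
  rw [Real.sq_sqrt (by positivity)]; field_simp

lemma flow_inv (H : Ctx m V β σ p ψ0 Tmax ψ) {t : ℝ} {η : Spc m → ℝ} (hη : Tst η)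
    (hi : Inv1 η) (ht : t ∈ Ico0 Tmax) :
    ∫ x in cube m, ψ t x * η x = ∫ x in cube m, ψ0 x * Ph (√(2 * t / β)) η x := by
  have h := H.flow (C := 0) (θ := 1) hη ht (Real.sqrt_nonneg _) (a0_sq H.hβ ht.1).le one_pos
    (fun a ha s hs hst => by rw [drift_inv H.hV H.hVp (H.snap hs) hη hi]; simp)
  rw [a0_sq H.hβ ht.1, sub_self, H.psi0_eq] at h
  simp only [zero_mul, zero_div] at h
  exact sub_eq_zero.1 (abs_nonpos_iff.1 h)

lemma mass (H : Ctx m V β σ p ψ0 Tmax ψ) {t : ℝ} (ht : t ∈ Ico0 Tmax) :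
    ∫ x in cube m, ψ t x = 1 := by
  have h := H.flow_inv (Tst_const 1) (fun _ _ _ => rfl) ht
  rw [← H.h1.2.2]
  simpa [Ph] using h

lemma marg_low (H : Ctx m V β σ p ψ0 Tmax ψ) :
    ∃ m0 > 0, ∀ t ∈ Ico0 Tmax, ∀ x1, m0 ≤ marg (ψ t) x1 := by
  have hp0 : Per ψ0 := (per_iff _).1 H.h1.1.1.1
  have hc0 : Continuous ψ0 := (H.h1.1.1.2.2.1 H.sig1.le).continuous
  obtain ⟨m0, hm0, hmin⟩ := per_min (marg_per hp0) ((marg_cont hp0 hc0).comp continuous_fst)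
    fun x => H.h1.1.2 x.1
  refine ⟨m0, hm0, fun t ht x1 => ?_⟩
  have hp := H.per ht; have hc := H.cont ht
  have hmc := marg_cont hp hc
  have key : ∀ η, Tst η → Inv1 η → (∀ x, 0 ≤ η x) →
      0 ≤ ∫ x in cube m, (ψ t x - m0) * η x := by
    intro η hη hi hpos
    have i1 : IntegrableOn (fun x => ψ t x * η x) (cube m) :=
      per_int (hp.op hη.2 (· * ·)) (hc.mul hη.cont)
    have i2 : IntegrableOn η (cube m) := per_int hη.2 hη.cont
    simp_rw [sub_mul]
    rw [integral_sub i1 (i2.const_mul _), integral_const_mul, H.flow_inv hη hi ht,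
      ← Ph_mass (√(2 * t / β)) hη.2 hη.cont, ← integral_const_mul]
    set g := Ph (√(2 * t / β)) η with hg
    have hgt : Inv1 g := hi.Ph _
    have hgp : Per g := Ph_per _ hη.2
    have hgc : Continuous g := Ph_cont _ hη
    have e1 : (fun x : Spc m => g (x.1, 0)) = g := funext fun x => (hgt.eq x).symm
    simp_rw [hgt.eq]
    rw [fub (G := fun s => g (s, 0)) hp0 hc0 (by rw [e1]; exact hgp) (by fun_prop)]
    rw [sub_nonneg]
    refine integral_mono (per_int (f := fun x : Spc m => m0 * g (x.1, 0)) ?_ ?_)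
      (per_int (f := fun x : Spc m => marg ψ0 x.1 * g (x.1, 0)) ?_ ?_) fun x => ?_
    · exact Per.comp (f := fun x : Spc m => g (x.1, 0)) (by rw [e1]; exact hgp) fun t => m0 * t
    · fun_prop
    · exact (marg_per hp0).op (g := fun x : Spc m => g (x.1, 0)) (by rw [e1]; exact hgp) (· * ·)
    · exact ((marg_cont hp0 hc0).comp continuous_fst).mul (by fun_prop)
    · exact mul_le_mul_of_nonneg_right (hmin x) (Ph_nonneg _ hpos _)
  set G : ℝ → ℝ := fun s => max (m0 - marg (ψ t) s) 0 with hG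
  have hGc : Continuous G := (continuous_const.sub hmc).max continuous_const
  have hGp : Per (fun x : Spc m => G x.1) := (marg_per hp).comp fun r => max (m0 - r) 0
  have hGc' : Continuous (fun x : Spc m => G x.1) := hGc.comp continuous_fst
  obtain ⟨K, hK0, hK⟩ := per_bdd (hp.comp fun r => r - m0) (hc.sub continuous_const)
  have h1 : 0 ≤ ∫ x in cube m, (ψ t x - m0) * G x.1 := by
    refine le_of_forall_pos_le_add fun ε hε => ?_
    obtain ⟨η, hη, hη1, hη2, hη3⟩ := moll hGp hGc' (ε := ε / (K + 1)) (by positivity)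
    have h2 := key η hη (fun v hv x => hη3 v (fun y => by simp [hv]) x)
      (hη2 fun x => le_max_right _ _)
    have i1 : IntegrableOn (fun x => (ψ t x - m0) * η x) (cube m) :=
      per_int (hp.op hη.2 fun a b => (a - m0) * b) ((hc.sub continuous_const).mul hη.cont)
    have i2 : IntegrableOn (fun x => (ψ t x - m0) * G x.1) (cube m) :=
      per_int (hp.op hGp fun a b => (a - m0) * b) ((hc.sub continuous_const).mul hGc')
    have h3 : (∫ x in cube m, (ψ t x - m0) * η x) - ∫ x in cube m, (ψ t x - m0) * G x.1 ≤ ε := by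
      have := finQ m
      rw [← integral_sub i1 i2]
      have := abs_int_le (μ := volume.restrict (cube m)) (g := fun _ => ε)
        (f := fun x => (ψ t x - m0) * η x - (ψ t x - m0) * G x.1) (integrable_const _) fun x => by
          rw [← mul_sub, abs_mul]
          calc _ ≤ K * (ε / (K + 1)) := by gcongr; exacts [hK x, hη1 x]
            _ ≤ (K + 1) * (ε / (K + 1)) := by gcongr; linarith
            _ = ε := by field_simp
      simp only [integral_const, probReal_univ, one_smul] at this
      exact (le_abs_self _).trans this
    linarith
  have e2 : ∫ x in cube m, (ψ t x - m0) * G x.1 = - ∫ x in cube m, G x.1 ^ 2 := by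
    have i1 : IntegrableOn (fun x => ψ t x * G x.1) (cube m) :=
      per_int (hp.op hGp (· * ·)) (hc.mul hGc')
    have i2 : IntegrableOn (fun x => m0 * G x.1) (cube m) :=
      per_int (hGp.comp fun a => m0 * a) (continuous_const.mul hGc')
    have i3 : IntegrableOn (fun x => marg (ψ t) x.1 * G x.1) (cube m) :=
      per_int ((marg_per hp).op hGp (· * ·)) ((hmc.comp continuous_fst).mul hGc')
    simp_rw [sub_mul]
    rw [integral_sub i1 i2, fub hp hc hGp hGc, ← integral_sub i3 i2, ← integral_neg]
    congr 1; ext x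
    rcases le_total (m0 - marg (ψ t) x.1) 0 with h | h
    · simp [hG, h]
    · simp only [hG, max_eq_left h]; ring
  have h4 := per_zero (hGp.comp fun r => r ^ 2) (hGc'.pow 2) (fun x => by positivity)
    (by linarith) (x1, 0)
  have h5 : G x1 = 0 := by simpa using h4
  have := le_max_left (m0 - marg (ψ t) x1) 0
  have h6 : max (m0 - marg (ψ t) x1) 0 = 0 := h5
  linarith

end Ctx

lemma hd_sqmin (s : ℝ) : HasDerivAt (fun s : ℝ => (min s 0) ^ 2) (2 * min s 0) s := by
  rcases lt_trichotomy s 0 with h | h | h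
  · rw [min_eq_left h.le]
    have := hasDerivAt_pow 2 s
    refine (this.congr_of_eventuallyEq ?_).congr_deriv (by simp)
    filter_upwards [gt_mem_nhds h] with r hr
    rw [min_eq_left (le_of_lt hr)]
  · subst h
    simp only [min_self, mul_zero]
    rw [hasDerivAt_iff_isLittleO]
    simp only [min_self, sub_zero, smul_zero, ne_eq, OfNat.ofNat_ne_zero, not_false_eq_true, zero_pow]
    have h1 : (fun x : ℝ => (min x 0) ^ 2) =O[𝓝 0] fun x : ℝ => x ^ 2 := by
      refine Asymptotics.IsBigO.of_bound 1 (Eventually.of_forall fun x => ?_)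
      rw [norm_pow, norm_pow, one_mul]
      refine pow_le_pow_left₀ (norm_nonneg _) ?_ 2
      rcases le_total x 0 with h | h <;> simp [h]
    exact h1.trans_isLittleO (by simpa using Asymptotics.isLittleO_pow_pow (𝕜 := ℝ) one_lt_two)
  · rw [min_eq_right h.le]
    refine ((hasDerivAt_const s (0:ℝ)).congr_of_eventuallyEq ?_).congr_deriv (by simp)
    filter_upwards [lt_mem_nhds h] with r hr
    simp [min_eq_right (le_of_lt hr)]

def xi (ε s : ℝ) : ℝ := (min s 0) ^ 2 / ((min s 0) ^ 2 + ε ^ 2)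
def xi' (ε s : ℝ) : ℝ := 2 * min s 0 * ε ^ 2 / ((min s 0) ^ 2 + ε ^ 2) ^ 2

lemma xi_deriv {ε : ℝ} (hε : 0 < ε) (s : ℝ) : HasDerivAt (xi ε) (xi' ε s) s := by
  have := (hd_sqmin s).div ((hd_sqmin s).add_const (ε ^ 2)) (by positivity)
  refine this.congr_deriv ?_
  unfold xi'; congr 1; ring

lemma xi_C1 {ε : ℝ} (hε : 0 < ε) : ContDiff ℝ 1 (xi ε) := by
  refine contDiff_one_iff_deriv.2 ⟨fun s => (xi_deriv hε s).differentiableAt, ?_⟩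
  rw [show deriv (xi ε) = xi' ε from funext fun s => (xi_deriv hε s).deriv]
  unfold xi'
  refine Continuous.div (by fun_prop) (by fun_prop) fun s => by positivity

lemma xi'_neg (ε s : ℝ) : xi' ε s ≤ 0 := by
  unfold xi'
  refine div_nonpos_of_nonpos_of_nonneg ?_ (by positivity)
  have : min s 0 ≤ 0 := min_le_right _ _
  nlinarith [sq_nonneg ε]

lemma xi'_sq {ε : ℝ} (hε : 0 < ε) (s : ℝ) : -xi' ε s * s ^ 2 ≤ ε := by
  rcases le_total 0 s with h | h
  · simp [xi', min_eq_right h, hε.le]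
  · unfold xi'
    rw [min_eq_left h, ← neg_div, div_mul_eq_mul_div, div_le_iff₀ (by positivity)]
    have h1 : 2 * (-s) * ε ≤ s ^ 2 + ε ^ 2 := by nlinarith [sq_nonneg (s + ε)]
    have h2 : s ^ 2 ≤ s ^ 2 + ε ^ 2 := by nlinarith [sq_nonneg ε]
    have := mul_le_mul h1 h2 (sq_nonneg s) (by positivity)
    nlinarith [this, hε]

lemma xi_bd {ε : ℝ} (hε : 0 < ε) (s : ℝ) : |xi ε s| ≤ 1 := by
  unfold xi
  rw [abs_of_nonneg (by positivity), div_le_one (by positivity)]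
  nlinarith [sq_nonneg ε]

lemma dini {N : ℝ → ℝ} {T : ℝ} (hT : 0 ≤ T) (hc : ContinuousOn N (Icc 0 T))
    (h : ∀ t ∈ Ioc 0 T, ∀ ε > 0, ∀ᶠ s in 𝓝[<] t, N t - N s ≤ ε * (t - s)) : N T ≤ N 0 := by
  have := image_le_of_liminf_slope_right_le_deriv_boundary (f := fun x => N T - N (T - x)) (a := 0)
    (b := T) (B := fun _ => 0) (B' := fun _ => 0) ?_ (by simp) continuousOn_const
    (fun x _ => hasDerivWithinAt_const _ _ _) ?_ (right_mem_Icc.2 hT)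
  · simpa using this
  · refine continuousOn_const.sub (hc.comp (by fun_prop) fun x hx => ?_)
    exact ⟨by linarith [hx.2], by linarith [hx.1]⟩
  · intro x hx r hr
    have h1 := h (T - x) ⟨by linarith [hx.2], by linarith [hx.1]⟩ (r / 2) (by positivity)
    have h2 : Tendsto (fun z => T - z) (𝓝[>] x) (𝓝[<] (T - x)) := by
      refine tendsto_nhdsWithin_iff.2 ⟨?_, ?_⟩
      · exact ((continuous_const.sub continuous_id).tendsto x).mono_left nhdsWithin_le_nhds
      · filter_upwards [self_mem_nhdsWithin] with z hz
        simp only [mem_Iio, mem_Ioi] at *; linarith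
    have h3 := h2.eventually h1
    refine Eventually.frequently ?_
    filter_upwards [h3, self_mem_nhdsWithin] with z hz hz'
    simp only [mem_Ioi] at hz'
    rw [slope_def_field, div_lt_iff₀ (by linarith)]
    nlinarith [mul_pos hr (sub_pos.2 hz')]

lemma A_neg {m : ℕ} {p β : ℝ} {V u : Spc m → ℝ} (hp : 1 ≤ p) (hβ : 0 < β) (h : Snap p u)
    (hV : ContDiff ℝ 2 V) (hVp : Per V) :
    0 ≤ ∫ x in cube m, Aop V β u x * (if u x < 0 then 1 else 0) := by
  have hc := h.diff.continuous
  have hB : ∃ B : ℝ, 0 ≤ B ∧ ∀ k x, |Wd V u k x| ≤ B * |u x| := by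
    have h1 : ∀ k : Option (Fin m), ∃ B : ℝ, 0 ≤ B ∧ ∀ x, |Wd V u k x| ≤ B * |u x| := fun k => by
      obtain ⟨C1, h10, h1⟩ := per_bdd (hVp.pd (dir k)) (pd_C1 hV _).continuous
      obtain ⟨C2, h20, h2⟩ := per_bdd (phi_per hVp h.per)
        ((phi_C1 hV hVp h.per h.c1 h.pos).continuous.comp continuous_fst)
      refine ⟨C1 + C2, by positivity, fun x => ?_⟩
      unfold Wd
      refine (abs_sub _ _).trans ?_
      rw [abs_mul, add_mul]
      refine add_le_add (mul_le_mul_of_nonneg_right (h1 x) (abs_nonneg _)) ?_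
      split_ifs
      · rw [abs_mul]; exact mul_le_mul_of_nonneg_right (h2 x) (abs_nonneg _)
      · rw [abs_zero]; positivity
    choose B hB0 hB using h1
    exact ⟨∑ k, B k, Finset.sum_nonneg fun k _ => hB0 k, fun k x => (hB k x).trans
      (mul_le_mul_of_nonneg_right (Finset.single_le_sum (fun k _ => hB0 k) (Finset.mem_univ k))
        (abs_nonneg _))⟩
  obtain ⟨B, hB0, hB⟩ := hB
  have hA := memLp_int hp (A_memLp (β := β) h hV hVp)
  have key : ∀ ε : ℝ, 0 < ε → -((m + 1) * (β * B ^ 2 / 4) * ε) ≤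
      ∫ x in cube m, Aop V β u x * xi ε (u x) := by
    intro ε hε
    rw [A_test (β := β) hp h hV hVp (h.per.comp (xi ε)) ((xi_C1 hε).comp h.c1)]
    have hpd : ∀ k x, pd (dir k) (fun x => xi ε (u x)) x = xi' ε (u x) * pd (dir k) u x := by
      intro k x
      have := ((xi_deriv hε (u x)).comp_hasFDerivAt x (h.diff x).hasFDerivAt).fderiv
      unfold pd
      change (fderiv ℝ (xi ε ∘ u) x) _ = _
      rw [this]; rfl
    have hk : ∀ k, ∫ x in cube m, (β⁻¹ * pd (dir k) u x + Wd V u k x) *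
        pd (dir k) (fun x => xi ε (u x)) x ≤ β * B ^ 2 / 4 * ε := by
      intro k
      have hxc : ContDiff ℝ 1 (fun x => xi ε (u x)) := (xi_C1 hε).comp h.c1
      have hxp : Per (fun x => xi ε (u x)) := h.per.comp (xi ε)
      refine (setIntegral_mono (g := fun _ => β * B ^ 2 / 4 * ε) (per_int ?_ ?_) ?_ fun x => ?_).trans
        (by simp [Measure.real, vol_cube])
      · exact ((h.per.pd (dir k)).op (Wd_per hVp h.per k) fun a b => β⁻¹ * a + b).op
          (hxp.pd (dir k)) (· * ·)
      · exact ((continuous_const.mul (C1_pd_cont h.c1 _)).add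
          (Wd_C1 hV hVp h.per h.c1 h.pos k).continuous).mul (C1_pd_cont hxc _)
      · have := finQ m
        exact integrable_const _
      · simp only
        rw [hpd]
        have h1 := xi'_sq hε (u x)
        have h2 := xi'_neg ε (u x)
        have h3 := hB k x
        have h4 : (Wd V u k x) ^ 2 ≤ B ^ 2 * u x ^ 2 := by
          rw [← mul_pow, ← sq_abs (Wd V u k x), ← sq_abs (B * u x), abs_mul, abs_of_nonneg hB0]
          exact pow_le_pow_left₀ (abs_nonneg _) h3 2
        set d := -xi' ε (u x)
        have hd : xi' ε (u x) = -d := by simp [d]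
        rw [hd] at h2 ⊢
        have hd0 : 0 ≤ d := by linarith
        set a := pd (dir k) u x
        set w := Wd V u k x
        have h5 : -(β⁻¹ * a + w) * a ≤ β * w ^ 2 / 4 := by
          have : β * (β⁻¹ * a + w / 2) ^ 2 = β⁻¹ * a ^ 2 + w * a + β * w ^ 2 / 4 := by
            field_simp; ring
          nlinarith [mul_nonneg hβ.le (sq_nonneg (β⁻¹ * a + w / 2))]
        have h6 := mul_le_mul_of_nonneg_left h5 hd0
        have h7 : d * (β * w ^ 2 / 4) ≤ β * B ^ 2 / 4 * (d * u x ^ 2) := by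
          have := mul_le_mul_of_nonneg_left h4 (mul_nonneg hd0 hβ.le)
          nlinarith
        have h8 := mul_le_mul_of_nonneg_left h1 (by positivity : 0 ≤ β * B ^ 2 / 4)
        nlinarith
    have := Finset.sum_le_sum fun k (_ : k ∈ Finset.univ) => hk k
    simp only [Finset.sum_const, Finset.card_univ, Fintype.card_option, Fintype.card_fin,
      nsmul_eq_mul, Nat.cast_add, Nat.cast_one] at this
    rw [neg_le_neg_iff]
    refine this.trans (le_of_eq (by ring))
  have hlim : Tendsto (fun n : ℕ => ∫ x in cube m, Aop V β u x * xi (1 / ((n:ℝ) + 1)) (u x)) atTop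
      (𝓝 (∫ x in cube m, Aop V β u x * (if u x < 0 then 1 else 0))) := by
    refine tendsto_integral_of_dominated_convergence (fun x => |Aop V β u x|) (fun n => ?_) hA.abs
      (fun n => Eventually.of_forall fun x => ?_) (Eventually.of_forall fun x => ?_)
    · exact hA.aestronglyMeasurable.mul
        ((xi_C1 (by positivity)).continuous.comp hc).aestronglyMeasurable
    · rw [Real.norm_eq_abs, abs_mul]
      exact mul_le_of_le_one_right (abs_nonneg _) (xi_bd (by positivity) _)
    · refine Tendsto.const_mul _ ?_
      have h0 : Tendsto (fun n : ℕ => (1 / ((n:ℝ) + 1)) ^ 2) atTop (𝓝 0) := by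
        simpa using (tendsto_one_div_add_atTop_nhds_zero_nat (𝕜 := ℝ)).pow 2
      unfold xi
      split_ifs with hx
      · have hne : min (u x) 0 ^ 2 ≠ 0 := by
          rw [min_eq_left hx.le]; exact pow_ne_zero _ hx.ne
        have := (tendsto_const_nhds (x := min (u x) 0 ^ 2)).div
          (tendsto_const_nhds (x := min (u x) 0 ^ 2) |>.add h0) (by simpa using hne)
        rwa [add_zero, div_self hne] at this
      · rw [min_eq_right (not_lt.1 hx)]; simp
  refine ge_of_tendsto' (x := atTop) (f := fun n : ℕ =>
    (∫ x in cube m, Aop V β u x * xi (1 / ((n:ℝ) + 1)) (u x)) +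
      (m + 1) * (β * B ^ 2 / 4) * (1 / ((n:ℝ) + 1))) ?_
    (fun n => ?_)
  · have := hlim.add ((tendsto_one_div_add_atTop_nhds_zero_nat (𝕜 := ℝ)).const_mul
      ((m + 1) * (β * B ^ 2 / 4)))
    simpa using this
  · have := key (1 / ((n:ℝ) + 1)) (by positivity)
    linarith

namespace Ctx
variable {m : ℕ} {V : Spc m → ℝ} {β σ p : ℝ} {ψ0 : Spc m → ℝ} {Tmax : ℝ≥0∞} {ψ : ℝ → Spc m → ℝ}

lemma L1_le (H : Ctx m V β σ p ψ0 Tmax ψ) {f : Spc m → ℝ} (hf : Per f) (hc : Continuous f) :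
    ∫ x in cube m, |f x| ≤ np p f := by
  have := H.holder_bd (w := fun x => |f x|) (g := fun _ => 1) (K := 1)
    (per_memLp (hf.comp fun t => |t|) hc.abs _) measurable_const zero_le_one (by simp)
  simp only [mul_one, np, abs_abs] at this
  exact (le_abs_self _).trans this

lemma pos (H : Ctx m V β σ p ψ0 Tmax ψ) {t : ℝ} (ht : t ∈ Ico0 Tmax) (x : Spc m) : 0 ≤ ψ t x := by
  set N : ℝ → ℝ := fun s => ∫ x in cube m, max (-ψ s x) 0 with hN
  have mem : ∀ s ∈ Icc 0 t, s ∈ Ico0 Tmax := fun s hs =>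
    ⟨hs.1, (ofReal_le_ofReal hs.2).trans_lt ht.2⟩
  have iN : ∀ s ∈ Ico0 Tmax, IntegrableOn (fun x => max (-ψ s x) 0) (cube m) := fun s hs =>
    per_int ((H.per hs).comp fun a => max (-a) 0) ((H.cont hs).neg.max continuous_const)
  have hcont : ContinuousOn N (Icc 0 t) := by
    intro s hs
    rw [ContinuousWithinAt, Metric.tendsto_nhdsWithin_nhds]
    intro ε hε
    obtain ⟨δ, hδ, h⟩ := H.conv (mem s hs) hε
    refine ⟨δ, hδ, fun s' hs' hd => lt_of_le_of_lt ?_ (h s' (mem _ hs') hd)⟩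
    have hp' := (H.per (mem _ hs')).op (H.per (mem _ hs)) (· - ·)
    have hc' := (H.cont (mem _ hs')).sub (H.cont (mem _ hs))
    refine le_trans ?_ (H.L1_le hp' hc')
    rw [Real.dist_eq, hN]
    simp only
    rw [← integral_sub (iN _ (mem _ hs')) (iN _ (mem _ hs))]
    refine abs_int_le (per_int hp' hc').abs fun x => ?_
    refine (abs_max_sub_max_le_abs _ _ _).trans (le_of_eq ?_)
    rw [← abs_neg]; congr 1; ring
  have hdini := dini ht.1 hcont (fun s hs ε hε => by
    have hs' : s ∈ Ioo0 Tmax := ⟨hs.1, (mem s ⟨hs.1.le, hs.2⟩).2⟩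
    set g : Spc m → ℝ := fun x => if ψ s x < 0 then 1 else 0 with hg
    have hgm : Measurable g := Measurable.ite
      (measurableSet_lt (H.cont (sub_mem hs')).measurable measurable_const)
      measurable_const measurable_const
    have hg1 : ∀ x, |g x| ≤ 1 := fun x => by simp only [hg]; split_ifs <;> simp
    have hd := H.pair_deriv' hs' hgm zero_le_one hg1
    have hL := A_neg H.p1.le H.hβ (H.snap hs') H.hV H.hVp
    have h1 := hasDerivAt_iff_tendsto_slope.1 hd
    have h2 := (h1.mono_left (nhdsWithin_mono s fun y (hy : y < s) => hy.ne)).eventually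
      (lt_mem_nhds (lt_of_lt_of_le (neg_lt_zero.2 hε) hL))
    have h3 := (nhds_mem hs').filter_mono (nhdsWithin_le_nhds (s := Iio s))
    filter_upwards [h2, h3, self_mem_nhdsWithin] with r hr hr' hrs
    simp only [mem_Iio] at hrs
    rw [slope_comm, slope_def_field, lt_div_iff₀ (by linarith)] at hr
    have i1 : ∀ s ∈ Ioo0 Tmax, IntegrableOn (fun x => ψ s x * g x) (cube m) := fun s hs =>
      Integrable.mul_bdd (c := 1) (per_int (H.per (sub_mem hs)) (H.cont (sub_mem hs)))
        hgm.aestronglyMeasurable (Eventually.of_forall hg1)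
    have h5 : N s - N r ≤ (∫ x in cube m, ψ r x * g x) - ∫ x in cube m, ψ s x * g x := by
      simp only [hN]
      rw [← integral_sub (iN _ (sub_mem hs')) (iN _ (sub_mem hr')), ← integral_sub (i1 _ hr') (i1 _ hs')]
      refine setIntegral_mono ((iN _ (sub_mem hs')).sub (iN _ (sub_mem hr')))
        ((i1 _ hr').sub (i1 _ hs')) fun x => ?_
      simp only [hg]
      split_ifs with hx
      · have a1 := le_max_left (-ψ r x) 0
        rw [max_eq_left (by linarith : 0 ≤ -ψ s x)]; linarith
      · have a1 := le_max_right (-ψ r x) 0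
        rw [max_eq_right (by linarith : -ψ s x ≤ 0)]; linarith
    linarith)
  have hN0 : N 0 = 0 := by
    simp only [hN, H.psi0_eq]
    simp [H.h1.2.1]
  have hz : ∀ x, max (-ψ t x) 0 = 0 := by
    refine per_zero ((H.per ht).comp fun a => max (-a) 0) ((H.cont ht).neg.max continuous_const)
      (fun x => le_max_right _ _) ?_
    exact hdini.trans hN0.le
  have := hz x
  have h2 := le_max_left (-ψ t x) 0
  linarith

end Ctx

lemma np_tri {m : ℕ} {p : ℝ} (hp : 1 ≤ p) {f g : Spc m → ℝ}
    (hf : MemLp f (ofReal p) (volume.restrict (cube m)))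
    (hg : MemLp g (ofReal p) (volume.restrict (cube m))) :
    np p (fun x => f x + g x) ≤ np p f + np p g := by
  have h0 : 0 < p := by linarith
  have h := eLpNorm_add_le (p := ofReal p) hf.1 hg.1 (ENNReal.one_le_ofReal.2 hp)
  have e1 := LpN_eq h0 (hf.add hg); have e2 := LpN_eq h0 hf; have e3 := LpN_eq h0 hg
  unfold LpN μT at e1 e2 e3
  rw [e1, e2, e3, ← ofReal_add (np_nonneg _ _) (np_nonneg _ _),
    ofReal_le_ofReal_iff (add_nonneg (np_nonneg _ _) (np_nonneg _ _))] at h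
  exact h

lemma np_mono {m : ℕ} {p : ℝ} (hp : 0 < p) {f g : Spc m → ℝ}
    (hg : MemLp g (ofReal p) (volume.restrict (cube m))) (h : ∀ x, |f x| ≤ |g x|) :
    np p f ≤ np p g := by
  unfold np
  refine Real.rpow_le_rpow (integral_nonneg fun _ => by positivity) ?_ (by positivity)
  refine integral_mono_of_nonneg (Eventually.of_forall fun _ => by positivity) ?_
    (Eventually.of_forall fun x => Real.rpow_le_rpow (abs_nonneg _) (h x) hp.le)
  have := hg.integrable_norm_rpow (by simpa using hp) ofReal_ne_top
  rwa [ENNReal.toReal_ofReal hp.le] at this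

lemma np_smul {m : ℕ} {p : ℝ} (hp : 0 < p) {f : Spc m → ℝ} (c : ℝ) :
    np p (fun x => c * f x) = |c| * np p f := by
  unfold np
  simp_rw [abs_mul, Real.mul_rpow (abs_nonneg _) (abs_nonneg _)]
  rw [integral_const_mul, Real.mul_rpow (by positivity) (integral_nonneg fun _ => by positivity),
    ← Real.rpow_mul (abs_nonneg _), mul_one_div_cancel hp.ne', Real.rpow_one]

lemma cube1_int {m : ℕ} {f : Spc m → ℝ} (hf : Per f) (hc : Continuous f) (x1 : ℝ) :
    IntegrableOn (fun y => f (x1, y)) (cube1 m) := by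
  obtain ⟨K, _, hK⟩ := per_bdd hf hc
  exact Integrable.of_bound (C := K) (by fun_prop : Continuous _).aestronglyMeasurable
    (Eventually.of_forall fun y => hK _)

lemma phi_bd {m : ℕ} {V u : Spc m → ℝ} {C : ℝ} (hC : ∀ x, |pd (e1 m) V x| ≤ C) (hu : Per u)
    (hc : Continuous u) (hpos : ∀ x, 0 ≤ u x) {x1 : ℝ} (hm : 0 < marg u x1) :
    |phiF V u x1| ≤ C := by
  unfold phiF
  rw [abs_div, abs_of_pos hm, div_le_iff₀ hm]
  unfold marg
  rw [← integral_const_mul]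
  refine abs_int_le ((cube1_int hu hc x1).const_mul C) fun y => ?_
  rw [abs_mul, abs_of_nonneg (hpos _)]
  exact mul_le_mul_of_nonneg_right (hC _) (hpos _)

lemma Ph_L11 {m : ℕ} (a : ℝ) {η : Spc m → ℝ} (h : Tst η) : ∫ x in cube m, |Ph a η x| ≤ np 1 η := by
  rw [np1, ← Ph_mass a (h.2.comp fun t => |t|) h.cont.abs]
  refine integral_mono_of_nonneg (Eventually.of_forall fun _ => abs_nonneg _) ?_
    (Eventually.of_forall fun x => ?_)
  · by_contra hcon
    have h1 := Ph_mass a (h.2.comp fun t => |t|) h.cont.abs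
    have h2 := integral_undef hcon
    rw [h2] at h1
    have h3 : ∀ x, |η x| = 0 := per_zero (h.2.comp fun t => |t|) h.cont.abs (fun _ => abs_nonneg _) h1.ge
    apply hcon
    have : Ph a (fun t => |η t|) = fun _ => 0 := funext fun x => by simp [Ph, h3]
    rw [this]; exact integrable_zero _ _ _
  · exact abs_integral_le_integral_abs

namespace Ctx
variable {m : ℕ} {V : Spc m → ℝ} {β σ p : ℝ} {ψ0 : Spc m → ℝ} {Tmax : ℝ≥0∞} {ψ : ℝ → Spc m → ℝ}

lemma le_mem {s t : ℝ} (ht : t ∈ Ico0 Tmax) (hs : s ∈ Icc 0 t) : s ∈ Ico0 Tmax :=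
  ⟨hs.1, (ofReal_le_ofReal hs.2).trans_lt ht.2⟩

lemma Wd_bd (H : Ctx m V β σ p ψ0 Tmax ψ) : ∃ B > 0, ∀ s ∈ Ioo0 Tmax, ∀ k x,
    |Wd V (ψ s) k x| ≤ B * |ψ s x| := by
  have h1 : ∀ k : Option (Fin m), ∃ C : ℝ, 0 ≤ C ∧ ∀ x, |pd (dir k) V x| ≤ C := fun k =>
    per_bdd (H.hVp.pd (dir k)) (pd_C1 H.hV _).continuous
  choose C hC0 hC using h1
  have hS : ∀ k, C k ≤ ∑ k, C k := fun k =>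
    Finset.single_le_sum (fun k _ => hC0 k) (Finset.mem_univ k)
  refine ⟨∑ k, C k + C none + 1, by
    have := Finset.sum_nonneg fun k (_ : k ∈ Finset.univ) => hC0 k
    linarith [hC0 none], fun s hs k x => ?_⟩
  have h := sub_mem hs
  have h2 : |phiF V (ψ s) x.1| ≤ C none := phi_bd (hC none) (H.per h) (H.cont h) (fun x => H.pos h x)
    ((H.snap hs).pos _)
  unfold Wd
  refine (abs_sub _ _).trans ?_
  rw [abs_mul, add_mul, add_mul, one_mul]
  have h3 := mul_le_mul_of_nonneg_right ((hC k x).trans (hS k)) (abs_nonneg (ψ s x))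
  have h4 : |if k = none then phiF V (ψ s) x.1 * ψ s x else 0| ≤ C none * |ψ s x| := by
    split_ifs
    · rw [abs_mul]; exact mul_le_mul_of_nonneg_right h2 (abs_nonneg _)
    · rw [abs_zero]; exact mul_nonneg (hC0 none) (abs_nonneg _)
  linarith [abs_nonneg (ψ s x)]

lemma np_cont (H : Ctx m V β σ p ψ0 Tmax ψ) {t : ℝ} (ht : t ∈ Ico0 Tmax) :
    ContinuousOn (fun s => np p (ψ s)) (Icc 0 t) := by
  intro s hs
  rw [ContinuousWithinAt, Metric.tendsto_nhdsWithin_nhds]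
  intro ε hε
  obtain ⟨δ, hδ, h⟩ := H.conv (le_mem ht hs) hε
  refine ⟨δ, hδ, fun s' hs' hd => lt_of_le_of_lt ?_ (h s' (le_mem ht hs') hd)⟩
  have p1 := H.per (le_mem ht hs); have p2 := H.per (le_mem ht hs')
  have c1 := H.cont (le_mem ht hs); have c2 := H.cont (le_mem ht hs')
  have hd : MemLp (fun x => ψ s' x - ψ s x) (ofReal p) (volume.restrict (cube m)) :=
    per_memLp (p2.op p1 (· - ·)) (c2.sub c1) _
  have hd' : MemLp (fun x => ψ s x - ψ s' x) (ofReal p) (volume.restrict (cube m)) :=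
    per_memLp (p1.op p2 (· - ·)) (c1.sub c2) _
  have a1 := np_tri H.p1.le hd (per_memLp p1 c1 _)
  have a2 := np_tri H.p1.le hd' (per_memLp p2 c2 _)
  have a3 : np p (fun x => ψ s x - ψ s' x) = np p (fun x => ψ s' x - ψ s x) := by
    unfold np; simp_rw [abs_sub_comm]
  simp only [sub_add_cancel] at a1 a2
  rw [Real.dist_eq, abs_sub_le_iff]
  constructor <;> linarith

lemma sup_bd (H : Ctx m V β σ p ψ0 Tmax ψ) : ∃ M > 0, ∀ t ∈ Ico0 Tmax, ∀ x, ψ t x ≤ M := by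
  have hpq := Real.HolderConjugate.conjExponent H.p1
  obtain ⟨C1, hC1, h1⟩ := drift_inf m hpq
  obtain ⟨C2, hC2, h2⟩ := Ph_L1 m
  obtain ⟨B, hB, hW⟩ := H.Wd_bd
  have hp0 := H.p0
  have hper0 : Per ψ0 := (per_iff _).1 H.h1.1.1.1
  have hc0 : Continuous ψ0 := (H.h1.1.1.2.2.1 H.sig1.le).continuous
  obtain ⟨M0, hM0, hM⟩ := per_bdd hper0 hc0
  set θ : ℝ := 1 - ((m:ℝ) + 1) / p with hθ
  have hθ0 : 0 < θ := by
    have : ((m:ℝ) + 1) / p < 1 := (div_lt_one hp0).2 H.h2.2.1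
    linarith
  set K : ℝ := β * ((m + 1) * (C1 * B)) with hK
  have hK0 : 0 < K := by have := H.hβ; positivity
  obtain ⟨A, hA0, hA1, hAK⟩ : ∃ A : ℝ, 0 < A ∧ A ≤ 1 ∧ K * A ^ θ / θ ≤ 1 / 2 := by
    have h0 : Tendsto (fun A : ℝ => K * A ^ θ / θ) (𝓝[>] 0) (𝓝 (K * 0 ^ θ / θ)) :=
      ((((Real.continuousAt_rpow_const 0 θ (Or.inr hθ0.le)).tendsto).const_mul K).div_const θ).mono_left
        nhdsWithin_le_nhds
    rw [Real.zero_rpow hθ0.ne', mul_zero, zero_div] at h0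
    have h1 := h0.eventually (gt_mem_nhds (by norm_num : (0:ℝ) < 1 / 2))
    have h2 : ∀ᶠ A in 𝓝[>] (0:ℝ), A ≤ 1 :=
      nhdsWithin_le_nhds (Iic_mem_nhds one_pos)
    obtain ⟨A, ⟨a1, a2⟩, a3⟩ := ((h1.and h2).and self_mem_nhdsWithin).exists
    exact ⟨A, a3, a2, a1.le⟩
  set St : ℝ := max M0 (C2 * A ^ (-((m:ℝ) + 1))) with hSt
  have hSt0 : 0 < St := lt_of_lt_of_le (by positivity) (le_max_right _ _)
  have main : ∀ t ∈ Ico0 Tmax, ∀ S, 0 ≤ S → (∀ s ∈ Ioo0 Tmax, s ≤ t → np p (ψ s) ≤ S) →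
      ∀ x, ψ t x ≤ St + S / 2 := by
    intro t ht S hS0 hS
    refine dual_inf (H.per ht) (H.cont ht) fun η hη => ?_
    have flow : ∀ a0, 0 ≤ a0 → a0 ≤ A → β * a0 ^ 2 / 2 ≤ t →
        |(∫ x in cube m, ψ t x * η x) - ∫ x in cube m, ψ (t - β * a0 ^ 2 / 2) x * Ph a0 η x| ≤
        S / 2 * np 1 η := by
      intro a0 h0 hA hat
      refine (H.flow (C := K * S * np 1 η) (θ := θ) hη ht h0 hat hθ0 ?_).trans ?_
      · intro a ha s hs hst
        have hSn := H.snap hs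
        have : ∀ k, |a * ∫ x in cube m, Wd V (ψ s) k x * Ph a (pd (dir k) η) x| ≤
            C1 * a ^ (-((m:ℝ) + 1) / p) * (B * S) * np 1 η := by
          intro k
          have e : a * ∫ x in cube m, Wd V (ψ s) k x * Ph a (pd (dir k) η) x =
              ∫ x in cube m, Wd V (ψ s) k x * ∫ z, co k z * η (x + a • z) ∂(gam m) := by
            rw [← integral_const_mul]; congr 1; ext x; rw [stein1 a hη]; ring
          rw [e]
          refine (h1 a ha.1 (ha.2.le.trans (hA.trans hA1)) η _ hη.2 hη.cont
            (Wd_per H.hVp hSn.per k) (Wd_C1 H.hV H.hVp hSn.per hSn.c1 hSn.pos k).continuous k).trans ?_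
          refine mul_le_mul_of_nonneg_right ?_ (np_nonneg _ _)
          refine mul_le_mul_of_nonneg_left ?_ (by have := ha.1; positivity)
          have : np p (Wd V (ψ s) k) ≤ np p (fun x => B * ψ s x) :=
            np_mono hp0 (per_memLp (hSn.per.comp fun t => B * t)
              (continuous_const.mul hSn.diff.continuous) _)
              fun x => by rw [abs_mul, abs_of_pos hB]; exact hW s hs k x
          rw [np_smul hp0, abs_of_pos hB] at this
          exact this.trans (mul_le_mul_of_nonneg_left (hS s hs hst) hB.le)
        rw [mul_assoc, abs_mul, abs_of_pos H.hβ, Finset.mul_sum]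
        refine (mul_le_mul_of_nonneg_left ((Finset.abs_sum_le_sum_abs _ _).trans
          (Finset.sum_le_sum fun k _ => this k)) H.hβ.le).trans (le_of_eq ?_)
        simp only [Finset.sum_const, Finset.card_univ, Fintype.card_option, Fintype.card_fin,
          nsmul_eq_mul, Nat.cast_add, Nat.cast_one]
        rw [show θ - 1 = -((m:ℝ) + 1) / p by rw [hθ]; ring]
        rw [hK]; ring
      · have : K * a0 ^ θ / θ ≤ 1 / 2 := le_trans (by gcongr) hAK
        have h3 := mul_le_mul_of_nonneg_right this (mul_nonneg hS0 (np_nonneg 1 η))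
        refine le_trans (le_of_eq ?_) (h3.trans (le_of_eq ?_)) <;> ring
    rw [add_mul]
    by_cases hc : β * A ^ 2 / 2 ≤ t
    · have h3 := (abs_le.1 (flow A hA0.le le_rfl hc)).2
      have hmem : t - β * A ^ 2 / 2 ∈ Ico0 Tmax := le_mem ht
        ⟨by linarith, by have := H.hβ; nlinarith [sq_nonneg A]⟩
      have h4 : ∫ x in cube m, ψ (t - β * A ^ 2 / 2) x * Ph A η x ≤ St * np 1 η := by
        have : ∫ x in cube m, ψ (t - β * A ^ 2 / 2) x * Ph A η x ≤
            ∫ x in cube m, ψ (t - β * A ^ 2 / 2) x * (C2 * A ^ (-((m:ℝ) + 1)) * np 1 η) := by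
          refine setIntegral_mono (per_int ((H.per hmem).op (Ph_per A hη.2) (· * ·))
            ((H.cont hmem).mul (Ph_cont A hη)))
            ((per_int (H.per hmem) (H.cont hmem)).mul_const _) fun x => ?_
          exact mul_le_mul_of_nonneg_left
            ((le_abs_self _).trans (h2 A hA0 hA1 η hη.2 hη.cont x)) (H.pos hmem x)
        rw [integral_mul_const, H.mass hmem, one_mul] at this
        exact this.trans (mul_le_mul_of_nonneg_right (le_max_right _ _) (np_nonneg _ _))
      linarith
    · have ha := a0_sq H.hβ ht.1
      have h3 := (abs_le.1 (flow (√(2 * t / β)) (Real.sqrt_nonneg _) ?_ ha.le)).2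
      · rw [ha, sub_self, H.psi0_eq] at h3
        have h4 : ∫ x in cube m, ψ0 x * Ph (√(2 * t / β)) η x ≤ M0 * np 1 η := by
          refine le_trans ?_ (mul_le_mul_of_nonneg_left (Ph_L11 (√(2 * t / β)) hη) hM0)
          rw [← integral_const_mul]
          refine setIntegral_mono (per_int (hper0.op (Ph_per _ hη.2) (· * ·))
            (hc0.mul (Ph_cont _ hη))) ((per_int (Ph_per _ hη.2) (Ph_cont _ hη)).abs.const_mul _)
            fun x => ?_
          simp only
          refine (le_abs_self _).trans ?_
          rw [abs_mul]
          exact mul_le_mul_of_nonneg_right (hM x) (abs_nonneg _)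
        have h5 := mul_le_mul_of_nonneg_right (le_max_left M0 (C2 * A ^ (-((m:ℝ) + 1))))
          (np_nonneg 1 η)
        linarith
      · refine Real.sqrt_le_iff.2 ⟨hA0.le, ?_⟩
        rw [div_le_iff₀ H.hβ]; push Not at hc; linarith
  have hnp : ∀ t ∈ Ico0 Tmax, np p (ψ t) ≤ 2 * St := by
    intro t ht
    obtain ⟨s0, hs0, hmax⟩ := isCompact_Icc.exists_isMaxOn (nonempty_Icc.2 ht.1) (H.np_cont ht)
    have h5 := main s0 (le_mem ht hs0) (np p (ψ s0)) (np_nonneg _ _) fun s hs hss =>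
      hmax ⟨hs.1.le, hss.trans hs0.2⟩
    have h6 : np p (ψ s0) ≤ St + np p (ψ s0) / 2 :=
      np_le_bd hp0 (by have := np_nonneg p (ψ s0); linarith) fun x => by
        rw [abs_of_nonneg (H.pos (le_mem ht hs0) x)]; exact h5 x
    have h7 : np p (ψ t) ≤ np p (ψ s0) := hmax (right_mem_Icc.2 ht.1)
    linarith
  refine ⟨2 * St, by positivity, fun t ht x => ?_⟩
  have := main t ht (2 * St) (by positivity) (fun s hs _ => hnp s (sub_mem hs)) x
  linarith

end Ctx

def dl {m : ℕ} (h : Spc m) (f : Spc m → ℝ) (x : Spc m) : ℝ := f (x + h) - f x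
def sh {m : ℕ} (h : Spc m) (f : Spc m → ℝ) (x : Spc m) : ℝ := f (x + -h) - f x

section
variable {m : ℕ}

lemma Per.dl {f : Spc m → ℝ} (hf : Per f) (h : Spc m) : Per (dl h f) := (hf.shift h).op hf (· - ·)

lemma cont_dl {f : Spc m → ℝ} (hf : Continuous f) (h : Spc m) : Continuous (dl h f) :=
  (hf.comp (by fun_prop)).sub hf

lemma Tst.sh {η : Spc m → ℝ} (h : Tst η) (v : Spc m) : Tst (sh v η) := (h.shift (-v)).sub h

lemma pd_shift (f : Spc m → ℝ) (v w x : Spc m) : pd v (fun x => f (x + w)) x = pd v f (x + w) := by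
  unfold pd
  rw [fderiv_comp_add_right]

lemma pd_sh {η : Spc m → ℝ} (h : Differentiable ℝ η) (v w : Spc m) : pd v (sh w η) = sh w (pd v η) := by
  ext x
  have h1 : pd v (sh w η) x = pd v (fun x => η (x + -w)) x - pd v η x := by
    unfold pd sh
    rw [fderiv_fun_sub (by fun_prop) (h x)]; rfl
  rw [h1, pd_shift]; rfl

lemma Ph_shift (a : ℝ) (η : Spc m → ℝ) (v x : Spc m) :
    Ph a (fun x => η (x + v)) x = Ph a η (x + v) := by
  unfold Ph; congr 1; ext z; rw [add_right_comm]

lemma Ph_sh (a : ℝ) {η : Spc m → ℝ} (h : Tst η) (v : Spc m) : Ph a (sh v η) = sh v (Ph a η) := by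
  ext x
  have hi : ∀ η : Spc m → ℝ, Tst η → Integrable (fun z => η (x + a • z)) (gam m) := fun η h => by
    obtain ⟨C, _, hC⟩ := h.bdd
    have hc := h.cont
    exact Integrable.of_bound (C := C) (by fun_prop : Continuous _).aestronglyMeasurable
      (Eventually.of_forall fun z => hC _)
  have e := integral_sub (hi _ (h.shift (-v))) (hi _ h)
  have e2 : sh v (Ph a η) x = Ph a (fun x => η (x + -v)) x - Ph a η x := by
    rw [Ph_shift]; rfl
  rw [e2]; unfold Ph sh; exact e

lemma memLp_shift {r : ℝ≥0∞} (h1 : r ≠ ⊤) {f : Spc m → ℝ} (hf : Per f) (hm : Measurable f)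
    (h : MemLp f r (volume.restrict (cube m))) (z : Spc m) :
    MemLp (fun x => f (x + z)) r (volume.restrict (cube m)) := by
  have hm' : Measurable fun x => f (x + z) := hm.comp (measurable_id.add_const z)
  refine ⟨hm'.aestronglyMeasurable, ?_⟩
  have : eLpNorm (fun x => f (x + z)) r (volume.restrict (cube m)) =
      eLpNorm f r (volume.restrict (cube m)) := by
    by_cases h0 : r = 0
    · simp [h0]
    rw [eLpNorm_eq_lintegral_rpow_enorm_toReal h0 h1, eLpNorm_eq_lintegral_rpow_enorm_toReal h0 h1,
      lint_per (hf.comp fun t => ‖t‖ₑ ^ r.toReal) z]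
  rw [this]; exact h.2

lemma pair_sh {w g : Spc m → ℝ} (hw : Per w) (hwm : Measurable w) (hwi : IntegrableOn w (cube m))
    (hg : Per g) (hc : Continuous g) (h : Spc m) :
    ∫ x in cube m, w x * sh h g x = ∫ x in cube m, dl h w x * g x := by
  obtain ⟨K, _, hK⟩ := per_bdd hg hc
  have b : ∀ (v w' : Spc m → ℝ), IntegrableOn v (cube m) → Continuous w' → (∀ x, ‖w' x‖ ≤ K) →
      IntegrableOn (fun x => v x * w' x) (cube m) := fun v w' hv hc hK =>
    Integrable.mul_bdd (c := K) hv hc.aestronglyMeasurable (Eventually.of_forall hK)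
  have hws : IntegrableOn (fun x => w (x + h)) (cube m) := by
    have := memLp_shift ENNReal.one_ne_top hw hwm (memLp_one_iff_integrable.2 hwi) h
    exact memLp_one_iff_integrable.1 this
  unfold sh dl
  simp_rw [mul_sub, sub_mul]
  rw [integral_sub (b _ _ hwi (by fun_prop) fun x => hK _) (b _ _ hwi hc hK),
    integral_sub (b _ _ hws hc hK) (b _ _ hwi hc hK)]
  congr 1
  have := int_per (hw.op (hg.shift (-h)) (· * ·)) h
  rw [← this]
  congr 1; ext x; simp

lemma mvt_sh {w g : Spc m → ℝ} (hw : Per w) (hwc : Continuous w) (hg : Per g) (hgc : ContDiff ℝ 1 g)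
    {h : Spc m} {D : ℝ} (hD : ∀ τ : ℝ, ∀ i, |∫ x in cube m, w x * pd (dir i) g (x + -(τ • h))| ≤ D) :
    |∫ x in cube m, w x * sh h g x| ≤ (m + 1) * D * ‖h‖ := by
  have := finQ m
  obtain ⟨K, hK0, hK⟩ := per_bdd hw hwc
  choose C hC0 hC using fun k : Option (Fin m) => per_bdd (hg.pd (dir k)) (C1_pd_cont hgc (dir k))
  have hpc := fun k => C1_pd_cont hgc (dir k)
  set G : ℝ → ℝ := fun τ => ∫ x in cube m, w x * g (x + -(τ • h)) with hG
  have hder : ∀ τ, HasDerivAt G (∫ x in cube m, w x * -∑ k, co k h * pd (dir k) g (x + -(τ • h))) τ := by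
    intro τ
    refine (hasDerivAt_integral_of_dominated_loc_of_deriv_le (s := univ)
      (μ := volume.restrict (cube m)) (F := fun τ x => w x * g (x + -(τ • h)))
      (F' := fun τ x => w x * -∑ k, co k h * pd (dir k) g (x + -(τ • h)))
      (bound := fun _ => K * ∑ k, |co k h| * C k) univ_mem ?_ ?_ ?_ ?_ (integrable_const _) ?_).2
    · exact Eventually.of_forall fun b => Continuous.aestronglyMeasurable (by
        have := hgc.continuous; fun_prop)
    · exact per_int (hw.op (hg.shift _) (· * ·)) (by have := hgc.continuous; fun_prop)
    · exact Continuous.aestronglyMeasurable (by fun_prop)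
    · refine Eventually.of_forall fun x b hb => ?_
      rw [norm_mul, norm_neg]
      gcongr
      · exact hK x
      · refine (norm_sum_le _ _).trans (Finset.sum_le_sum fun k _ => ?_)
        rw [norm_mul, Real.norm_eq_abs]
        exact mul_le_mul_of_nonneg_left (hC k _) (abs_nonneg _)
    · refine Eventually.of_forall fun x b _ => HasDerivAt.const_mul _ ?_
      have h1 : HasDerivAt (fun s : ℝ => x + -(s • h)) (-h) b := by
        have := (((hasDerivAt_id b).smul_const h).neg).const_add x
        simpa using this
      have h2 := ((hgc.differentiable (by simp)) (x + -(b • h))).hasFDerivAt.comp_hasDerivAt b h1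
      refine h2.congr_deriv ?_
      rw [map_neg, clm_eq_sum]; rfl
  have hbd : ∀ τ ∈ (univ : Set ℝ), ‖∫ x in cube m, w x * -∑ k, co k h * pd (dir k) g (x + -(τ • h))‖ ≤
      (m + 1) * D * ‖h‖ := by
    intro τ _
    have e : ∫ x in cube m, w x * -∑ k, co k h * pd (dir k) g (x + -(τ • h)) =
        -∑ k, co k h * ∫ x in cube m, w x * pd (dir k) g (x + -(τ • h)) := by
      simp_rw [← integral_const_mul]
      rw [← integral_finsetSum, ← integral_neg]
      · congr 1; ext x; rw [mul_neg, Finset.mul_sum]; congr 1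
        exact Finset.sum_congr rfl fun k _ => by ring
      · intro k _
        exact (per_int (hw.op ((hg.pd (dir k)).shift _) (· * ·)) (by fun_prop)).const_mul _
    rw [e, norm_neg]
    refine (norm_sum_le _ _).trans ((Finset.sum_le_sum (g := fun _ => ‖h‖ * D) fun k _ => ?_).trans
      (le_of_eq ?_))
    · rw [norm_mul]
      exact mul_le_mul (abs_co_le k h) (hD τ k) (norm_nonneg _) (norm_nonneg _)
    · simp; ring
  have hf := convex_univ.norm_image_sub_le_of_norm_hasDerivWithin_le (f := G)
    (fun τ _ => (hder τ).hasDerivWithinAt) hbd (mem_univ 0) (mem_univ 1)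
  have e : ∫ x in cube m, w x * sh h g x = G 1 - G 0 := by
    simp only [hG]
    have hc := hgc.continuous
    rw [← integral_sub (per_int (hw.op (hg.shift _) (· * ·)) (by fun_prop))
      (per_int (hw.op (hg.shift _) (· * ·)) (by fun_prop))]
    congr 1; ext x; simp [sh]; ring
  rw [e]; simpa using hf

lemma kern (m : ℕ) {p q : ℝ} (hpq : p.HolderConjugate q) : ∃ C : ℝ, 1 ≤ C ∧
    ∀ (w η : Spc m → ℝ), MemLp w (ofReal p) (volume.restrict (cube m)) → Tst η → ∀ a : ℝ,
      0 < a → |∫ x in cube m, w x * Ph a η x| ≤ C * np p w * np q η ∧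
      (∀ k, a * |∫ x in cube m, w x * Ph a (pd (dir k) η) x| ≤ C * np p w * np q η) ∧
      ∀ i j, a ^ 2 * |∫ x in cube m, w x * Ph a (pd (dir j) (pd (dir i) η)) x| ≤
        C * np p w * np q η := by
  have i1 : ∀ k, Integrable (fun z : Spc m => co k z) (gam m) := fun k =>
    gam_poly (C := 1) (k := 1) (by fun_prop : Continuous _).aestronglyMeasurable fun z => by
      have := abs_co_le k z; simp only [pow_one]; linarith
  have i2 : ∀ i j, Integrable (fun z : Spc m => co i z * co j z - if i = j then 1 else 0) (gam m) :=
    fun i j => gam_poly (C := 1) (k := 2) (by fun_prop : Continuous _).aestronglyMeasurable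
      fun z => by
        refine (abs_sub _ _).trans ?_
        have h1 : |co i z * co j z| ≤ ‖z‖ ^ 2 := by
          rw [abs_mul, sq]
          exact mul_le_mul (abs_co_le i z) (abs_co_le j z) (abs_nonneg _) (norm_nonneg _)
        have h2 : |if i = j then (1:ℝ) else 0| ≤ 1 := by split_ifs <;> simp
        linarith
  set c1 := fun k => ∫ z : Spc m, |co k z| ∂(gam m)
  set c2 := fun (i j : Option (Fin m)) =>
    ∫ z : Spc m, |co i z * co j z - if i = j then 1 else 0| ∂(gam m)
  have h1 : ∀ k, 0 ≤ c1 k := fun k => integral_nonneg fun _ => abs_nonneg _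
  have h2 : ∀ i j, 0 ≤ c2 i j := fun i j => integral_nonneg fun _ => abs_nonneg _
  have s1 : ∀ k, c1 k ≤ ∑ k, c1 k := fun k =>
    Finset.single_le_sum (fun k _ => h1 k) (Finset.mem_univ k)
  have s2 : ∀ i j, c2 i j ≤ ∑ i, ∑ j, c2 i j := fun i j =>
    (Finset.single_le_sum (fun j _ => h2 i j) (Finset.mem_univ j)).trans
      (Finset.single_le_sum (f := fun i => ∑ j, c2 i j)
        (fun i _ => Finset.sum_nonneg fun j _ => h2 i j) (Finset.mem_univ i))
  have n1 := Finset.sum_nonneg fun k (_ : k ∈ Finset.univ) => h1 k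
  have n2 : 0 ≤ ∑ i, ∑ j, c2 i j := Finset.sum_nonneg fun i _ => Finset.sum_nonneg fun j _ => h2 i j
  refine ⟨1 + ∑ k, c1 k + ∑ i, ∑ j, c2 i j, by linarith, fun w η hw hη a ha => ⟨?_, fun k => ?_,
    fun i j => ?_⟩⟩
  · have := Bbd hpq a hη.2 hη.cont hw (κ := fun _ => 1) (integrable_const _)
    simp only [one_mul, abs_one, integral_const, probReal_univ, one_smul] at this
    rw [mul_assoc]
    exact this.trans (le_mul_of_one_le_left (mul_nonneg (np_nonneg _ _) (np_nonneg _ _)) (by linarith))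
  · have := Bbd hpq a hη.2 hη.cont hw (i1 k)
    simp_rw [stein1 a hη] at this
    rw [mul_assoc]
    refine le_trans (le_of_eq ?_) (this.trans (mul_le_mul_of_nonneg_right
      ((s1 k).trans (by linarith)) (mul_nonneg (np_nonneg _ _) (np_nonneg _ _))))
    rw [← abs_of_pos ha, ← abs_mul, ← integral_const_mul, abs_of_pos ha]
    congr 2; ext x; ring
  · have := Bbd hpq a hη.2 hη.cont hw (i2 i j)
    simp_rw [stein2 a hη] at this
    rw [mul_assoc]
    refine le_trans (le_of_eq ?_) (this.trans (mul_le_mul_of_nonneg_right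
      ((s2 i j).trans (by linarith)) (mul_nonneg (np_nonneg _ _) (np_nonneg _ _))))
    rw [← abs_of_pos (pow_pos ha 2), ← abs_mul, ← integral_const_mul, abs_of_pos (pow_pos ha 2)]
    congr 2; ext x; ring

lemma np_dl_le {p : ℝ} (hp : 1 ≤ p) {f : Spc m → ℝ} (hf : Per f) (hm : Measurable f)
    (h : MemLp f (ofReal p) (volume.restrict (cube m))) (z : Spc m) :
    np p (dl z f) ≤ 2 * np p f := by
  have h1 := np_tri hp (memLp_shift ofReal_ne_top hf hm h z) h.neg
  have h2 : np p (-f) = np p f := by simp [np]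
  rw [np_shift p hf, h2] at h1
  simp only [Pi.neg_apply, ← sub_eq_add_neg] at h1
  unfold dl; linarith

end

section
variable {m : ℕ}

lemma min_interp {X Y c r s : ℝ} (hX : 0 ≤ X) (hc : 1 ≤ c) (hr : 0 ≤ r) (hs0 : 0 ≤ s) (hs : s ≤ 1)
    (h1 : Y ≤ 2 * X) (h2 : Y ≤ c * X * r) : Y ≤ 2 * c * X * r ^ s := by
  have hcX : X ≤ c * X := le_mul_of_one_le_left hX hc
  rcases le_total r 1 with h | h
  · rcases hr.eq_or_lt with h0 | h0
    · subst h0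
      have : 0 ≤ (0:ℝ) ^ s := Real.rpow_nonneg le_rfl _
      have : 0 ≤ c * X * (0:ℝ) ^ s := by positivity
      nlinarith
    · have := Real.rpow_le_rpow_of_exponent_ge h0 h hs
      rw [Real.rpow_one] at this
      have h3 : 0 ≤ c * X * r := by positivity
      have h4 : c * X * r ≤ c * X * r ^ s := by gcongr
      nlinarith
  · have := Real.one_le_rpow h hs0
    have h4 : c * X * 1 ≤ c * X * r ^ s := by gcongr
    nlinarith

lemma shift_drift (m : ℕ) {p q : ℝ} (hpq : p.HolderConjugate q) : ∃ C : ℝ, 1 ≤ C ∧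
    ∀ (w η : Spc m → ℝ), Per w → Continuous w → Tst η → ∀ h : Spc m,
      (|∫ x in cube m, w x * Ph 1 (sh h η) x| ≤ C * np p w * np q η * ‖h‖) ∧
      ∀ a : ℝ, 0 < a → ∀ s : ℝ, 0 ≤ s → s ≤ 1 → ∀ k,
      a * |∫ x in cube m, w x * Ph a (pd (dir k) (sh h η)) x| ≤
        C * np p w * np q η * (‖h‖ / a) ^ s := by
  obtain ⟨C, hC, hk⟩ := kern m hpq
  have hp1 : 1 ≤ p := hpq.lt.le
  have hm0 : (0:ℝ) ≤ m := Nat.cast_nonneg m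
  refine ⟨2 * (m + 1) * C, by nlinarith, fun w η hw hc hη h => ?_⟩
  have hwL := per_memLp hw hc (ofReal p)
  have hX : 0 ≤ C * np p w * np q η := by
    have := np_nonneg p w; have := np_nonneg q η; positivity
  have hpdS : ∀ τ : ℝ, ∀ ξ : Spc m → ℝ, ∀ x : Spc m, ∀ a,
      Ph a ξ (x + -(τ • h)) = Ph a (fun x => ξ (x + -(τ • h))) x := fun τ ξ x a => by rw [Ph_shift]
  have hpdT : ∀ (v z : Spc m) (ξ : Spc m → ℝ), (fun x => pd v ξ (x + z)) = pd v (fun x => ξ (x + z)) :=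
    fun v z ξ => by ext x; rw [pd_shift]
  constructor
  · rw [Ph_sh 1 hη]
    have := mvt_sh (w := w) (g := Ph 1 η) (h := h) (D := C * np p w * np q η) hw hc (Ph_per 1 hη.2)
      (Ph_C1 1 hη) fun τ i => by
        rw [Ph_pd 1 hη]
        simp_rw [hpdS, hpdT]
        have := (hk w _ hwL (hη.shift (-(τ • h))) 1 one_pos).2.1 i
        rwa [np_shift q hη.2, one_mul] at this
    refine this.trans ?_
    have : 0 ≤ (m + 1) * (C * np p w * np q η) * ‖h‖ := by positivity
    nlinarith
  · intro a ha s hs0 hs1 k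
    have e : ∀ x, Ph a (pd (dir k) (sh h η)) x = sh h (Ph a (pd (dir k) η)) x := fun x => by
      rw [pd_sh hη.diff, Ph_sh a (hη.pd _)]
    simp_rw [e]
    have h1 : a * |∫ x in cube m, w x * sh h (Ph a (pd (dir k) η)) x| ≤ 2 * (C * np p w * np q η) := by
      rw [pair_sh hw hc.measurable (per_int hw hc) (Ph_per a (hη.pd _).2) (Ph_cont a (hη.pd _))]
      refine ((hk _ η (per_memLp (hw.dl h) (cont_dl hc h) _) hη a ha).2.1 k).trans ?_
      have := np_dl_le hp1 hw hc.measurable hwL h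
      have h3 : C * np p (dl h w) * np q η ≤ C * (2 * np p w) * np q η := by
        have := np_nonneg q η; gcongr
      linarith
    have h2 : a * |∫ x in cube m, w x * sh h (Ph a (pd (dir k) η)) x| ≤
        (m + 1) * (C * np p w * np q η) * (‖h‖ / a) := by
      have := mvt_sh (w := w) (g := Ph a (pd (dir k) η)) (h := h) (D := C * np p w * np q η / a ^ 2)
        hw hc (Ph_per a (hη.pd _).2) (Ph_C1 a (hη.pd _)) fun τ i => by
          rw [Ph_pd a (hη.pd _)]
          simp_rw [hpdS, hpdT]
          have := (hk w _ hwL (hη.shift (-(τ • h))) a ha).2.2 k i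
          rw [np_shift q hη.2] at this
          rw [le_div_iff₀ (by positivity), mul_comm]
          exact this
      refine (mul_le_mul_of_nonneg_left this ha.le).trans (le_of_eq ?_)
      field_simp
    have := min_interp hX (c := m + 1) (by linarith) (by positivity : 0 ≤ ‖h‖ / a) hs0 hs1 h1 h2
    refine this.trans (le_of_eq ?_)
    ring

end

namespace Ctx
variable {m : ℕ} {V : Spc m → ℝ} {β σ p : ℝ} {ψ0 : Spc m → ℝ} {Tmax : ℝ≥0∞} {ψ : ℝ → Spc m → ℝ}

lemma per0 (H : Ctx m V β σ p ψ0 Tmax ψ) : Per ψ0 := (per_iff _).1 H.h1.1.1.1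
lemma diff0 (H : Ctx m V β σ p ψ0 Tmax ψ) : Differentiable ℝ ψ0 := H.h1.1.1.2.2.1 H.sig1.le

lemma WN (H : Ctx m V β σ p ψ0 Tmax ψ) (u : Spc m → ℝ) : WNorm σ p u = LpN p u +
    eLpNorm (fun x => ‖grd u x‖) (ofReal p) (μT m) + gagl (σ - 1) p (grd u) := by
  have h1 := H.sig1
  have h2 := H.h2.2.2.2
  unfold WNorm
  rw [if_neg (by linarith), if_neg (by linarith), if_pos h2, if_neg (by linarith)]

lemma pd0_memLp (H : Ctx m V β σ p ψ0 Tmax ψ) (v : Spc m) :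
    MemLp (pd v ψ0) (ofReal p) (volume.restrict (cube m)) := by
  have h := H.h1.1.1.2.2.2.2
  rw [H.WN] at h
  have h2 : eLpNorm (fun x => ‖grd ψ0 x‖) (ofReal p) (μT m) < ⊤ :=
    lt_of_le_of_lt (le_trans le_add_self le_self_add) h
  have hm : Measurable (fderiv ℝ ψ0) := measurable_fderiv ℝ ψ0
  have h3 : MemLp (fun x => ‖grd ψ0 x‖) (ofReal p) (volume.restrict (cube m)) :=
    ⟨hm.norm.aestronglyMeasurable, h2⟩
  refine (h3.mul_const ‖v‖).mono' (measurable_fderiv_apply_const ℝ ψ0 v).aestronglyMeasurable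
    (Eventually.of_forall fun x => ?_)
  exact (fderiv ℝ ψ0 x).le_opNorm v

lemma pd_meas (u : Spc m → ℝ) (v : Spc m) : Measurable (pd v u) := measurable_fderiv_apply_const ℝ u v

lemma start_scale (H : Ctx m V β σ p ψ0 Tmax ψ) {t : ℝ} (ht : t ∈ Ioo0 Tmax) :
    ∃ a0, 0 < a0 ∧ a0 ≤ 1 ∧ β * a0 ^ 2 / 2 ≤ t ∧ (a0 = 1 ∨ t - β * a0 ^ 2 / 2 = 0) := by
  have hβ := H.hβ
  by_cases hc : β * 1 ^ 2 / 2 ≤ t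
  · exact ⟨1, one_pos, le_rfl, hc, Or.inl rfl⟩
  · have h1 := a0_sq hβ ht.1.le
    refine ⟨√(2 * t / β), Real.sqrt_pos.2 (by have := ht.1; positivity), ?_, h1.le, Or.inr (by rw [h1]; ring)⟩
    rw [Real.sqrt_le_left one_pos.le, one_pow, div_le_one hβ]; push Not at hc; linarith

lemma np_psi (H : Ctx m V β σ p ψ0 Tmax ψ) : ∃ S > 0, (∀ t ∈ Ico0 Tmax, np p (ψ t) ≤ S) ∧
    ∀ t ∈ Ioo0 Tmax, ∀ k, np p (Wd V (ψ t) k) ≤ S := by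
  obtain ⟨M, hM, h⟩ := H.sup_bd
  obtain ⟨B, hB, hW⟩ := H.Wd_bd
  have hb : ∀ t ∈ Ico0 Tmax, ∀ x, |ψ t x| ≤ M := fun t ht x => by
    rw [abs_of_nonneg (H.pos ht x)]; exact h t ht x
  refine ⟨M + B * M, by positivity, fun t ht => np_le_bd H.p0 (by positivity) fun x => ?_,
    fun t ht k => np_le_bd H.p0 (by positivity) fun x => ?_⟩
  · exact (hb t ht x).trans (by nlinarith)
  · exact (hW t ht k x).trans ((mul_le_mul_of_nonneg_left (hb t (sub_mem ht) x) hB.le).trans (by nlinarith))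

lemma E2 (H : Ctx m V β σ p ψ0 Tmax ψ) {s : ℝ} (hs0 : 0 < s) (hs1 : s < 1) :
    ∃ C > 0, ∀ t ∈ Ioo0 Tmax, ∀ h, np p (dl h (ψ t)) ≤ C * ‖h‖ ^ s := by
  have hpq := Real.HolderConjugate.conjExponent H.p1
  set q := p.conjExponent
  obtain ⟨C, hC, hk⟩ := kern m hpq
  obtain ⟨C1, hC1, hd⟩ := shift_drift m hpq
  obtain ⟨S, hS, hS1, hS2⟩ := H.np_psi
  have hp0 := H.p0
  have hβ := H.hβ
  set P := ∑ k, np p (pd (dir k) ψ0)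
  have hP0 : 0 ≤ P := Finset.sum_nonneg fun k _ => np_nonneg _ _
  have hPk : ∀ k, np p (pd (dir k) ψ0) ≤ P := fun k =>
    Finset.single_le_sum (f := fun k => np p (pd (dir k) ψ0)) (fun k _ => np_nonneg _ _) (Finset.mem_univ k)
  set K := β * ((m + 1) * (C1 * S)) with hK
  have hK0 : 0 < K := by positivity
  set st := max (C1 * S) ((m + 1) * (C * P))
  have hst0 : 0 < st := lt_of_lt_of_le (by positivity) (le_max_left _ _)
  refine ⟨2 * S + (st + K / (1 - s)), ?_, fun t ht h => ?_⟩
  · have : 0 < 1 - s := by linarith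
    positivity
  have hSn := H.snap ht
  have ht' := sub_mem ht
  have h1s : 0 < 1 - s := by linarith
  have hDp : 0 < K / (1 - s) := by positivity
  have hhs : 0 ≤ ‖h‖ ^ s := Real.rpow_nonneg (norm_nonneg _) _
  rcases le_total 1 ‖h‖ with hh | hh
  · have e1 := np_dl_le H.p1.le hSn.per hSn.diff.continuous.measurable (per_memLp hSn.per hSn.diff.continuous _) h
    have e2 := hS1 t ht'
    have e3 := Real.one_le_rpow hh hs0.le
    nlinarith
  suffices hmain : np p (dl h (ψ t)) ≤ (st + K / (1 - s)) * ‖h‖ ^ s by nlinarith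
  have hhs1 : ‖h‖ ≤ ‖h‖ ^ s := by
    rcases (norm_nonneg h).eq_or_lt with h0 | h0
    · rw [← h0, Real.zero_rpow hs0.ne']
    · have := Real.rpow_le_rpow_of_exponent_ge h0 hh hs1.le
      rwa [Real.rpow_one] at this
  refine dual_p hpq (by positivity) (hSn.per.dl h) (cont_dl hSn.diff.continuous h) fun η hη => ?_
  have hN := np_nonneg q η
  rw [← pair_sh hSn.per hSn.diff.continuous.measurable (per_int hSn.per hSn.diff.continuous) hη.2 hη.cont]
  obtain ⟨a0, ha0, ha1, hat, hcase⟩ := H.start_scale ht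
  have hfl := H.flow (C := K * ‖h‖ ^ s * np q η) (θ := 1 - s) (hη.sh h) ht' ha0.le hat h1s ?_
  swap
  · intro a ha r hr hrt
    have hSr := H.snap hr
    have : ∀ k, |a * ∫ x in cube m, Wd V (ψ r) k x * Ph a (pd (dir k) (sh h η)) x| ≤
        C1 * S * np q η * (‖h‖ / a) ^ s := by
      intro k
      rw [abs_mul, abs_of_pos ha.1]
      refine ((hd _ η (Wd_per H.hVp hSr.per k) (Wd_C1 H.hV H.hVp hSr.per hSr.c1 hSr.pos k).continuous
        hη h).2 a ha.1 s hs0.le hs1.le k).trans ?_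
      have := hS2 r hr k
      have h0 : 0 ≤ (‖h‖ / a) ^ s := Real.rpow_nonneg (by have := ha.1; positivity) _
      gcongr
    rw [mul_assoc, abs_mul, abs_of_pos hβ, Finset.mul_sum]
    refine (mul_le_mul_of_nonneg_left ((Finset.abs_sum_le_sum_abs _ _).trans
      (Finset.sum_le_sum fun k _ => this k)) hβ.le).trans (le_of_eq ?_)
    simp only [Finset.sum_const, Finset.card_univ, Fintype.card_option, Fintype.card_fin,
      nsmul_eq_mul, Nat.cast_add, Nat.cast_one]
    rw [Real.div_rpow (norm_nonneg _) ha.1.le, show 1 - s - 1 = -s by ring, Real.rpow_neg ha.1.le, hK]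
    ring
  have hstart : |∫ x in cube m, ψ (t - β * a0 ^ 2 / 2) x * Ph a0 (sh h η) x| ≤ st * ‖h‖ ^ s * np q η := by
    have key : |∫ x in cube m, ψ (t - β * a0 ^ 2 / 2) x * Ph a0 (sh h η) x| ≤ st * np q η * ‖h‖ := by
      rcases hcase with hc | hc
      · subst hc
        have hm : t - β * 1 ^ 2 / 2 ∈ Ico0 Tmax := le_mem ht' ⟨by linarith, by nlinarith⟩
        refine ((hd _ η (H.per hm) (H.cont hm) hη h).1).trans ?_
        have := hS1 _ hm
        have : C1 * np p (ψ (t - β * 1 ^ 2 / 2)) ≤ st := le_trans (by gcongr) (le_max_left _ _)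
        gcongr
      · rw [hc, H.psi0_eq, Ph_sh a0 hη]
        have hcc := H.diff0.continuous
        have := mvt_sh (w := ψ0) (g := Ph a0 η) (h := h) (D := C * P * np q η) H.per0 hcc
          (Ph_per a0 hη.2) (Ph_C1 a0 hη) fun τ i => by
            have e := ibp H.per0 H.diff0 ((Ph_per a0 hη.2).shift (-(τ • h)))
              (by have := (Ph_C1 a0 hη).differentiable (by simp); fun_prop) (dir i) (memLp_int H.p1.le (H.pd0_memLp _)) ?_
            · simp_rw [pd_shift] at e
              rw [eq_neg_iff_add_eq_zero, add_comm, ← eq_neg_iff_add_eq_zero] at e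
              rw [e, abs_neg]
              simp_rw [← Ph_shift]
              refine ((hk _ _ (H.pd0_memLp (dir i)) (hη.shift (-(τ • h))) a0 ha0).1).trans ?_
              rw [np_shift q hη.2]
              have := hPk i
              gcongr
            · refine per_int (((Ph_per a0 hη.2).shift _).pd _) (C1_pd_cont ?_ _)
              exact (Ph_C1 a0 hη).comp (by fun_prop)
        refine this.trans ?_
        have h5 : (m + 1) * (C * P) ≤ st := le_max_right _ _
        calc _ = (m + 1) * (C * P) * np q η * ‖h‖ := by ring
          _ ≤ _ := by gcongr
    refine key.trans ?_
    calc _ ≤ st * np q η * ‖h‖ ^ s := by gcongr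
      _ = _ := by ring
  have h6 : K * ‖h‖ ^ s * np q η * a0 ^ (1 - s) / (1 - s) ≤ K / (1 - s) * ‖h‖ ^ s * np q η := by
    have := Real.rpow_le_one ha0.le ha1 h1s.le
    calc _ = K / (1 - s) * ‖h‖ ^ s * np q η * a0 ^ (1 - s) := by ring
      _ ≤ _ := mul_le_of_le_one_right (by positivity) this
  have h7 := (abs_le.1 hfl).2
  have h8 := (abs_le.1 hstart).2
  linarith

end Ctx

section
variable {m : ℕ}

lemma np_marg {p : ℝ} (hp : 1 ≤ p) {f : Spc m → ℝ} (hf : Per f) (hc : Continuous f) :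
    np p (fun x : Spc m => marg (fun z => |f z|) x.1) ≤ np p f := by
  have hp0 : 0 < p := by linarith
  have hfa : Per fun z => |f z| := hf.comp fun t => |t|
  have hfp : Per fun z => |f z| ^ p := hf.comp fun t => |t| ^ p
  have hcp : Continuous fun z => |f z| ^ p := hc.abs.rpow_const fun _ => Or.inr hp0.le
  have hcm := marg_cont hfa hc.abs
  unfold np
  refine Real.rpow_le_rpow (integral_nonneg fun _ => Real.rpow_nonneg (abs_nonneg _) _) ?_ (by positivity)
  have hb := fub hfp hcp (G := fun _ => 1) (fun _ _ => rfl) continuous_const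
  simp only [mul_one] at hb
  rw [hb]
  refine integral_mono (per_int ((marg_per hfa).comp fun t => |t| ^ p)
    ((hcm.comp continuous_fst).abs.rpow_const fun _ => Or.inr hp0.le))
    (per_int (marg_per hfp) ((marg_cont hfp hcp).comp continuous_fst)) fun x => ?_
  have h1 : 0 ≤ marg (fun z => |f z|) x.1 := integral_nonneg fun _ => abs_nonneg _
  simp only [abs_of_nonneg h1]
  exact (convexOn_rpow hp).map_integral_le (continuousOn_id.rpow_const fun _ _ => Or.inr hp0.le) isClosed_Ici
    (Eventually.of_forall fun y => mem_Ici.2 (abs_nonneg _)) (cube1_int hfa hc.abs x.1) (cube1_int hfp hcp x.1)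

lemma per_lip {f : Spc m → ℝ} (hf : Per f) (hd : ContDiff ℝ 1 f) :
    ∃ L : ℝ, 0 ≤ L ∧ ∀ h x, |dl h f x| ≤ L * ‖h‖ := by
  obtain ⟨L, h0, hL⟩ := per_bdd hf.fderiv (hd.continuous_fderiv (by simp))
  refine ⟨L, h0, fun h x => ?_⟩
  have := convex_univ.norm_image_sub_le_of_norm_fderiv_le (f := f) (C := L) (𝕜 := ℝ)
    (fun x _ => (hd.differentiable (by simp)) x) (fun x _ => hL x) (mem_univ x) (mem_univ (x + h))
  simpa [dl] using this

lemma dl_mul (f g : Spc m → ℝ) (h x : Spc m) :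
    dl h (fun x => f x * g x) x = f (x + h) * dl h g x + g x * dl h f x := by
  unfold dl; ring

lemma marg_diff {f : Spc m → ℝ} (hf : Per f) (hc : Continuous f) (x1 h1 : ℝ) :
    marg f (x1 + h1) - marg f x1 = marg (dl (h1, 0) f) x1 := by
  unfold marg dl
  rw [← integral_sub (cube1_int hf hc _) (cube1_int hf hc _)]
  simp

lemma phi_dl {V u : Spc m → ℝ} {B L M m0 : ℝ} (hu : Per u) (hc : Continuous u) (hpos : ∀ x, 0 ≤ u x)
    (hM : ∀ x, u x ≤ M) (hm0 : 0 < m0) (hm : ∀ x1, m0 ≤ marg u x1) (hvp : Per (pd (e1 m) V))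
    (hvc : Continuous (pd (e1 m) V)) (hB : ∀ x, |pd (e1 m) V x| ≤ B)
    (hL : ∀ h x, |dl h (pd (e1 m) V) x| ≤ L * ‖h‖) (x1 h1 : ℝ) :
    |phiF V u (x1 + h1) - phiF V u x1| ≤
      (2 * B * marg (fun z => |dl (h1, 0) u z|) x1 + M * (L * |h1|)) / m0 := by
  have hD : ∀ x1, 0 < marg u x1 := fun x1 => hm0.trans_le (hm x1)
  have hB0 : 0 ≤ B := (abs_nonneg _).trans (hB 0)
  set w : Spc m → ℝ := fun z => pd (e1 m) V z * u z with hw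
  have hwp : Per w := hvp.op hu (· * ·)
  have hwc : Continuous w := hvc.mul hc
  have hphi : ∀ x1, phiF V u x1 * marg u x1 = marg w x1 := fun x1 => by
    unfold phiF; rw [div_mul_cancel₀ _ (hD x1).ne']; rfl
  have e : (phiF V u (x1 + h1) - phiF V u x1) * marg u x1 =
      marg (dl (h1, 0) w) x1 - phiF V u (x1 + h1) * marg (dl (h1, 0) u) x1 := by
    rw [← marg_diff hwp hwc, ← marg_diff hu hc, ← hphi, ← hphi]; ring
  have b1 : |marg (dl (h1, 0) u) x1| ≤ marg (fun z => |dl (h1, 0) u z|) x1 := abs_integral_le_integral_abs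
  have iu := cube1_int ((hu.dl (h1, 0)).comp fun t => |t|) (cont_dl hc (h1, 0)).abs x1
  have nh : ‖((h1, 0) : Spc m)‖ = |h1| := by simp [Prod.norm_def]
  have b2 : |marg (dl (h1, 0) w) x1| ≤ B * marg (fun z => |dl (h1, 0) u z|) x1 + M * (L * |h1|) := by
    have : B * marg (fun z => |dl (h1, 0) u z|) x1 + M * (L * |h1|) =
        ∫ y in cube1 m, (B * |dl (h1, 0) u (x1, y)| + M * (L * |h1|)) := by
      rw [integral_add (iu.const_mul B) (integrable_const _), integral_const_mul]
      simp [marg]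
    rw [this]
    refine abs_int_le ((iu.const_mul B).add (integrable_const _)) fun y => ?_
    rw [hw, dl_mul]
    refine (abs_add_le _ _).trans (add_le_add ?_ ?_)
    · rw [abs_mul]; exact mul_le_mul_of_nonneg_right (hB _) (abs_nonneg _)
    · rw [abs_mul, abs_of_nonneg (hpos _), ← nh]
      exact mul_le_mul (hM _) (hL _ _) (abs_nonneg _) ((hpos 0).trans (hM 0))
  have b3 := phi_bd hB hu hc hpos (hD (x1 + h1))
  have b4 : |phiF V u (x1 + h1) * marg (dl (h1, 0) u) x1| ≤ B * marg (fun z => |dl (h1, 0) u z|) x1 := by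
    rw [abs_mul]; exact mul_le_mul b3 b1 (abs_nonneg _) hB0
  rw [le_div_iff₀ hm0]
  calc _ ≤ |phiF V u (x1 + h1) - phiF V u x1| * marg u x1 :=
        mul_le_mul_of_nonneg_left (hm x1) (abs_nonneg _)
    _ = |(phiF V u (x1 + h1) - phiF V u x1) * marg u x1| := by rw [abs_mul, abs_of_pos (hD x1)]
    _ ≤ _ := by rw [e]; refine (abs_sub _ _).trans ?_; linarith

lemma Wd_dl {V u : Spc m → ℝ} {B L M m0 : ℝ} (hu : Per u) (hc : Continuous u) (hpos : ∀ x, 0 ≤ u x)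
    (hM : ∀ x, u x ≤ M) (hm0 : 0 < m0) (hm : ∀ x1, m0 ≤ marg u x1) (hV : ContDiff ℝ 2 V) (hVp : Per V)
    (hB : ∀ k x, |pd (dir k) V x| ≤ B)
    (hL : ∀ k h x, |dl h (pd (dir k) V) x| ≤ L * ‖h‖) (h x : Spc m) (k : Option (Fin m)) :
    |dl h (Wd V u k) x| ≤ 2 * B * |dl h u x| + M * 2 * B / m0 * marg (fun z => |dl (h.1, 0) u z|) x.1 +
      (M * L + M * (M * L) / m0) * ‖h‖ := by
  have hB0 : 0 ≤ B := (abs_nonneg _).trans (hB none 0)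
  have hM0 : 0 ≤ M := (hpos 0).trans (hM 0)
  have hph := phi_dl hu hc hpos hM hm0 hm (hVp.pd (e1 m)) (pd_C1 hV _).continuous (hB none) (hL none) x.1 h.1
  have hg0 : 0 ≤ marg (fun z => |dl (h.1, 0) u z|) x.1 := integral_nonneg fun _ => abs_nonneg _
  have hh1 : |h.1| ≤ ‖h‖ := norm_fst_le h
  have hLh : 0 ≤ L * ‖h‖ := (abs_nonneg _).trans (hL none h x)
  have t1 : |dl h (fun x => pd (dir k) V x * u x) x| ≤ B * |dl h u x| + M * (L * ‖h‖) := by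
    rw [dl_mul]
    refine (abs_add_le _ _).trans (add_le_add ?_ ?_)
    · rw [abs_mul]; exact mul_le_mul_of_nonneg_right (hB _ _) (abs_nonneg _)
    · rw [abs_mul, abs_of_nonneg (hpos _)]
      exact mul_le_mul (hM _) (hL _ _ _) (abs_nonneg _) hM0
  have t2 : |dl h (fun x => if k = none then phiF V u x.1 * u x else 0) x| ≤ B * |dl h u x| +
      M * ((2 * B * marg (fun z => |dl (h.1, 0) u z|) x.1 + M * (L * |h.1|)) / m0) := by
    by_cases hk : k = none
    · simp only [hk, if_true]
      rw [dl_mul (fun x => phiF V u x.1) u]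
      refine (abs_add_le _ _).trans (add_le_add ?_ ?_)
      · rw [abs_mul]
        exact mul_le_mul_of_nonneg_right (phi_bd (hB none) hu hc hpos (hm0.trans_le (hm _))) (abs_nonneg _)
      · rw [abs_mul, abs_of_nonneg (hpos _)]
        exact mul_le_mul (hM _) hph (abs_nonneg _) hM0
    · simp only [hk, if_false, dl, sub_self, abs_zero]
      have : 0 ≤ (2 * B * marg (fun z => |dl (h.1, 0) u z|) x.1 + M * (L * |h.1|)) / m0 :=
        (abs_nonneg _).trans hph
      positivity
  have hL1 : L * |h.1| ≤ L * ‖h‖ := by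
    by_cases hL0 : 0 ≤ L
    · exact mul_le_mul_of_nonneg_left hh1 hL0
    · have : ‖h‖ = 0 := by
        by_contra hne
        have : 0 < ‖h‖ := lt_of_le_of_ne (norm_nonneg _) (Ne.symm hne)
        nlinarith
      rw [this] at hh1 ⊢
      rw [le_antisymm hh1 (abs_nonneg _)]
  have e : dl h (Wd V u k) x = dl h (fun x => pd (dir k) V x * u x) x -
      dl h (fun x => if k = none then phiF V u x.1 * u x else 0) x := by
    unfold dl Wd; ring
  rw [e]
  refine (abs_sub _ _).trans ((add_le_add t1 t2).trans ?_)
  have hL2 : M * ((2 * B * marg (fun z => |dl (h.1, 0) u z|) x.1 + M * (L * |h.1|)) / m0) ≤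
      M * ((2 * B * marg (fun z => |dl (h.1, 0) u z|) x.1 + M * (L * ‖h‖)) / m0) := by gcongr
  refine (add_le_add_right (add_le_add_right hL2 _) _).trans (le_of_eq ?_)
  field_simp
  ring

end

namespace Ctx
variable {m : ℕ} {V : Spc m → ℝ} {β σ p : ℝ} {ψ0 : Spc m → ℝ} {Tmax : ℝ≥0∞} {ψ : ℝ → Spc m → ℝ}

lemma V_bd (H : Ctx m V β σ p ψ0 Tmax ψ) : ∃ B L : ℝ, 0 ≤ B ∧ 0 ≤ L ∧ (∀ k x, |pd (dir k) V x| ≤ B) ∧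
    ∀ k h x, |dl h (pd (dir k) V) x| ≤ L * ‖h‖ := by
  choose C hC0 hC using fun k : Option (Fin m) => per_bdd (H.hVp.pd (dir k)) (pd_C1 H.hV (dir k)).continuous
  choose L hL0 hL using fun k : Option (Fin m) => per_lip (H.hVp.pd (dir k)) (pd_C1 H.hV (dir k))
  refine ⟨∑ k, C k, ∑ k, L k, Finset.sum_nonneg fun k _ => hC0 k, Finset.sum_nonneg fun k _ => hL0 k,
    fun k x => (hC k x).trans (Finset.single_le_sum (fun k _ => hC0 k) (Finset.mem_univ k)),
    fun k h x => (hL k h x).trans ?_⟩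
  exact mul_le_mul_of_nonneg_right (Finset.single_le_sum (fun k _ => hL0 k) (Finset.mem_univ k))
    (norm_nonneg _)

lemma W2 (H : Ctx m V β σ p ψ0 Tmax ψ) {s : ℝ} (hs0 : 0 < s) (hs1 : s < 1) :
    ∃ C > 0, ∀ t ∈ Ioo0 Tmax, ∀ k h, np p (dl h (Wd V (ψ t) k)) ≤ C * ‖h‖ ^ s := by
  obtain ⟨B, L, hB0, hL0, hB, hL⟩ := H.V_bd
  obtain ⟨m0, hm0, hm⟩ := H.marg_low
  obtain ⟨M, hM0, hM⟩ := H.sup_bd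
  obtain ⟨S, hS0, -, hS⟩ := H.np_psi
  obtain ⟨C, hC0, hC⟩ := H.E2 hs0 hs1
  have hp1 := H.p1.le
  have hp0 := H.p0
  set R := M * L + M * (M * L) / m0
  refine ⟨2 * S + (2 * B * C + M * 2 * B / m0 * C + R), by positivity, fun t ht k h => ?_⟩
  have hSn := H.snap ht
  have ht' := sub_mem ht
  have hWp := Wd_per H.hVp hSn.per k
  have hWc := (Wd_C1 H.hV H.hVp hSn.per hSn.c1 hSn.pos k).continuous
  have hhs : 0 ≤ ‖h‖ ^ s := Real.rpow_nonneg (norm_nonneg _) _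
  have hR : 0 ≤ 2 * B * C + M * 2 * B / m0 * C + R := by positivity
  rcases le_total 1 ‖h‖ with hh | hh
  · have e1 := np_dl_le hp1 hWp hWc.measurable (per_memLp hWp hWc _) h
    have e2 := hS t ht k
    have e3 := Real.one_le_rpow hh hs0.le
    nlinarith
  have hhs1 : ‖h‖ ≤ ‖h‖ ^ s := by
    rcases (norm_nonneg h).eq_or_lt with h0 | h0
    · rw [← h0, Real.zero_rpow hs0.ne']
    · have := Real.rpow_le_rpow_of_exponent_ge h0 hh hs1.le
      rwa [Real.rpow_one] at this
  have hc := H.cont ht'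
  have hu := H.per ht'
  set d : Spc m → ℝ := dl (h.1, 0) (ψ t) with hd
  have hdp : Per d := hu.dl _
  have hdc : Continuous d := cont_dl hc _
  have hgp := marg_per (hdp.comp fun t => |t|)
  have hgc : Continuous fun x : Spc m => marg (fun z => |d z|) x.1 :=
    (marg_cont (hdp.comp fun t => |t|) hdc.abs).comp continuous_fst
  have f1 := per_memLp ((hu.dl h).comp fun t => 2 * B * |t|) (continuous_const.mul (cont_dl hc h).abs)
    (ofReal p)
  have f2 := per_memLp (hgp.comp fun t => M * 2 * B / m0 * t) (continuous_const.mul hgc) (ofReal p)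
  have f3 := per_memLp (f := fun _ : Spc m => R * ‖h‖) (fun _ _ => rfl) continuous_const (ofReal p)
  have h1 : np p (dl h (Wd V (ψ t) k)) ≤ np p (fun x => (2 * B * |dl h (ψ t) x| +
      M * 2 * B / m0 * marg (fun z => |d z|) x.1) + R * ‖h‖) := by
    refine np_mono hp0 ((f1.add f2).add f3) fun x => ?_
    refine (Wd_dl hu hc (fun x => H.pos ht' x) (hM t ht') hm0 (hm t ht') H.hV H.hVp hB hL h x k).trans
      (le_abs_self _)
  have h2 := np_tri hp1 (f1.add f2) f3
  have h3 := np_tri hp1 f1 f2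
  have h4 : np p (fun _ : Spc m => R * ‖h‖) ≤ R * ‖h‖ :=
    np_le_bd hp0 (by positivity) fun x => by rw [abs_of_nonneg (by positivity)]
  have h5 : np p (fun x => 2 * B * |dl h (ψ t) x|) ≤ 2 * B * (C * ‖h‖ ^ s) := by
    rw [np_smul hp0, abs_of_nonneg (by positivity)]
    have : np p (fun x => |dl h (ψ t) x|) = np p (dl h (ψ t)) := by simp [np]
    rw [this]
    exact mul_le_mul_of_nonneg_left (hC t ht h) (by positivity)
  have h6 : np p (fun x : Spc m => M * 2 * B / m0 * marg (fun z => |d z|) x.1) ≤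
      M * 2 * B / m0 * (C * ‖h‖ ^ s) := by
    rw [np_smul hp0, abs_of_nonneg (by positivity)]
    refine mul_le_mul_of_nonneg_left ((np_marg hp1 hdp hdc).trans ((hC t ht _).trans ?_)) (by positivity)
    have : ‖((h.1, 0) : Spc m)‖ ≤ ‖h‖ := by
      have := norm_fst_le h
      simp [Prod.norm_def]
    gcongr
  have h7 : R * ‖h‖ ≤ R * ‖h‖ ^ s := mul_le_mul_of_nonneg_left hhs1 (by positivity)
  have h8 : 0 ≤ 2 * S * ‖h‖ ^ s := by positivity
  refine (h1.trans (h2.trans (add_le_add (h3.trans (add_le_add h5 h6)) (h4.trans h7)))).trans ?_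
  linarith

end Ctx

section
variable {m : ℕ}

lemma dl_comm (h k : Spc m) (f : Spc m → ℝ) : dl h (dl k f) = dl k (dl h f) := by
  ext x; unfold dl; rw [add_right_comm]; ring

lemma min_pow {A B s s' : ℝ} (hA : 0 ≤ A) (hB : 0 ≤ B) (h0 : 0 < s') (h1 : s' < s) :
    min (A ^ s) (B ^ s) ≤ A ^ s' * B ^ (s - s') := by
  have key : ∀ r : ℝ, 0 ≤ r → r ^ s = r ^ s' * r ^ (s - s') := fun r hr => by
    rw [← Real.rpow_add_of_nonneg hr h0.le (by linarith)]; congr 1; ring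
  rcases le_total A B with h | h
  · refine (min_le_left _ _).trans ?_
    rw [key A hA]
    exact mul_le_mul_of_nonneg_left (Real.rpow_le_rpow hA h (by linarith)) (Real.rpow_nonneg hA _)
  · refine (min_le_right _ _).trans ?_
    rw [key B hB]
    exact mul_le_mul_of_nonneg_right (Real.rpow_le_rpow hB h h0.le) (Real.rpow_nonneg hB _)

lemma kap2_zero (i j : Option (Fin m)) :
    ∫ z : Spc m, (co i z * co j z - if i = j then 1 else 0) ∂(gam m) = 0 := by
  have h := stein2 (m := m) 1 (η := fun _ => 1) ⟨contDiff_const, fun _ _ => rfl⟩ i j 0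
  have e : pd (dir j) (pd (dir i) (fun _ : Spc m => (1:ℝ))) = fun _ => 0 := by
    have : pd (dir i) (fun _ : Spc m => (1:ℝ)) = fun _ => 0 := by ext x; simp [pd]
    rw [this]; ext x; simp [pd]
  rw [e] at h
  simpa [Ph] using h

lemma drift2 (m : ℕ) {p q : ℝ} (hpq : p.HolderConjugate q) : ∃ C : ℝ, 1 ≤ C ∧
    ∀ (w η : Spc m → ℝ), Per w → Continuous w → Tst η → ∀ (h : Spc m) (Cw s s' : ℝ), 0 < s' → s' < s →
      s < 1 → 0 ≤ Cw → (∀ h, np p (dl h w) ≤ Cw * ‖h‖ ^ s) → ∀ a : ℝ, 0 < a → ∀ i j,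
      a ^ 2 * |∫ x in cube m, w x * Ph a (pd (dir j) (pd (dir i) (sh h η))) x| ≤
        C * Cw * np q η * ‖h‖ ^ s' * a ^ (s - s') := by
  have hκ : ∀ i j : Option (Fin m), ∀ z : Spc m, |co i z * co j z - if i = j then 1 else 0| ≤ 1 + ‖z‖ ^ 2 := by
    intro i j z
    refine (abs_sub _ _).trans ?_
    have h1 : |co i z * co j z| ≤ ‖z‖ ^ 2 := by
      rw [abs_mul, sq]
      exact mul_le_mul (abs_co_le i z) (abs_co_le j z) (abs_nonneg _) (norm_nonneg _)
    have h2 : |if i = j then (1:ℝ) else 0| ≤ 1 := by split_ifs <;> simp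
    linarith
  have hb : ∀ r : ℝ, 0 ≤ r → |(1 + r ^ 2) * (1 + r)| ≤ 4 * (1 + r ^ 3) := fun r hr => by
    rw [abs_of_nonneg (by positivity)]
    nlinarith [sq_nonneg (r - 1), mul_nonneg hr (sq_nonneg (r-1)), pow_nonneg hr 3]
  have hint : Integrable (fun z : Spc m => (1 + ‖z‖ ^ 2) * (1 + ‖z‖)) (gam m) :=
    gam_poly (C := 4) (k := 3) (by fun_prop : Continuous _).aestronglyMeasurable fun z => hb _ (norm_nonneg z)
  set I := ∫ z : Spc m, (1 + ‖z‖ ^ 2) * (1 + ‖z‖) ∂(gam m) with hI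
  have hI0 : 0 ≤ I := integral_nonneg fun z => by positivity
  refine ⟨2 * I + 1, by linarith, fun w η hw hc hη h Cw s s' hs0 hss hs1 hCw hwd a ha i j => ?_⟩
  have hp1 := hpq.lt.le
  set κ : Spc m → ℝ := fun z => co i z * co j z - if i = j then 1 else 0 with hκd
  have iκ : Integrable κ (gam m) := gam_poly (C := 1) (k := 2)
    (by fun_prop : Continuous _).aestronglyMeasurable fun z => by simpa using hκ i j z
  have hw1 := per_int hw hc
  have e1 : a ^ 2 * ∫ x in cube m, w x * Ph a (pd (dir j) (pd (dir i) (sh h η))) x =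
      ∫ z, κ z * (∫ x in cube m, w x * sh h η (x + a • z)) ∂(gam m) := by
    rw [← Bswap a (hη.sh h).2 (hη.sh h).cont hw1 iκ, ← integral_const_mul]
    congr 1; ext x
    rw [hκd, stein2 a (hη.sh h)]; ring
  set J : Spc m → ℝ := fun y => ∫ x in cube m, w x * sh h η (x + y) with hJ
  have hs := hη.sh h
  have iwt : ∀ y, IntegrableOn (fun x => w x * sh h η (x + y)) (cube m) := fun y =>
    per_int (hw.op (hs.2.shift y) (· * ·)) (by have := hs.cont; fun_prop)
  have hN := np_nonneg q η
  have hJb : ∀ y, |J y - J 0| ≤ 2 * Cw * ‖h‖ ^ s' * ‖y‖ ^ (s - s') * np q η := by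
    intro y
    have e2 : J y - J 0 = ∫ x in cube m, dl h (dl (-y) w) x * η x := by
      rw [← pair_sh (hw.dl _) (cont_dl hc _).measurable (per_int (hw.dl _) (cont_dl hc _)) hη.2 hη.cont,
        ← pair_sh hw hc.measurable hw1 hs.2 hs.cont]
      simp only [hJ]
      rw [← integral_sub (iwt y) (iwt 0)]
      congr 1; ext x; simp only [sh, neg_neg, add_zero]; ring
    rw [e2]
    have mL : ∀ v, MemLp (dl v w) (ofReal p) (volume.restrict (cube m)) := fun v =>
      per_memLp (hw.dl v) (cont_dl hc v) _
    refine (holder' hpq (per_memLp ((hw.dl _).dl _) (cont_dl (cont_dl hc _) _) _) (per_memLp hη.2 hη.cont _)).trans ?_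
    refine mul_le_mul_of_nonneg_right ?_ hN
    have b1 : np p (dl h (dl (-y) w)) ≤ 2 * Cw * ‖y‖ ^ s := by
      have := np_dl_le hp1 (hw.dl (-y)) (cont_dl hc _).measurable (mL _) h
      have h3 := hwd (-y)
      rw [norm_neg] at h3; linarith
    have b2 : np p (dl h (dl (-y) w)) ≤ 2 * Cw * ‖h‖ ^ s := by
      rw [dl_comm]
      have := np_dl_le hp1 (hw.dl h) (cont_dl hc _).measurable (mL _) (-y)
      have h3 := hwd h
      linarith
    have b3 := min_pow (norm_nonneg h) (norm_nonneg y) hs0 hss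
    rw [mul_assoc _ (‖h‖ ^ s')]
    refine le_trans ?_ (mul_le_mul_of_nonneg_left b3 (by positivity))
    rcases min_choice (‖h‖ ^ s) (‖y‖ ^ s) with h4 | h4 <;> rw [h4] <;> assumption
  have hJc : Continuous J := by
    obtain ⟨K1, _, hK1⟩ := per_bdd hw hc
    obtain ⟨K2, _, hK2⟩ := per_bdd hs.2 hs.cont
    have := finQ m
    have hsc := hs.cont
    refine continuous_of_dominated (bound := fun _ => K1 * K2) (fun y => ?_) (fun y => ?_) (integrable_const _) ?_
    · exact (by fun_prop : Continuous _).aestronglyMeasurable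
    · refine Eventually.of_forall fun x => ?_
      rw [norm_mul]; exact mul_le_mul (hK1 _) (hK2 _) (norm_nonneg _) ((norm_nonneg _).trans (hK1 0))
    · exact Eventually.of_forall fun x => by fun_prop
  have hpt : ∀ z, |κ z * (J (a • z) - J 0)| ≤
      (2 * Cw * ‖h‖ ^ s' * a ^ (s - s') * np q η) * ((1 + ‖z‖ ^ 2) * (1 + ‖z‖)) := by
    intro z
    rw [abs_mul]
    have h1 : ‖z‖ ^ (s - s') ≤ 1 + ‖z‖ := by
      rcases le_total ‖z‖ 1 with hz | hz
      · exact (Real.rpow_le_one (norm_nonneg _) hz (by linarith)).trans (by linarith [norm_nonneg z])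
      · have := Real.rpow_le_rpow_of_exponent_le hz (by linarith : s - s' ≤ 1)
        rw [Real.rpow_one] at this; linarith
    have h2 := hJb (a • z)
    rw [norm_smul, Real.norm_of_nonneg ha.le, Real.mul_rpow ha.le (norm_nonneg _)] at h2
    have h0 : 0 ≤ ‖h‖ ^ s' := Real.rpow_nonneg (norm_nonneg _) _
    have h3 : |J (a • z) - J 0| ≤ 2 * Cw * ‖h‖ ^ s' * (a ^ (s - s') * (1 + ‖z‖)) * np q η :=
      h2.trans (by gcongr)
    refine (mul_le_mul (hκ i j z) h3 (abs_nonneg _) (by positivity)).trans (le_of_eq ?_)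
    ring
  have iJ : Integrable (fun z => κ z * (J (a • z) - J 0)) (gam m) :=
    (hint.const_mul _).mono' (by fun_prop : Continuous _).aestronglyMeasurable (Eventually.of_forall hpt)
  have e3 : ∫ z, κ z * J (a • z) ∂(gam m) = ∫ z, κ z * (J (a • z) - J 0) ∂(gam m) := by
    have : ∀ z, κ z * J (a • z) = κ z * (J (a • z) - J 0) + κ z * J 0 := fun z => by ring
    simp_rw [this]
    rw [integral_add iJ (iκ.mul_const _), integral_mul_const, kap2_zero, zero_mul, add_zero]
  rw [← abs_of_pos (pow_pos ha 2), ← abs_mul, e1, e3]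
  refine (abs_int_le (hint.const_mul _) hpt).trans ?_
  rw [integral_const_mul, ← hI]
  have h0 : 0 ≤ ‖h‖ ^ s' := Real.rpow_nonneg (norm_nonneg _) _
  have h1 : 0 ≤ Cw * np q η * ‖h‖ ^ s' * a ^ (s - s') := by positivity
  nlinarith

end

namespace Ctx
variable {m : ℕ} {V : Spc m → ℝ} {β σ p : ℝ} {ψ0 : Spc m → ℝ} {Tmax : ℝ≥0∞} {ψ : ℝ → Spc m → ℝ}

lemma E3 (H : Ctx m V β σ p ψ0 Tmax ψ) {s' : ℝ} (hs0 : 0 < s') (hs1 : s' < 1) :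
    ∃ C > 0, ∀ t ∈ Ioo0 Tmax, ∀ i h, ‖h‖ ≤ 1 →
      np p (dl h (pd (dir i) (ψ t))) ≤ C * (np p (dl h (pd (dir i) ψ0)) + ‖h‖ ^ s') := by
  have hpq := Real.HolderConjugate.conjExponent H.p1
  set q := p.conjExponent
  obtain ⟨s, hss, hsl⟩ := exists_between hs1
  obtain ⟨C, hC, hk⟩ := kern m hpq
  obtain ⟨C1, hC1, hd⟩ := shift_drift m hpq
  obtain ⟨C2, hC2, hd2⟩ := drift2 m hpq
  obtain ⟨S, hS, hS1, hS2⟩ := H.np_psi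
  obtain ⟨Cw, hCw, hW⟩ := H.W2 (hs0.trans hss) hsl
  have hp0 := H.p0
  have hβ := H.hβ
  set K := β * ((m + 1) * (C2 * Cw)) with hK
  have hK0 : 0 < K := by positivity
  have hε : 0 < s - s' := by linarith
  refine ⟨C + C1 * S + K / (s - s'), by positivity, fun t ht i h hh => ?_⟩
  have hSn := H.snap ht
  have ht' := sub_mem ht
  have hhs : 0 ≤ ‖h‖ ^ s' := Real.rpow_nonneg (norm_nonneg _) _
  have hhs1 : ‖h‖ ≤ ‖h‖ ^ s' := by
    rcases (norm_nonneg h).eq_or_lt with h0 | h0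
    · rw [← h0, Real.zero_rpow hs0.ne']
    · have := Real.rpow_le_rpow_of_exponent_ge h0 hh hs1.le
      rwa [Real.rpow_one] at this
  set P := np p (dl h (pd (dir i) ψ0)) with hP
  have hP0 : 0 ≤ P := np_nonneg _ _
  have hgp : Per (pd (dir i) (ψ t)) := hSn.per.pd _
  have hgc : Continuous (pd (dir i) (ψ t)) := C1_pd_cont hSn.c1 _
  refine dual_p hpq (by positivity) (hgp.dl h) (cont_dl hgc h) fun η hη => ?_
  have hN := np_nonneg q η
  have hs := hη.sh h
  rw [← pair_sh hgp hgc.measurable (per_int hgp hgc) hη.2 hη.cont,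
    ibp hSn.per hSn.diff hs.2 hs.diff _ (per_int hgp hgc) (per_int (hs.pd _).2 (hs.pd _).cont)]
  obtain ⟨a0, ha0, ha1, hat, hcase⟩ := H.start_scale ht
  have hfl := H.flow (C := K * ‖h‖ ^ s' * np q η) (θ := s - s') (hs.pd (dir i)) ht' ha0.le hat hε ?_
  swap
  · intro a ha r hr hrt
    have hSr := H.snap hr
    have : ∀ k, |a * ∫ x in cube m, Wd V (ψ r) k x * Ph a (pd (dir k) (pd (dir i) (sh h η))) x| ≤
        C2 * Cw * np q η * ‖h‖ ^ s' * a ^ (s - s' - 1) := by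
      intro k
      rw [abs_mul, abs_of_pos ha.1]
      have := hd2 _ η (Wd_per H.hVp hSr.per k) (Wd_C1 H.hV H.hVp hSr.per hSr.c1 hSr.pos k).continuous
        hη h Cw s s' hs0 hss hsl hCw.le (hW r hr k) a ha.1 i k
      rw [Real.rpow_sub_one ha.1.ne', ← mul_div_assoc, le_div_iff₀ ha.1]
      refine le_trans (le_of_eq ?_) this
      ring
    rw [mul_assoc, abs_mul, abs_of_pos hβ, Finset.mul_sum]
    refine (mul_le_mul_of_nonneg_left ((Finset.abs_sum_le_sum_abs _ _).trans
      (Finset.sum_le_sum fun k _ => this k)) hβ.le).trans (le_of_eq ?_)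
    simp only [Finset.sum_const, Finset.card_univ, Fintype.card_option, Fintype.card_fin,
      nsmul_eq_mul, Nat.cast_add, Nat.cast_one]
    rw [hK]
    ring
  have hstart : |∫ x in cube m, ψ (t - β * a0 ^ 2 / 2) x * Ph a0 (pd (dir i) (sh h η)) x| ≤
      (C * P + C1 * S * ‖h‖ ^ s') * np q η := by
    rcases hcase with hc | hc
    · subst hc
      have hm : t - β * 1 ^ 2 / 2 ∈ Ico0 Tmax := le_mem ht' ⟨by linarith, by nlinarith⟩
      have := (hd _ η (H.per hm) (H.cont hm) hη h).2 1 one_pos 1 zero_le_one le_rfl i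
      rw [one_mul, div_one, Real.rpow_one] at this
      refine this.trans ?_
      have h1 := hS1 _ hm
      have h2 : C1 * np p (ψ (t - β * 1 ^ 2 / 2)) * np q η * ‖h‖ ≤ C1 * S * np q η * ‖h‖ ^ s' := by gcongr
      have h3 : 0 ≤ C * P * np q η := by positivity
      linarith
    · rw [hc, H.psi0_eq, ← Ph_pd a0 hs]
      have i0 := memLp_int H.p1.le (H.pd0_memLp (dir i))
      have e := ibp H.per0 H.diff0 (Ph_per a0 hs.2) ((Ph_C1 a0 hs).differentiable (by simp)) (dir i)
        i0 (per_int ((Ph_per a0 hs.2).pd _) (C1_pd_cont (Ph_C1 a0 hs) _))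
      rw [eq_neg_iff_add_eq_zero, add_comm, ← eq_neg_iff_add_eq_zero] at e
      rw [e, abs_neg, Ph_sh a0 hη, pair_sh (H.per0.pd _) (pd_meas _ _) i0 (Ph_per a0 hη.2) (Ph_cont a0 hη)]
      have hmL : MemLp (dl h (pd (dir i) ψ0)) (ofReal p) (volume.restrict (cube m)) :=
        (memLp_shift ofReal_ne_top (H.per0.pd _) (pd_meas _ _) (H.pd0_memLp (dir i)) h).sub
          (H.pd0_memLp (dir i))
      refine ((hk _ _ hmL hη a0 ha0).1).trans ?_
      have h3 : 0 ≤ C1 * S * ‖h‖ ^ s' * np q η := by positivity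
      rw [← hP]
      linarith
  have h6 : K * ‖h‖ ^ s' * np q η * a0 ^ (s - s') / (s - s') ≤ K / (s - s') * ‖h‖ ^ s' * np q η := by
    have := Real.rpow_le_one ha0.le ha1 hε.le
    calc _ = K / (s - s') * ‖h‖ ^ s' * np q η * a0 ^ (s - s') := by ring
      _ ≤ _ := mul_le_of_le_one_right (by positivity) this
  have h7 := (abs_le.1 hfl).1
  have h8 := (abs_le.1 hstart).1
  have h9 : 0 ≤ (C * ‖h‖ ^ s' + C1 * S * P + K / (s - s') * P) * np q η := by positivity
  linarith

end Ctx

lemma chi_ex (m : ℕ) : ∃ χ : Spc m → ℝ, ContDiff ℝ 1 χ ∧ HasCompactSupport χ ∧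
    tsupport χ ⊆ cube m ∧ (∫ u, χ u) = 1 := by
  let c : Spc m := (1/2, fun _ => 1/2)
  let φ : ContDiffBump c := ⟨1/8, 1/4, by norm_num, by norm_num⟩
  refine ⟨φ.normed volume, φ.contDiff_normed, φ.hasCompactSupport_normed, ?_, φ.integral_normed⟩
  rw [φ.tsupport_normed_eq]
  intro x hx
  rw [Metric.mem_closedBall, dist_eq_norm, Prod.norm_def, sup_le_iff] at hx
  have h1 := abs_le.1 hx.1
  have h2 : ∀ i, |x.2 i - 1/2| ≤ 1/4 := fun i => (norm_le_pi_norm (x.2 - c.2) i).trans hx.2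
  simp only [Prod.fst_sub, c] at h1
  have e : φ.rOut = 1/4 := rfl
  rw [e] at h1
  refine ⟨⟨by linarith, by linarith⟩, fun i _ => ?_⟩
  have := abs_le.1 (h2 i)
  exact ⟨by linarith, by linarith⟩

lemma jen {α : Type*} [MeasurableSpace α] (μ : Measure α) [IsProbabilityMeasure μ] {p : ℝ} (hp : 1 < p)
    {f : α → ℝ≥0∞} (hf : AEMeasurable f μ) : (∫⁻ x, f x ∂μ) ^ p ≤ ∫⁻ x, f x ^ p ∂μ := by
  have h := ENNReal.lintegral_mul_le_Lp_mul_Lq μ (Real.HolderConjugate.conjExponent hp) hf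
    (aemeasurable_const (b := (1 : ℝ≥0∞)))
  have hp0 : 0 < p := by linarith
  simp only [Pi.mul_apply, mul_one, ENNReal.one_rpow, lintegral_const, measure_univ] at h
  calc _ ≤ ((∫⁻ x, f x ^ p ∂μ) ^ (1 / p)) ^ p := ENNReal.rpow_le_rpow h hp0.le
    _ = _ := by rw [← ENNReal.rpow_mul, one_div_mul_cancel hp0.ne', ENNReal.rpow_one]

lemma aff_mem {m : ℕ} {a u : Spc m} (ha : a ∈ Icc (0 : Spc m) 1) (hu : u ∈ cube m) {r : ℝ}
    (hr : 0 < r) (hr1 : r ≤ 1) : a + r • (u - a) ∈ cube m := by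
  obtain ⟨⟨h1, h1'⟩, h2⟩ := hu
  obtain ⟨⟨a1, a1'⟩, a2, a2'⟩ := ha
  refine ⟨⟨?_, ?_⟩, fun i _ => ⟨?_, ?_⟩⟩
  · simp at a1 ⊢; nlinarith
  · simp at a2 ⊢; nlinarith
  · have := a1' i; have := (h2 i trivial).1; simp at this ⊢; simp at *; nlinarith [a1' i]
  · have := a2' i; have := (h2 i trivial).2; simp at this ⊢; simp at *; nlinarith [a2' i]

lemma Kdist {m : ℕ} {a u : Spc m} (ha : a ∈ Icc (0 : Spc m) 1) (hu : u ∈ Icc (0 : Spc m) 1) :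
    ‖u - a‖ ≤ 1 := by
  obtain ⟨⟨h1, h1'⟩, h2, h2'⟩ := hu
  obtain ⟨⟨a1, a1'⟩, a2, a2'⟩ := ha
  rw [Prod.norm_def, sup_le_iff]
  constructor
  · simp at *; rw [abs_le]; constructor <;> linarith
  · refine (pi_norm_le_iff_of_nonneg zero_le_one).2 fun i => ?_
    have := a1' i; have := a2' i; have := h1' i; have := h2' i
    simp at *; rw [abs_le]; constructor <;> linarith

lemma lint_scale {m : ℕ} (c : Spc m) {r : ℝ} (hr : 0 < r) {f : Spc m → ℝ≥0∞} (hf : Measurable f) :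
    ∫⁻ u, f (c + r • u) = ofReal ((r ^ (m+1))⁻¹) * ∫⁻ z, f z := by
  have h := Measure.map_addHaar_smul (volume : Measure (Spc m)) hr.ne'
  rw [finrank_spc, abs_of_pos (by positivity)] at h
  have h2 : ∫⁻ u, f (c + r • u) = ∫⁻ z, f (c + z) ∂(Measure.map (fun x : Spc m => r • x) volume) := by
    rw [lintegral_map (by fun_prop) (by fun_prop)]
  rw [h2, h, lintegral_smul_measure, lintegral_add_left_eq_self f c, smul_eq_mul]

lemma chg {m : ℕ} {a : Spc m} (ha : a ∈ Icc (0 : Spc m) 1) {r : ℝ}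
    (hr : 0 < r) (hr1 : r ≤ 1) {f : Spc m → ℝ≥0∞} (hf : Measurable f) :
    ∫⁻ u in cube m, f (a + r • (u - a)) ≤ ofReal ((r ^ (m+1))⁻¹) * ∫⁻ z in cube m, f z := by
  rw [← lintegral_indicator (meas_cube m), ← lintegral_indicator (meas_cube m),
    ← lint_scale (a - r • a) hr (hf.indicator (meas_cube m))]
  refine lintegral_mono fun u => ?_
  by_cases hu : u ∈ cube m
  · have := aff_mem ha hu hr hr1
    have e : a - r • a + r • u = a + r • (u - a) := by rw [smul_sub]; abel
    rw [indicator_of_mem hu, e, indicator_of_mem this]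
  · rw [indicator_of_notMem hu]; exact zero_le

def kg {m : ℕ} (G : Spc m → ℝ) (p r : ℝ) (z w : Spc m) : ℝ≥0∞ :=
  ofReal (|G z - G w| ^ p / ‖z - w‖ ^ r)

def kgx {m : ℕ} (G : Spc m → ℝ) (p r : ℝ) (x : Spc m) (ρ : ℝ) (z w : Spc m) : ℝ≥0∞ :=
  (Metric.closedBall (0:Spc m) (2 * ρ)).indicator 1 (x - z) *
    ((Metric.closedBall (0:Spc m) (3 * ρ)).indicator 1 (z - w) * kg G p r z w)

def EE {m : ℕ} (G : Spc m → ℝ) (p r : ℝ) (x : Spc m) (ρ : ℝ) : ℝ≥0∞ :=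
  ∫⁻ z in cube m, ∫⁻ w in cube m, kgx G p r x ρ z w

def Av {m : ℕ} (χ G : Spc m → ℝ) (r : ℝ) (a : Spc m) : ℝ := ∫ u, χ u * G (a + r • (u - a))

lemma kg_meas {m : ℕ} {G : Spc m → ℝ} (hG : Measurable G) (p r : ℝ) :
    Measurable (fun q : Spc m × Spc m => kg G p r q.1 q.2) := by
  unfold kg; fun_prop

lemma ind_meas {m : ℕ} (R : ℝ) : Measurable
    ((Metric.closedBall (0:Spc m) R).indicator (1 : Spc m → ℝ≥0∞)) :=
  measurable_one.indicator Metric.isClosed_closedBall.measurableSet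

lemma kgx_meas {m : ℕ} {G : Spc m → ℝ} (hG : Measurable G) (p r ρ : ℝ) {α : Type*} [MeasurableSpace α]
    {a b c : α → Spc m} (ha : Measurable a) (hb : Measurable b) (hc : Measurable c) :
    Measurable (fun q : α => kgx G p r (a q) ρ (b q) (c q)) := by
  have h1 : Measurable fun q => (Metric.closedBall (0:Spc m) (2 * ρ)).indicator (1 : Spc m → ℝ≥0∞) (a q - b q) :=
    (ind_meas (2 * ρ)).comp (ha.sub hb)
  have h2 : Measurable fun q => (Metric.closedBall (0:Spc m) (3 * ρ)).indicator (1 : Spc m → ℝ≥0∞) (b q - c q) :=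
    (ind_meas (3 * ρ)).comp (hb.sub hc)
  have h3 : Measurable fun q => kg G p r (b q) (c q) := by
    unfold kg; fun_prop
  unfold kgx
  exact h1.mul (h2.mul h3)

lemma EE_meas {m : ℕ} {G : Spc m → ℝ} (hG : Measurable G) (p r ρ : ℝ) :
    Measurable (fun x => EE G p r x ρ) := by
  have h1 : Measurable (fun q : (Spc m × Spc m) × Spc m => kgx G p r q.1.1 ρ q.1.2 q.2) :=
    kgx_meas hG p r ρ (measurable_fst.comp measurable_fst) (measurable_snd.comp measurable_fst) measurable_snd
  have h2 : Measurable fun q : Spc m × Spc m => ∫⁻ w in cube m, kgx G p r q.1 ρ q.2 w :=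
    h1.lintegral_prod_right'
  exact h2.lintegral_prod_right'

lemma aff_int {m : ℕ} {G : Spc m → ℝ} (hm : Measurable G) (hi : IntegrableOn G (cube m))
    {a : Spc m} (ha : a ∈ Icc (0 : Spc m) 1) {r : ℝ} (hr : 0 < r) (hr1 : r ≤ 1) :
    IntegrableOn (fun u => G (a + r • (u - a))) (cube m) := by
  refine ⟨(hm.comp (by fun_prop)).aestronglyMeasurable, ?_⟩
  refine (chg ha hr hr1 (f := fun z => ‖G z‖ₑ) hm.enorm).trans_lt ?_
  exact ENNReal.mul_lt_top ofReal_lt_top hi.2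

lemma chi_int {m : ℕ} {χ : Spc m → ℝ} {B : ℝ} (hB : ∀ u, |χ u| ≤ B) (hc : Continuous χ)
    (hs : ∀ u ∉ cube m, χ u = 0) {g : Spc m → ℝ} (hg : IntegrableOn g (cube m)) :
    Integrable (fun u => χ u * g u) := by
  have h : IntegrableOn (fun u => χ u * g u) (cube m) :=
    hg.bdd_mul (c := B) hc.aestronglyMeasurable (Eventually.of_forall hB)
  refine (integrableOn_iff_integrable_of_support_subset ?_).1 h
  intro u hu
  by_contra h'
  exact hu (by simp [hs u h'])

lemma av_diff {m : ℕ} {χ : Spc m → ℝ} {B : ℝ} (hB : ∀ u, |χ u| ≤ B) (hc : Continuous χ)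
    (hs : ∀ u ∉ cube m, χ u = 0) (h1 : ∫ u, χ u = 1) {G : Spc m → ℝ} (hm : Measurable G)
    (hi : IntegrableOn G (cube m)) {p R : ℝ} (hp : 1 < p) (hR : 0 < R)
    {a b x : Spc m} (ha : a ∈ Icc (0 : Spc m) 1) (hb : b ∈ Icc (0 : Spc m) 1) {r r' ρ : ℝ}
    (hr' : 0 < r') (hrr : r' ≤ r) (hr1 : r ≤ 1) (hrρ : r ≤ ρ) (hab : ‖a - b‖ ≤ r) (hax : ‖a - x‖ ≤ ρ) :
    ‖Av χ G r a - Av χ G r' b‖ₑ ^ p ≤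
      ofReal (B * B) ^ p * ofReal ((3 * r) ^ R * ((r ^ (m+1))⁻¹ * (r' ^ (m+1))⁻¹)) * EE G p R x ρ := by
  have hr : 0 < r := hr'.trans_le hrr
  have hB0 : 0 ≤ B := (abs_nonneg _).trans (hB 0)
  have hp0 : 0 < p := by linarith
  have ia := aff_int hm hi ha hr hr1
  have ib := aff_int hm hi hb hr' (hrr.trans hr1)
  have := finQ m
  have hχ : ∀ (f : Spc m → ℝ≥0∞), ∫⁻ u, ‖χ u‖ₑ * f u ≤ ofReal B * ∫⁻ u in cube m, f u := by
    intro f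
    rw [← lintegral_const_mul' _ _ ofReal_ne_top, ← lintegral_indicator (meas_cube m)]
    refine lintegral_mono fun u => ?_
    by_cases hu : u ∈ cube m
    · rw [indicator_of_mem hu]
      gcongr
      rw [← ofReal_norm]
      exact ofReal_le_ofReal (hB u)
    · rw [indicator_of_notMem hu, hs u hu]; simp
  have hχi : Integrable χ := by
    simpa using chi_int hB hc hs (g := fun _ => 1) (integrable_const _)
  have key : ∀ (c : ℝ) (g : Spc m → ℝ), IntegrableOn g (cube m) →
      ‖c - ∫ u, χ u * g u‖ₑ ≤ ofReal B * ∫⁻ u in cube m, ‖c - g u‖ₑ := by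
    intro c g hg
    have e : c - ∫ u, χ u * g u = ∫ u, χ u * (c - g u) := by
      simp_rw [mul_sub]
      rw [integral_sub (hχi.mul_const c) (chi_int hB hc hs hg), integral_mul_const, h1, one_mul]
    rw [e]
    refine (enorm_integral_le_lintegral_enorm _).trans ?_
    simp_rw [enorm_mul]
    exact hχ _
  set g1 : Spc m → ℝ := fun u => G (a + r • (u - a)) with hg1
  set g2 : Spc m → ℝ := fun u => G (b + r' • (u - b)) with hg2
  have m1 : Measurable g1 := hm.comp (by fun_prop)
  have m2 : Measurable g2 := hm.comp (by fun_prop)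
  have hA : ‖Av χ G r a - Av χ G r' b‖ₑ ≤
      ofReal (B * B) * ∫⁻ u in cube m, ∫⁻ v in cube m, ‖g1 u - g2 v‖ₑ := by
    rw [← neg_sub, enorm_neg]
    refine (key _ _ ia).trans ?_
    rw [ofReal_mul hB0, mul_assoc]
    gcongr
    rw [← lintegral_const_mul' _ _ ofReal_ne_top]
    refine lintegral_mono fun u => ?_
    rw [← neg_sub, enorm_neg]
    exact key _ _ ib
  have mm : Measurable fun q : Spc m × Spc m => ‖g1 q.1 - g2 q.2‖ₑ := by fun_prop
  have hP : IsProbabilityMeasure ((volume : Measure (Spc m)).restrict (cube m)) := instProbT m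
  have hJ : (∫⁻ u in cube m, ∫⁻ v in cube m, ‖g1 u - g2 v‖ₑ) ^ p ≤
      ∫⁻ u in cube m, ∫⁻ v in cube m, ‖g1 u - g2 v‖ₑ ^ p := by
    refine (jen _ hp mm.lintegral_prod_right'.aemeasurable).trans ?_
    refine lintegral_mono fun u => ?_
    exact jen _ hp (by fun_prop)
  have hK : ∀ u ∈ cube m, ∀ v ∈ cube m, ‖g1 u - g2 v‖ₑ ^ p ≤ ofReal ((3 * r) ^ R) *
      kgx G p R x ρ (a + r • (u - a)) (b + r' • (v - b)) := by
    intro u hu v hv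
    have d1 := Kdist ha (cube_sub m hu)
    have d2 := Kdist hb (cube_sub m hv)
    set z := a + r • (u - a)
    set w := b + r' • (v - b)
    have n1 : ‖r • (u - a)‖ ≤ r := by
      rw [norm_smul, Real.norm_of_nonneg hr.le]; nlinarith
    have n2 : ‖r' • (v - b)‖ ≤ r := by
      rw [norm_smul, Real.norm_of_nonneg hr'.le]; nlinarith
    have zx : ‖x - z‖ ≤ 2 * ρ := by
      rw [norm_sub_rev, show z - x = (a - x) + r • (u - a) by simp only [z]; abel]
      refine (norm_add_le _ _).trans ?_
      linarith
    have zw : ‖z - w‖ ≤ 3 * r := by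
      rw [show z - w = (a - b) + r • (u - a) - r' • (v - b) by simp only [z, w]; abel]
      refine (norm_sub_le _ _).trans ?_
      have := norm_add_le (a - b) (r • (u - a))
      linarith
    unfold kgx
    rw [indicator_of_mem (by simpa using zx), indicator_of_mem (by simp; linarith)]
    simp only [Pi.one_apply, one_mul]
    rw [kg, ← ofReal_mul (by positivity), ← ofReal_norm,
      ofReal_rpow_of_nonneg (norm_nonneg _) hp0.le]
    refine ofReal_le_ofReal ?_
    rw [Real.norm_eq_abs]
    change |G z - G w| ^ p ≤ _
    by_cases hzw : z = w
    · rw [hzw]; simp [Real.zero_rpow hp0.ne']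
    · have h0 : 0 < ‖z - w‖ := norm_pos_iff.2 (sub_ne_zero.2 hzw)
      have h2 : ‖z - w‖ ^ R ≤ (3 * r) ^ R := Real.rpow_le_rpow h0.le zw hR.le
      rw [mul_div_assoc', le_div_iff₀ (by positivity), mul_comm]
      gcongr
  calc _ ≤ (ofReal (B * B) * ∫⁻ u in cube m, ∫⁻ v in cube m, ‖g1 u - g2 v‖ₑ) ^ p :=
        ENNReal.rpow_le_rpow hA hp0.le
    _ ≤ ofReal (B * B) ^ p * ∫⁻ u in cube m, ∫⁻ v in cube m, ‖g1 u - g2 v‖ₑ ^ p := by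
        rw [ENNReal.mul_rpow_of_nonneg _ _ hp0.le]; gcongr
    _ ≤ ofReal (B * B) ^ p * (ofReal ((3 * r) ^ R) * (ofReal ((r ^ (m+1))⁻¹) *
         (ofReal ((r' ^ (m+1))⁻¹) * EE G p R x ρ))) := by
        refine mul_le_mul' le_rfl ?_
        calc _ ≤ ∫⁻ u in cube m, ∫⁻ v in cube m, ofReal ((3 * r) ^ R) *
              kgx G p R x ρ (a + r • (u - a)) (b + r' • (v - b)) :=
              setLIntegral_mono' (meas_cube m) fun u hu => setLIntegral_mono' (meas_cube m) fun v hv => hK u hu v hv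
          _ = ofReal ((3 * r) ^ R) * ∫⁻ u in cube m, ∫⁻ v in cube m,
              kgx G p R x ρ (a + r • (u - a)) (b + r' • (v - b)) := by
              simp_rw [lintegral_const_mul' _ _ ofReal_ne_top]
          _ ≤ ofReal ((3 * r) ^ R) * ∫⁻ u in cube m, ofReal ((r' ^ (m+1))⁻¹) *
                ∫⁻ w in cube m, kgx G p R x ρ (a + r • (u - a)) w := by
              gcongr with u
              exact chg hb hr' (hrr.trans hr1) (kgx_meas hm p R ρ measurable_const measurable_const measurable_id)
          _ ≤ _ := by
              refine mul_le_mul' le_rfl ?_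
              rw [lintegral_const_mul' _ _ ofReal_ne_top, mul_left_comm]
              refine mul_le_mul' le_rfl ?_
              refine chg ha hr hr1 (f := fun z => ∫⁻ w in cube m, kgx G p R x ρ z w) ?_
              have : Measurable fun q : Spc m × Spc m => kgx G p R x ρ q.1 q.2 :=
                kgx_meas hm p R ρ measurable_const measurable_fst measurable_snd
              exact this.lintegral_prod_right'
    _ = _ := by
        have e1 : 0 ≤ (3 * r) ^ R := by positivity
        have e2 : 0 ≤ (r ^ (m+1))⁻¹ := by positivity
        rw [ofReal_mul e1, ofReal_mul e2, mul_assoc, mul_assoc, mul_assoc]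

lemma av_lim {m : ℕ} {χ : Spc m → ℝ} (hχ : ContDiff ℝ 1 χ) (hcs : HasCompactSupport χ)
    (hts : tsupport χ ⊆ cube m) (h1 : ∫ u, χ u = 1) {u : Spc m → ℝ} (hu : Differentiable ℝ u) (e : Spc m)
    (hi : IntegrableOn (pd e u) (cube m)) {P : Spc m} (hP : P ∈ Icc (0 : Spc m) 1) :
    Tendsto (fun r => Av χ (pd e u) r P) (𝓝[>] 0) (𝓝 (pd e u P)) := by
  have hm : Measurable (pd e u) := Ctx.pd_meas u e
  have := finQ m
  obtain ⟨B, hB⟩ := hχ.continuous.bounded_above_of_compact_support hcs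
  have hs : ∀ v ∉ cube m, χ v = 0 := fun v hv => image_eq_zero_of_notMem_tsupport fun h => hv (hts h)
  have hcf : Continuous fun v => fderiv ℝ χ v e := (hχ.continuous_fderiv (by simp)).clm_apply continuous_const
  have hcsf : HasCompactSupport fun v => fderiv ℝ χ v e := hcs.fderiv_apply ℝ e
  have hfi : Integrable fun v => fderiv ℝ χ v e := hcf.integrable_of_hasCompactSupport hcsf
  have hχi : Integrable χ := hχ.continuous.integrable_of_hasCompactSupport hcs
  have hsf : ∀ v ∉ cube m, fderiv ℝ χ v e = 0 := fun v hv => by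
    have : v ∉ tsupport (fderiv ℝ χ) := fun h => hv (hts (tsupport_fderiv_subset ℝ h))
    rw [image_eq_zero_of_notMem_tsupport this]; rfl
  set L := fderiv ℝ u P with hL
  set I := ∫ v, |fderiv ℝ χ v e| with hI
  have hI0 : 0 ≤ I := integral_nonneg fun _ => abs_nonneg _
  rw [Metric.tendsto_nhdsWithin_nhds]
  intro ε hε
  set ε' := ε / (I + 1) with hε'
  have hε0 : 0 < ε' := by positivity
  have hd := (hu P).hasFDerivAt.isLittleO.bound hε0
  obtain ⟨δ, hδ, hδ'⟩ := Metric.eventually_nhds_iff.1 hd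
  refine ⟨min δ 1, by positivity, fun {r} hr hrd => ?_⟩
  have hr0 : (0:ℝ) < r := hr
  rw [Real.dist_eq, sub_zero, abs_of_pos hr0, lt_min_iff] at hrd
  set f : Spc m → ℝ := fun v => r⁻¹ * (u (P + r • (v - P)) - u P) - L (v - P) with hf
  have hfd : ∀ v, HasFDerivAt f (fderiv ℝ u (P + r • (v - P)) - L) v := by
    intro v
    have a1 : HasFDerivAt (fun v : Spc m => P + r • (v - P)) (r • ContinuousLinearMap.id ℝ (Spc m)) v :=
      (((hasFDerivAt_id v).sub_const P).const_smul r).const_add P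
    have a2 := (hu (P + r • (v - P))).hasFDerivAt.comp v a1
    have a3 := ((a2.sub_const (u P)).const_mul r⁻¹).sub (L.hasFDerivAt.comp v ((hasFDerivAt_id v).sub_const P))
    refine a3.congr_fderiv ?_
    ext w <;> simp [hr0.ne']
  have hfdiff : Differentiable ℝ f := fun v => (hfd v).differentiableAt
  have hfb : ∀ v ∈ cube m, |f v| ≤ ε' := by
    intro v hv
    have d1 := Kdist hP (cube_sub m hv)
    have n1 : ‖r • (v - P)‖ ≤ r := by rw [norm_smul, Real.norm_of_nonneg hr0.le]; nlinarith
    have h3 := hδ' (y := P + r • (v - P)) (by rw [dist_eq_norm]; simp only [add_sub_cancel_left]; linarith)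
    simp only [add_sub_cancel_left] at h3
    have h4 : f v = r⁻¹ * (u (P + r • (v - P)) - u P - L (r • (v - P))) := by
      simp only [hf, map_smul, smul_eq_mul]; field_simp
    rw [h4, abs_mul, abs_of_pos (inv_pos.2 hr0), inv_mul_le_iff₀ hr0]
    rw [Real.norm_eq_abs] at h3
    refine h3.trans ?_
    rw [mul_comm]; gcongr
  have ibp := integral_mul_fderiv_eq_neg_fderiv_mul_of_integrable (μ := (volume : Measure (Spc m)))
    (f := χ) (g := f) (v := e)
    ((hcf.mul hfdiff.continuous).integrable_of_hasCompactSupport hcsf.mul_right)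
    (by
      have : IntegrableOn (fun v => pd e u (P + r • (v - P)) - L e) (cube m) :=
        (aff_int hm hi hP hr0 hrd.2.le).sub (integrable_const _)
      have := chi_int hB hχ.continuous hs this
      refine this.congr (Eventually.of_forall fun v => ?_)
      simp only [(hfd v).fderiv]; rfl)
    ((hχ.continuous.mul hfdiff.continuous).integrable_of_hasCompactSupport hcs.mul_right)
    (fun x _ => hχ.differentiable (by simp) x) (fun x _ => hfdiff x)
  have e1 : ∫ v, χ v * (fderiv ℝ f v) e = Av χ (pd e u) r P - pd e u P := by
    have : ∀ v, χ v * (fderiv ℝ f v) e = χ v * pd e u (P + r • (v - P)) - χ v * pd e u P := fun v => by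
      rw [(hfd v).fderiv, ← mul_sub]; rfl
    simp_rw [this]
    rw [integral_sub (chi_int hB hχ.continuous hs (aff_int hm hi hP hr0 hrd.2.le)) (hχi.mul_const _),
      integral_mul_const, h1, one_mul]; rfl
  rw [Real.dist_eq, ← e1, ibp, abs_neg]
  have h5 : |∫ v, (fderiv ℝ χ v) e * f v| ≤ ∫ v, |(fderiv ℝ χ v) e| * ε' := by
    refine abs_int_le (hfi.abs.mul_const _) fun v => ?_
    by_cases hv : v ∈ cube m
    · rw [abs_mul]; gcongr; exact hfb v hv
    · rw [hsf v hv]; simp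
  refine h5.trans_lt ?_
  rw [integral_mul_const, ← hI, hε', mul_div_assoc', div_lt_iff₀ (by positivity)]
  nlinarith

lemma morrey {m : ℕ} {u : Spc m → ℝ} (hu : Differentiable ℝ u) (e : Spc m)
    (hi : IntegrableOn (pd e u) (cube m)) {p s : ℝ} (hp : 1 < p) (hs : (m:ℝ) + 1 < s * p) :
    ∃ C > 0, ∀ x ∈ Icc (0 : Spc m) 1, ∀ P ∈ Icc (0 : Spc m) 1, ∀ ρ, 0 < ρ → ρ ≤ 1 → ‖x - P‖ ≤ ρ →
      ‖pd e u x - pd e u P‖ₑ ^ p ≤ ofReal (C * ρ ^ (s * p - (m + 1))) * EE (pd e u) p (m + 1 + s * p) x ρ := by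
  obtain ⟨χ, hχ, hcs, hts, h1⟩ := chi_ex m
  have hm : Measurable (pd e u) := Ctx.pd_meas u e
  obtain ⟨B, hB⟩ := hχ.continuous.bounded_above_of_compact_support hcs
  have hχs : ∀ v ∉ cube m, χ v = 0 := fun v hv => image_eq_zero_of_notMem_tsupport fun h => hv (hts h)
  have hp0 : 0 < p := by linarith
  set R : ℝ := m + 1 + s * p with hR
  have hR0 : 0 < R := by
    have : (0:ℝ) ≤ m := by positivity
    linarith
  have hB0 : 0 < B := by
    by_contra h
    have : ∀ v, χ v = 0 := fun v => norm_le_zero_iff.1 ((hB v).trans (not_lt.1 h))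
    simp [this] at h1
  set K0 : ℝ := (B * B) ^ p * (3 ^ R * 2 ^ (m + 1)) with hK0
  have hK : 0 < K0 := by positivity
  set κ : ℝ := s * p - (m + 1) with hκ
  have hκ0 : 0 < κ := by linarith
  set θ := κ / p with hθ
  have hθ0 : 0 < θ := by positivity
  set l : ℝ := (1/2) ^ θ with hl
  have hl1 : l < 1 := Real.rpow_lt_one (by norm_num) (by norm_num) hθ0
  set M : ℝ := 1 + 2 / (1 - l) with hM
  have hl2 : 0 < 1 - l := by linarith
  have hM0 : 0 < M := by positivity
  refine ⟨K0 * M ^ p, by positivity, fun x hx P hP ρ hρ hρ1 hxP => ?_⟩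
  by_cases hE : EE (pd e u) p R x ρ = ⊤
  · rw [hE, ENNReal.mul_top (by simp; positivity)]; exact le_top
  set E := (EE (pd e u) p R x ρ).toReal with hEd
  have hE0 : 0 ≤ E := ENNReal.toReal_nonneg
  have hEE : EE (pd e u) p R x ρ = ofReal E := (ofReal_toReal hE).symm
  set D := (K0 * E) ^ (1/p) with hD
  have hD0 : 0 ≤ D := by positivity
  have step : ∀ a ∈ Icc (0 : Spc m) 1, ∀ b ∈ Icc (0 : Spc m) 1, ∀ r r', 0 < r' → r' ≤ r → r ≤ 2 * r' →
      r ≤ ρ → ‖a - b‖ ≤ r → ‖a - x‖ ≤ ρ → |Av χ (pd e u) r a - Av χ (pd e u) r' b| ≤ D * r ^ θ := by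
    intro a ha b hb r r' hr' hrr hr2 hrρ hab hax
    have hr : 0 < r := hr'.trans_le hrr
    have h := av_diff hB hχ.continuous hχs h1 hm hi hp hR0 ha hb hr' hrr (hrρ.trans hρ1) hrρ hab hax
    rw [hEE, ofReal_rpow_of_pos (by positivity), ← ofReal_mul (by positivity),
      ← ofReal_mul (by positivity), ← ofReal_norm, ofReal_rpow_of_nonneg (norm_nonneg _) hp0.le,
      ofReal_le_ofReal_iff (by positivity), Real.norm_eq_abs] at h
    have h2 : (B * B) ^ p * ((3 * r) ^ R * ((r ^ (m + 1))⁻¹ * (r' ^ (m + 1))⁻¹)) * E ≤ (D * r ^ θ) ^ p := by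
      have e1 : (D * r ^ θ) ^ p = K0 * E * r ^ κ := by
        rw [Real.mul_rpow hD0 (by positivity), hD, ← Real.rpow_mul (by positivity), ← Real.rpow_mul hr.le,
          hθ, div_mul_cancel₀ (1:ℝ) hp0.ne', div_mul_cancel₀ κ hp0.ne', Real.rpow_one]
      have e2 : (r' ^ (m + 1))⁻¹ ≤ 2 ^ (m + 1) * (r ^ (m + 1))⁻¹ := by
        rw [← div_eq_mul_inv, ← div_pow, ← inv_pow]
        gcongr
        rw [le_div_iff₀ hr, inv_mul_le_iff₀ hr']; linarith
      have e3 : r ^ κ = r ^ R * ((r ^ (m + 1))⁻¹ * (r ^ (m + 1))⁻¹) := by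
        rw [← Real.rpow_natCast, ← Real.rpow_neg hr.le, ← Real.rpow_add hr, ← Real.rpow_add hr]
        congr 1
        push_cast
        rw [hκ, hR]; ring
      rw [e1, e3, hK0, Real.mul_rpow (by norm_num) hr.le]
      calc _ ≤ (B * B) ^ p * (3 ^ R * r ^ R * ((r ^ (m + 1))⁻¹ * (2 ^ (m + 1) * (r ^ (m + 1))⁻¹))) * E := by gcongr
        _ = _ := by ring
    exact (Real.rpow_le_rpow_iff (abs_nonneg _) (by positivity) hp0).1 (h.trans h2)
  have lim : ∀ a ∈ Icc (0 : Spc m) 1, ‖a - x‖ ≤ ρ → |Av χ (pd e u) ρ a - pd e u a| ≤ D * ρ ^ θ / (1 - l) := by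
    intro a ha hax
    have ht : Tendsto (fun j : ℕ => Av χ (pd e u) (ρ * (1/2) ^ j) a) atTop (𝓝 (pd e u a)) := by
      refine (av_lim hχ hcs hts h1 hu e hi ha).comp ?_
      refine tendsto_nhdsWithin_iff.2 ⟨?_, Eventually.of_forall fun j => ?_⟩
      · simpa using (tendsto_pow_atTop_nhds_zero_of_lt_one (by norm_num : (0:ℝ) ≤ 1/2) (by norm_num)).const_mul ρ
      · simp only [mem_Ioi]; positivity
    have := dist_le_of_le_geometric_of_tendsto₀ l (D * ρ ^ θ) hl1 (fun j => ?_) ht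
    · simpa [Real.dist_eq] using this
    · rw [Real.dist_eq]
      have hj : (1/2 : ℝ) ^ j ≤ 1 := pow_le_one₀ (by norm_num) (by norm_num)
      have hj0 : (0 : ℝ) < (1/2 : ℝ) ^ j := by positivity
      refine (step a ha a ha _ _ (by positivity) ?_ ?_ ?_ ?_ hax).trans (le_of_eq ?_)
      · rw [pow_succ]; nlinarith
      · rw [pow_succ]; nlinarith
      · nlinarith
      · simp; positivity
      · rw [Real.mul_rpow hρ.le hj0.le, hl, ← Real.rpow_natCast, ← Real.rpow_natCast, ← Real.rpow_mul (by norm_num),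
          ← Real.rpow_mul (by norm_num), mul_comm θ, mul_assoc]
  have l1 := lim x hx (by simp [hρ.le])
  have l2 := lim P hP (by rwa [norm_sub_rev])
  have l3 := step x hx P hP ρ ρ hρ le_rfl (by linarith) le_rfl hxP (by simp [hρ.le])
  have l4 : |pd e u x - pd e u P| ≤ D * ρ ^ θ * M := by
    have e1 : D * ρ ^ θ * M = D * ρ ^ θ + 2 * (D * ρ ^ θ / (1 - l)) := by rw [hM]; ring
    rw [e1]
    rw [abs_le] at *
    constructor <;> linarith
  rw [hEE, ← ofReal_mul (by positivity), ← ofReal_norm, ofReal_rpow_of_nonneg (norm_nonneg _) hp0.le]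
  refine ofReal_le_ofReal ?_
  refine (Real.rpow_le_rpow (abs_nonneg _) l4 hp0.le).trans (le_of_eq ?_)
  rw [Real.mul_rpow (by positivity) hM0.le, Real.mul_rpow hD0 (by positivity), hD, ← Real.rpow_mul (by positivity), ← Real.rpow_mul hρ.le,
          hθ, div_mul_cancel₀ (1:ℝ) hp0.ne', div_mul_cancel₀ κ hp0.ne', Real.rpow_one]
  ring

lemma geo1 {x h : ℝ} {k : ℤ} (h0 : 0 ≤ x) (h1 : x < 1) (hh : |h| ≤ 1) (hk : 0 ≤ x + h + k) (hk1 : x + h + k < 1) :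
    ∃ P : ℝ, (0 ≤ P ∧ P ≤ 1) ∧ (0 ≤ P + k ∧ P + k ≤ 1) ∧ |x - P| ≤ |h| ∧ |x + h - P| ≤ |h| := by
  have a := abs_le.1 hh
  rcases lt_or_ge (x + h) 0 with c | c
  · have : k = 1 := by
      have k1 : (0:ℝ) < k := by linarith
      have k2 : (k:ℝ) < 2 := by linarith
      have k1' : 0 < k := by exact_mod_cast k1
      have k2' : k < 2 := by exact_mod_cast k2
      omega
    have hn : h < 0 := by linarith
    refine ⟨0, by norm_num, by simp [this], ?_, ?_⟩
    · rw [abs_of_neg hn, abs_le]; constructor <;> linarith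
    · rw [abs_of_neg hn, abs_le]; constructor <;> linarith
  rcases lt_or_ge (x + h) 1 with d | d
  · have : k = 0 := by
      have k1 : (-1:ℝ) < k := by linarith
      have k2 : (k:ℝ) < 1 := by linarith
      have k1' : -1 < k := by exact_mod_cast k1
      have k2' : k < 1 := by exact_mod_cast k2
      omega
    exact ⟨x + h, ⟨c, d.le⟩, by simp [this, c, d.le], by simp, by simp⟩
  · have : k = -1 := by
      have k1 : (-2:ℝ) < k := by linarith
      have k2 : (k:ℝ) < 0 := by linarith
      have k1' : -2 < k := by exact_mod_cast k1
      have k2' : k < 0 := by exact_mod_cast k2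
      omega
    have hn : 0 < h := by linarith
    refine ⟨1, by norm_num, by simp [this], ?_, ?_⟩
    · rw [abs_of_pos hn, abs_le]; constructor <;> linarith
    · rw [abs_of_pos hn, abs_le]; constructor <;> linarith

lemma geo {m : ℕ} {x h : Spc m} (hx : x ∈ cube m) (hh : ‖h‖ ≤ 1) {g : Lam m} (hg : x + h + g ∈ cube m) :
    ∃ P ∈ Icc (0 : Spc m) 1, P + (g : Spc m) ∈ Icc (0 : Spc m) 1 ∧ ‖x - P‖ ≤ ‖h‖ ∧ ‖x + h - P‖ ≤ ‖h‖ := by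
  obtain ⟨g, ⟨k, j⟩, rfl⟩ := g
  obtain ⟨⟨x1, x1'⟩, x2⟩ := hx
  obtain ⟨⟨y1, y1'⟩, y2⟩ := hg
  have n1 : |h.1| ≤ ‖h‖ := norm_fst_le h
  have n2 : ∀ i, |h.2 i| ≤ ‖h‖ := fun i => (norm_le_pi_norm h.2 i).trans (norm_snd_le h)
  obtain ⟨P1, a1, a2, a3, a4⟩ := geo1 (k := k) x1 x1' (n1.trans hh) (by simpa [lat] using y1) (by simpa [lat] using y1')
  have : ∀ i, ∃ P : ℝ, (0 ≤ P ∧ P ≤ 1) ∧ (0 ≤ P + j i ∧ P + j i ≤ 1) ∧ |x.2 i - P| ≤ |h.2 i| ∧ |x.2 i + h.2 i - P| ≤ |h.2 i| := by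
    intro i
    have b1 := x2 i trivial
    have b2 := y2 i trivial
    exact geo1 (k := j i) b1.1 b1.2 ((n2 i).trans hh) (by simpa [lat] using b2.1) (by simpa [lat] using b2.2)
  choose P2 b1 b2 b3 b4 using this
  refine ⟨(P1, P2), ⟨⟨a1.1, fun i => (b1 i).1⟩, ⟨a1.2, fun i => (b1 i).2⟩⟩,
    ⟨⟨a2.1, fun i => (b2 i).1⟩, ⟨a2.2, fun i => (b2 i).2⟩⟩, ?_, ?_⟩
  · rw [Prod.norm_def, sup_le_iff]
    exact ⟨a3.trans n1, (pi_norm_le_iff_of_nonneg (norm_nonneg _)).2 fun i => (b3 i).trans (n2 i)⟩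
  · rw [Prod.norm_def, sup_le_iff]
    exact ⟨a4.trans n1, (pi_norm_le_iff_of_nonneg (norm_nonneg _)).2 fun i => (b4 i).trans (n2 i)⟩

lemma uniq0 {a : ℝ} {k : ℤ} (h0 : 0 ≤ a) (h1 : a < 1) (h2 : 0 ≤ a + k) (h3 : a + k < 1) : k = 0 := by
  have k1 : (-1:ℝ) < k := by linarith
  have k2 : (k:ℝ) < 1 := by linarith
  have k1' : -1 < k := by exact_mod_cast k1
  have k2' : k < 1 := by exact_mod_cast k2
  omega

lemma uniq {m : ℕ} {a : Spc m} (ha : a ∈ cube m) {g : Lam m} (hg : a + g ∈ cube m) : (g : Spc m) = 0 := by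
  obtain ⟨g, ⟨k, j⟩, rfl⟩ := g
  obtain ⟨⟨x1, x1'⟩, x2⟩ := ha
  obtain ⟨⟨y1, y1'⟩, y2⟩ := hg
  have e1 : k = 0 := uniq0 x1 x1' (by simpa [lat] using y1) (by simpa [lat] using y1')
  have e2 : ∀ i, j i = 0 := fun i => by
    have b1 := x2 i trivial
    have b2 := y2 i trivial
    exact uniq0 b1.1 b1.2 (by simpa [lat] using b2.1) (by simpa [lat] using b2.2)
  subst e1
  ext
  · simp [lat]
  · simp [lat, e2]

def prz {m : ℕ} (F : Spc m → ℝ≥0∞) (x : Spc m) : ℝ≥0∞ := F (x + ((exists_rep x).choose : Lam m))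

lemma prz_eq {m : ℕ} (F : Spc m → ℝ≥0∞) {x : Spc m} {g : Lam m} (hg : x + g ∈ cube m) : prz F x = F (x + g) := by
  unfold prz
  set g' := (exists_rep x).choose
  have h' : x + (g' : Spc m) ∈ cube m := (exists_rep x).choose_spec
  have := uniq hg (g := g' - g) (by convert h' using 1; push_cast; abel)
  congr 1
  push_cast at this
  rw [sub_eq_zero] at this
  rw [this]

lemma prz_per {m : ℕ} (F : Spc m → ℝ≥0∞) : Per (prz F) := by
  intro g x
  obtain ⟨g', h'⟩ := exists_rep x
  rw [prz_eq F h', prz_eq F (g := g' - g) (by convert h' using 1; push_cast; abel)]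
  congr 1; push_cast; abel

lemma prz_int {m : ℕ} (F : Spc m → ℝ≥0∞) (h : Spc m) :
    ∫⁻ x in cube m, prz F (x + h) = ∫⁻ x in cube m, F x := by
  rw [lint_per (prz_per F) h]
  refine setLIntegral_congr_fun (meas_cube m) fun x hx => ?_
  have := prz_eq F (x := x) (g := 0) (by simpa using hx)
  simpa using this

lemma mor_pt {m : ℕ} {u : Spc m → ℝ} (hu : Differentiable ℝ u) (hper : Per u) (e : Spc m)
    (hi : IntegrableOn (pd e u) (cube m)) {p s : ℝ} (hp : 1 < p) (hs : (m:ℝ) + 1 < s * p) :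
    ∃ C > 0, ∀ x ∈ cube m, ∀ h, h ≠ 0 → ‖h‖ ≤ 1 →
      ‖dl h (pd e u) x‖ₑ ^ p ≤ ofReal (C * ‖h‖ ^ (s * p - (m + 1))) *
        (EE (pd e u) p (m + 1 + s * p) x ‖h‖ + prz (fun y => EE (pd e u) p (m + 1 + s * p) y ‖h‖) (x + h)) := by
  obtain ⟨C, hC, hM⟩ := morrey hu e hi hp hs
  have hper' := hper.pd e
  refine ⟨2 ^ (p - 1) * C, by positivity, fun x hx h h0 h1 => ?_⟩
  obtain ⟨g, hg⟩ := exists_rep (x + h)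
  obtain ⟨P, hP, hPg, d1, d2⟩ := geo hx h1 hg
  have hpos : 0 < ‖h‖ := norm_pos_iff.2 h0
  have A := hM x (cube_sub m hx) P hP ‖h‖ hpos h1 d1
  have B := hM (x + h + g) (cube_sub m hg) (P + g) hPg ‖h‖ hpos h1 (by rwa [add_sub_add_right_eq_sub])
  rw [hper' g, hper' g] at B
  rw [prz_eq _ hg]
  have t : ‖dl h (pd e u) x‖ₑ ≤ ‖pd e u x - pd e u P‖ₑ + ‖pd e u (x + h) - pd e u P‖ₑ := by
    rw [add_comm, dl, show pd e u (x + h) - pd e u x = (pd e u (x + h) - pd e u P) - (pd e u x - pd e u P) by ring]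
    exact enorm_sub_le
  calc _ ≤ (‖pd e u x - pd e u P‖ₑ + ‖pd e u (x + h) - pd e u P‖ₑ) ^ p := ENNReal.rpow_le_rpow t (by linarith)
    _ ≤ (2 : ℝ≥0∞) ^ (p - 1) * (‖pd e u x - pd e u P‖ₑ ^ p + ‖pd e u (x + h) - pd e u P‖ₑ ^ p) :=
      ENNReal.rpow_add_le_mul_rpow_add_rpow _ _ hp.le
    _ ≤ (2 : ℝ≥0∞) ^ (p - 1) * (ofReal (C * ‖h‖ ^ (s * p - (m + 1))) * EE (pd e u) p (m + 1 + s * p) x ‖h‖ +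
        ofReal (C * ‖h‖ ^ (s * p - (m + 1))) * EE (pd e u) p (m + 1 + s * p) (x + h + g) ‖h‖) := by gcongr
    _ = _ := by
      have e2 : (2 : ℝ≥0∞) ^ (p - 1) = ofReal (2 ^ (p - 1)) := by
        rw [← ofReal_rpow_of_pos (by norm_num)]; norm_num
      rw [← mul_add, ← mul_assoc, e2, ← ofReal_mul (by positivity), mul_assoc]

def TT {m : ℕ} (G : Spc m → ℝ) (p R : ℝ) : ℝ≥0∞ := ∫⁻ z in cube m, ∫⁻ w in cube m, kg G p R z w

lemma ind_le {m : ℕ} (R : ℝ) (x : Spc m) : (Metric.closedBall (0:Spc m) R).indicator (1 : Spc m → ℝ≥0∞) x ≤ 1 := by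
  by_cases h : x ∈ Metric.closedBall (0:Spc m) R
  · rw [indicator_of_mem h]; rfl
  · rw [indicator_of_notMem h]; exact zero_le

lemma EE_le {m : ℕ} (G : Spc m → ℝ) (p R : ℝ) (x : Spc m) (ρ : ℝ) : EE G p R x ρ ≤ TT G p R := by
  refine lintegral_mono fun z => lintegral_mono fun w => ?_
  refine (mul_le_mul' (ind_le _ _) (mul_le_mul' (ind_le _ _) le_rfl)).trans ?_
  simp

lemma kg_self {m : ℕ} (G : Spc m → ℝ) {p : ℝ} (hp : 0 < p) (R : ℝ) (z : Spc m) : kg G p R z z = 0 := by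
  simp [kg, Real.zero_rpow hp.ne']

lemma prz_le {m : ℕ} {F : Spc m → ℝ≥0∞} {C : ℝ≥0∞} (h : ∀ x, F x ≤ C) (x : Spc m) : prz F x ≤ C := h _

lemma mor_cont {m : ℕ} {u : Spc m → ℝ} (hu : Differentiable ℝ u) (hper : Per u) (e : Spc m)
    (hi : IntegrableOn (pd e u) (cube m)) {p s : ℝ} (hp : 1 < p) (hs : (m:ℝ) + 1 < s * p)
    (hT : TT (pd e u) p (m + 1 + s * p) < ⊤) : Continuous (pd e u) := by
  obtain ⟨C, hC, hM⟩ := mor_pt hu hper e hi hp hs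
  have hper' := hper.pd e
  have hp0 : 0 < p := by linarith
  set T := (TT (pd e u) p (m + 1 + s * p)).toReal with hTd
  have hTT : TT (pd e u) p (m + 1 + s * p) = ofReal T := (ofReal_toReal hT.ne).symm
  have hT0 : 0 ≤ T := ENNReal.toReal_nonneg
  set κ := s * p - (m + 1) with hκ
  have hκ0 : 0 < κ := by linarith
  have key : ∀ x h : Spc m, ‖h‖ ≤ 1 → |pd e u (x + h) - pd e u x| ≤ (C * ‖h‖ ^ κ * (T + T)) ^ (1/p) := by
    intro x h h1
    by_cases h0 : h = 0
    · rw [h0]; simp; positivity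
    obtain ⟨g, hg⟩ := exists_rep x
    have A := hM (x + g) hg h h0 h1
    have A2 : ‖dl h (pd e u) (x + g)‖ₑ ^ p ≤ ofReal (C * ‖h‖ ^ κ * (T + T)) := by
      refine A.trans ?_
      rw [ofReal_mul (q := T + T) (by positivity), ofReal_add hT0 hT0, ← hTT]
      gcongr
      · exact EE_le _ _ _ _ _
      · exact prz_le (fun y => EE_le _ _ _ _ _) _
    have e1 : dl h (pd e u) (x + g) = pd e u (x + h) - pd e u x := by
      rw [dl, add_right_comm, hper' g, hper' g]
    rw [e1, ← ofReal_norm, ofReal_rpow_of_nonneg (norm_nonneg _) hp0.le,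
      ofReal_le_ofReal_iff (by positivity)] at A2
    rw [one_div, Real.le_rpow_inv_iff_of_pos (abs_nonneg _) (by positivity) hp0]
    exact A2
  rw [continuous_iff_continuousAt]
  intro x
  have h2 : Tendsto (fun h : Spc m => (C * ‖h‖ ^ κ * (T + T)) ^ (1/p)) (𝓝 0) (𝓝 0) := by
    have : Continuous fun h : Spc m => (C * ‖h‖ ^ κ * (T + T)) ^ (1/p) := by
      refine Continuous.rpow_const ?_ fun _ => Or.inr (by positivity)
      have := (continuous_norm (E := Spc m)).rpow_const fun _ => Or.inr hκ0.le
      fun_prop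
    simpa [Real.zero_rpow hκ0.ne', Real.zero_rpow (inv_pos.2 hp0).ne'] using this.tendsto 0
  have h3 : Tendsto (fun h : Spc m => pd e u (x + h) - pd e u x) (𝓝 0) (𝓝 0) := by
    refine squeeze_zero_norm' ?_ h2
    filter_upwards [Metric.closedBall_mem_nhds (0 : Spc m) one_pos] with h hh
    exact key x h (by simpa using hh)
  have h4 := h3.comp (show Tendsto (fun y => y - x) (𝓝 x) (𝓝 0) by
    simpa using (continuous_id.sub continuous_const).tendsto (f := fun y => y - x) x)
  have h5 := h4.add_const (pd e u x)
  simp only [zero_add] at h5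
  refine h5.congr fun y => ?_
  simp

def JJ {m : ℕ} (G : Spc m → ℝ) (p R ρ : ℝ) (z : Spc m) : ℝ≥0∞ :=
  ∫⁻ w in cube m, (Metric.closedBall (0:Spc m) (3 * ρ)).indicator 1 (z - w) * kg G p R z w

lemma JJ_meas {m : ℕ} {G : Spc m → ℝ} (hG : Measurable G) (p R ρ : ℝ) : Measurable (JJ G p R ρ) := by
  have : Measurable fun q : Spc m × Spc m =>
      (Metric.closedBall (0:Spc m) (3 * ρ)).indicator (1 : Spc m → ℝ≥0∞) (q.1 - q.2) * kg G p R q.1 q.2 :=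
    Measurable.mul ((ind_meas (3 * ρ)).comp (measurable_fst.sub measurable_snd)) (kg_meas hG p R)
  exact this.lintegral_prod_right'

lemma EE_int {m : ℕ} {G : Spc m → ℝ} (hG : Measurable G) (p R : ℝ) {ρ : ℝ} (hρ : 0 < ρ) :
    ∫⁻ x in cube m, EE G p R x ρ ≤ ofReal ((2 * ρ) ^ (m+1)) * volume (Metric.ball (0 : Spc m) 1) *
      ∫⁻ z in cube m, JJ G p R ρ z := by
  set I : Spc m → ℝ≥0∞ := (Metric.closedBall (0:Spc m) (2 * ρ)).indicator 1 with hI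
  have hIm : Measurable I := ind_meas _
  have e1 : ∀ x, EE G p R x ρ = ∫⁻ z in cube m, I (x - z) * JJ G p R ρ z := by
    intro x
    refine lintegral_congr fun z => ?_
    refine lintegral_const_mul' _ _ ?_
    exact ((ind_le _ _).trans_lt ENNReal.one_lt_top).ne
  simp_rw [e1]
  rw [lintegral_lintegral_swap]
  · have hv : volume (Metric.closedBall (0 : Spc m) (2 * ρ)) =
        ofReal ((2 * ρ) ^ (m+1)) * volume (Metric.ball (0 : Spc m) 1) := by
      rw [Measure.addHaar_closedBall _ _ (by positivity), finrank_spc]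
    rw [← hv, ← lintegral_const_mul _ (JJ_meas hG p R ρ)]
    refine lintegral_mono fun z => ?_
    have hz : Measurable fun x => I (x - z) := hIm.comp (measurable_id.sub_const z)
    rw [lintegral_mul_const _ hz]
    gcongr
    refine (setLIntegral_le_lintegral _ _).trans ?_
    rw [lintegral_sub_right_eq_self I z, hI, lintegral_indicator_one Metric.isClosed_closedBall.measurableSet]
  · refine Measurable.aemeasurable ?_
    exact Measurable.mul (hIm.comp (measurable_fst.sub measurable_snd)) ((JJ_meas hG p R ρ).comp measurable_snd)

def rk {m : ℕ} (r d : ℝ) (h : Spc m) : ℝ≥0∞ := if d ≤ 3 * ‖h‖ then ofReal (‖h‖ ^ (-r)) else 0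

lemma rk_meas {m : ℕ} (r : ℝ) {α : Type*} [MeasurableSpace α] {d : α → ℝ} {h : α → Spc m}
    (hd : Measurable d) (hh : Measurable h) : Measurable fun q => rk r (d q) (h q) := by
  unfold rk
  refine Measurable.ite (measurableSet_le hd (by fun_prop)) (by fun_prop) measurable_const

lemma rad_out (m : ℕ) {ε : ℝ} (hε : 0 < ε) : ∃ c < (⊤ : ℝ≥0∞), ∀ d : ℝ, 0 < d →
    ∫⁻ h : Spc m, rk (m + 1 + ε) d h ≤ ofReal (d ^ (-ε)) * c := by
  set r : ℝ := m + 1 + ε with hr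
  have hr0 : 0 < r := by positivity
  refine ⟨∫⁻ h : Spc m, rk r 1 h, ?_, fun d hd => ?_⟩
  · have hf : ∫⁻ x : Spc m, ofReal ((1 + ‖x‖) ^ (-r)) < ⊤ :=
      finite_integral_one_add_norm (by rw [finrank_spc]; push_cast; linarith)
    refine lt_of_le_of_lt ?_ (ENNReal.mul_lt_top (ofReal_lt_top (r := 4 ^ r)) hf)
    rw [← lintegral_const_mul' _ _ ofReal_ne_top]
    refine lintegral_mono fun h => ?_
    rw [rk]
    split_ifs with h1
    · rw [← ofReal_mul (by positivity)]
      refine ofReal_le_ofReal ?_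
      have h0 : 0 < ‖h‖ := by linarith
      rw [Real.rpow_neg h0.le, Real.rpow_neg (by positivity), ← div_eq_mul_inv, inv_eq_one_div,
        div_le_div_iff₀ (by positivity) (by positivity), one_mul, ← Real.mul_rpow (by norm_num) h0.le]
      exact Real.rpow_le_rpow (by positivity) (by linarith) hr0.le
    · exact zero_le
  · have h1 := lint_scale (m := m) 0 hd (f := rk r d) (rk_meas r measurable_const measurable_id)
    have h2 : ∀ u : Spc m, rk r d (0 + d • u) = ofReal (d ^ (-r)) * rk r 1 u := by
      intro u
      rw [zero_add, rk, rk, norm_smul, Real.norm_of_nonneg hd.le]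
      by_cases h3 : 1 ≤ 3 * ‖u‖
      · rw [if_pos h3, if_pos (by nlinarith), ← ofReal_mul (by positivity), Real.mul_rpow hd.le (norm_nonneg _)]
      · rw [if_neg h3, if_neg (by push Not at *; nlinarith), mul_zero]
    simp_rw [h2] at h1
    rw [lintegral_const_mul' _ _ ofReal_ne_top] at h1
    have h3 : ofReal (d ^ (m+1)) * ofReal (d ^ (m+1))⁻¹ = 1 := by
      rw [← ofReal_mul (by positivity), mul_inv_cancel₀ (by positivity), ofReal_one]
    have h4 : ∫⁻ h : Spc m, rk r d h = ofReal (d ^ (m+1)) * (ofReal (d ^ (m+1))⁻¹ * ∫⁻ h : Spc m, rk r d h) := by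
      rw [← mul_assoc, h3, one_mul]
    rw [h4, ← h1, ← mul_assoc, ← ofReal_mul (by positivity)]
    refine le_of_eq ?_
    congr 2
    rw [← Real.rpow_natCast, ← Real.rpow_add hd, hr]
    congr 1; push_cast; ring

lemma rad_in (m : ℕ) {ε : ℝ} (hε : 0 < ε) :
    ∫⁻ h in Metric.closedBall (0 : Spc m) 1, ofReal (‖h‖ ^ (ε - (m + 1))) < ⊤ := by
  set f : ℝ → ℝ := (Iic 1).indicator fun y => y ^ (ε - (m + 1)) with hf
  have h1 : Integrable (fun x : Spc m => f ‖x‖) := by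
    rw [integrable_fun_norm_addHaar, finrank_spc]
    have h2 : IntegrableOn (fun y : ℝ => y ^ (ε - 1)) (Ioc 0 1) :=
      (intervalIntegrable_iff_integrableOn_Ioc_of_le zero_le_one).1
        (intervalIntegral.intervalIntegrable_rpow' (by linarith))
    have h3 : IntegrableOn ((Iic 1).indicator fun y : ℝ => y ^ (ε - 1)) (Ioi 0) := by
      rw [integrableOn_indicator_iff measurableSet_Iic, inter_comm, Ioi_inter_Iic]; exact h2
    refine h3.congr_fun (fun y hy => ?_) measurableSet_Ioi
    have hy0 : (0:ℝ) < y := hy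
    simp only [hf, indicator]
    split_ifs
    · simp only [add_tsub_cancel_right, smul_eq_mul]
      rw [← Real.rpow_natCast, ← Real.rpow_add hy0]; congr 1; ring
    · simp
  have h2 := h1.2
  refine lt_of_le_of_lt ?_ h2
  rw [← lintegral_indicator Metric.isClosed_closedBall.measurableSet]
  refine lintegral_mono fun h => ?_
  by_cases hh : h ∈ Metric.closedBall (0 : Spc m) 1
  · rw [indicator_of_mem hh, ← ofReal_norm]
    have : ‖h‖ ∈ Iic (1:ℝ) := by simpa using hh
    have e : f ‖h‖ = ‖h‖ ^ (ε - (m + 1)) := by rw [hf, indicator_of_mem this]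
    show _ ≤ ofReal ‖f ‖h‖‖
    rw [e, Real.norm_of_nonneg (by positivity)]
  · rw [indicator_of_notMem hh]; exact zero_le

lemma mor_int {m : ℕ} {u : Spc m → ℝ} (hu : Differentiable ℝ u) (hper : Per u) (e : Spc m)
    (hi : IntegrableOn (pd e u) (cube m)) {p s s1 : ℝ} (hp : 1 < p) (hs : (m:ℝ) + 1 < s * p) (hs1 : s < s1)
    (hT : TT (pd e u) p (m + 1 + s1 * p) < ⊤) :
    ∫⁻ h in Metric.closedBall (0 : Spc m) 1, ofReal (‖h‖ ^ (-(m + 1 + s1 * p))) *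
      ∫⁻ x in cube m, ‖dl h (pd e u) x‖ₑ ^ p < ⊤ := by
  obtain ⟨C, hC, hM⟩ := mor_pt hu hper e hi hp hs
  set G := pd e u with hG
  have hGm : Measurable G := Ctx.pd_meas u e
  have hp0 : 0 < p := by linarith
  set R : ℝ := m + 1 + s * p with hR
  set ε := (s1 - s) * p with hε
  have hε0 : 0 < ε := mul_pos (by linarith) hp0
  obtain ⟨c, hc, hrad⟩ := rad_out m hε0
  set v := volume (Metric.ball (0 : Spc m) 1) with hv
  have hvt : v < ⊤ := Metric.isBounded_ball.measure_lt_top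
  set K := ofReal (C * (2 * 2 ^ (m+1))) * v with hK
  have hKt : K < ⊤ := ENNReal.mul_lt_top ofReal_lt_top hvt
  have b1 : ∀ h : Spc m, ‖h‖ ≤ 1 → h ≠ 0 → ofReal (‖h‖ ^ (-(m + 1 + s1 * p))) * ∫⁻ x in cube m, ‖dl h G x‖ₑ ^ p
      ≤ K * ∫⁻ z in cube m, ∫⁻ w in cube m, rk (m + 1 + ε) ‖z - w‖ h * kg G p R z w := by
    intro h h1 h0
    have hpos : 0 < ‖h‖ := norm_pos_iff.2 h0
    have e1 : ∫⁻ x in cube m, ‖dl h G x‖ₑ ^ p ≤ ofReal (C * ‖h‖ ^ (s * p - (m + 1))) *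
        (2 * ∫⁻ x in cube m, EE G p R x ‖h‖) := by
      refine (setLIntegral_mono' (meas_cube m) fun x hx => hM x hx h h0 h1).trans ?_
      rw [lintegral_const_mul' _ _ ofReal_ne_top, lintegral_add_left (EE_meas hGm p R ‖h‖), prz_int, two_mul]
    have e2 := EE_int hGm p R hpos
    have e3 : ofReal (‖h‖ ^ (-(m + 1 + s1 * p))) * (ofReal (C * ‖h‖ ^ (s * p - (m + 1))) *
        (2 * (ofReal ((2 * ‖h‖) ^ (m+1)) * v))) = K * ofReal (‖h‖ ^ (-(m + 1 + ε))) := by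
      have two : (2 : ℝ≥0∞) = ofReal 2 := by norm_num
      rw [hK, two, mul_right_comm, ← mul_assoc, ← mul_assoc, ← mul_assoc, ← ofReal_mul (by positivity),
        ← ofReal_mul (by positivity), ← ofReal_mul (by positivity), ← ofReal_mul (by positivity)]
      congr 2
      have e4 : ‖h‖ ^ (-(m + 1 + ε)) = ‖h‖ ^ (-(m + 1 + s1 * p)) * ‖h‖ ^ (s * p - (m + 1)) * ‖h‖ ^ (m + 1) := by
        rw [← Real.rpow_natCast, ← Real.rpow_add hpos, ← Real.rpow_add hpos]
        congr 1; push_cast; rw [hε]; ring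
      rw [e4, mul_pow]; ring
    have e5 : ofReal (‖h‖ ^ (-(m + 1 + ε))) * ∫⁻ z in cube m, JJ G p R ‖h‖ z =
        ∫⁻ z in cube m, ∫⁻ w in cube m, rk (m + 1 + ε) ‖z - w‖ h * kg G p R z w := by
      rw [← lintegral_const_mul' _ _ ofReal_ne_top]
      refine lintegral_congr fun z => ?_
      rw [JJ, ← lintegral_const_mul' _ _ ofReal_ne_top]
      refine lintegral_congr fun w => ?_
      rw [rk]
      split_ifs with h3
      · rw [indicator_of_mem (by simpa using h3)]; simp
      · rw [indicator_of_notMem (by simpa using h3)]; simp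
    calc _ ≤ ofReal (‖h‖ ^ (-(m + 1 + s1 * p))) * (ofReal (C * ‖h‖ ^ (s * p - (m + 1))) *
        (2 * (ofReal ((2 * ‖h‖) ^ (m+1)) * v * ∫⁻ z in cube m, JJ G p R ‖h‖ z))) := by
          refine mul_le_mul' le_rfl (e1.trans ?_)
          gcongr
      _ = (ofReal (‖h‖ ^ (-(m + 1 + s1 * p))) * (ofReal (C * ‖h‖ ^ (s * p - (m + 1))) *
        (2 * (ofReal ((2 * ‖h‖) ^ (m+1)) * v)))) * ∫⁻ z in cube m, JJ G p R ‖h‖ z := by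
          simp only [mul_assoc]
      _ = _ := by rw [e3, mul_assoc, e5]
  have hae : ∀ᵐ h : Spc m, h ≠ 0 := by
    rw [ae_iff]
    have : {a : Spc m | ¬ a ≠ 0} = {0} := by ext; simp
    rw [this]; exact measure_singleton 0
  have b2 : ∫⁻ h in Metric.closedBall (0 : Spc m) 1, ofReal (‖h‖ ^ (-(m + 1 + s1 * p))) *
      ∫⁻ x in cube m, ‖dl h G x‖ₑ ^ p ≤
      ∫⁻ h : Spc m, K * ∫⁻ z in cube m, ∫⁻ w in cube m, rk (m + 1 + ε) ‖z - w‖ h * kg G p R z w := by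
    refine le_trans ?_ (setLIntegral_le_lintegral (Metric.closedBall (0 : Spc m) 1) _)
    refine lintegral_mono_ae ?_
    filter_upwards [ae_restrict_mem Metric.isClosed_closedBall.measurableSet, ae_restrict_of_ae hae] with h h1 h0
    exact b1 h (by simpa using h1) h0
  refine b2.trans_lt ?_
  rw [lintegral_const_mul' _ _ hKt.ne]
  refine ENNReal.mul_lt_top hKt ?_
  have kgm : ∀ {α : Type} [MeasurableSpace α] {b c : α → Spc m} (_ : Measurable b) (_ : Measurable c),
      Measurable fun q => kg G p R (b q) (c q) := by
    intro α _ b c hb hc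
    unfold kg; fun_prop
  have M3 : Measurable fun q : (Spc m × Spc m) × Spc m => rk (m + 1 + ε) ‖q.1.2 - q.2‖ q.1.1 * kg G p R q.1.2 q.2 := by
    have h1 : Measurable fun q : (Spc m × Spc m) × Spc m => rk (m + 1 + ε) ‖q.1.2 - q.2‖ q.1.1 :=
      rk_meas _ (by fun_prop) (by fun_prop)
    have h2 : Measurable fun q : (Spc m × Spc m) × Spc m => kg G p R q.1.2 q.2 := kgm (by fun_prop) (by fun_prop)
    exact h1.mul h2
  have M2 : Measurable fun q : Spc m × Spc m => ∫⁻ w in cube m, rk (m + 1 + ε) ‖q.2 - w‖ q.1 * kg G p R q.2 w :=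
    M3.lintegral_prod_right'
  rw [lintegral_lintegral_swap M2.aemeasurable]
  have b3 : ∀ z ∈ cube m, ∫⁻ h : Spc m, ∫⁻ w in cube m, rk (m + 1 + ε) ‖z - w‖ h * kg G p R z w ≤
      c * ∫⁻ w in cube m, kg G p (m + 1 + s1 * p) z w := by
    intro z hz
    have M1 : Measurable fun q : Spc m × Spc m => rk (m + 1 + ε) ‖z - q.2‖ q.1 * kg G p R z q.2 := by
      have h1 : Measurable fun q : Spc m × Spc m => rk (m + 1 + ε) ‖z - q.2‖ q.1 :=
        rk_meas _ (by fun_prop) (by fun_prop)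
      have h2 : Measurable fun q : Spc m × Spc m => kg G p R z q.2 := kgm (by fun_prop) (by fun_prop)
      exact h1.mul h2
    rw [lintegral_lintegral_swap M1.aemeasurable, ← lintegral_const_mul' _ _ hc.ne]
    refine lintegral_mono fun w => ?_
    have h1 : Measurable fun h : Spc m => rk (m + 1 + ε) ‖z - w‖ h := rk_meas _ (by fun_prop) (by fun_prop)
    rw [lintegral_mul_const _ h1]
    by_cases hzw : z = w
    · rw [hzw, kg_self G hp0]; simp
    · have h0 : 0 < ‖z - w‖ := norm_pos_iff.2 (sub_ne_zero.2 hzw)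
      refine (mul_le_mul' (hrad _ h0) le_rfl).trans (le_of_eq ?_)
      rw [mul_comm _ c, mul_assoc, kg, kg, ← ofReal_mul (by positivity)]
      congr 2
      rw [show (m:ℝ) + 1 + s1 * p = R + ε by rw [hR, hε]; ring, Real.rpow_add (y := R) (z := ε) h0, Real.rpow_neg h0.le, inv_mul_eq_div, div_div]
  refine (setLIntegral_mono' (meas_cube m) b3).trans_lt ?_
  rw [lintegral_const_mul' _ _ hc.ne]
  exact ENNReal.mul_lt_top hc hT

lemma lint_np {m : ℕ} {p : ℝ} (hp : 0 < p) {f : Spc m → ℝ}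
    (hf : MemLp f (ofReal p) (volume.restrict (cube m))) :
    ∫⁻ x in cube m, ‖f x‖ₑ ^ p = ofReal (np p f) ^ p := by
  rw [← LpN_eq hp hf, LpN, μT, eLpNorm_eq_lintegral_rpow_enorm_toReal (by simpa using hp) (by simp),
    ENNReal.toReal_ofReal hp.le, ← ENNReal.rpow_mul, one_div, inv_mul_cancel₀ hp.ne', ENNReal.rpow_one]

lemma gagl_le {m : ℕ} {p R : ℝ} (hp : 1 ≤ p) (u : Spc m → ℝ) :
    ∫⁻ x in cube m, ∫⁻ y in cube m, ofReal (‖grd u x - grd u y‖ ^ p / ‖x - y‖ ^ R) ≤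
      ofReal ((m + 1) ^ (p - 1)) * ∑ k, TT (pd (dir k) u) p R := by
  have h1 : ∀ x y : Spc m, ofReal (‖grd u x - grd u y‖ ^ p / ‖x - y‖ ^ R) ≤
      ofReal ((m + 1) ^ (p - 1)) * ∑ k, kg (pd (dir k) u) p R x y := by
    intro x y
    unfold kg
    rw [← ofReal_sum_of_nonneg fun _ _ => by positivity, ← ofReal_mul (by positivity),
      ← Finset.sum_div, ← mul_div_assoc]
    refine ofReal_le_ofReal (div_le_div_of_nonneg_right ?_ (by positivity))
    have h2 := Real.rpow_sum_le_const_mul_sum_rpow (Finset.univ : Finset (Option (Fin m)))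
      (fun k => pd (dir k) u x - pd (dir k) u y) hp
    simp only [Finset.card_univ, Fintype.card_option, Fintype.card_fin, Nat.cast_add, Nat.cast_one] at h2
    refine le_trans ?_ h2
    exact Real.rpow_le_rpow (norm_nonneg _) (clm_norm_le (grd u x - grd u y)) (by linarith)
  have km : ∀ k : Option (Fin m), Measurable fun q : Spc m × Spc m => kg (pd (dir k) u) p R q.1 q.2 := by
    intro k
    have := Ctx.pd_meas u (dir k)
    unfold kg; fun_prop
  refine (lintegral_mono fun x => lintegral_mono fun y => h1 x y).trans (le_of_eq ?_)
  have h3 : ∀ x : Spc m, ∫⁻ y in cube m, ofReal ((m + 1) ^ (p - 1)) * ∑ k, kg (pd (dir k) u) p R x y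
      = ofReal ((m + 1) ^ (p - 1)) * ∑ k, ∫⁻ y in cube m, kg (pd (dir k) u) p R x y := by
    intro x
    rw [lintegral_const_mul' _ _ ofReal_ne_top, lintegral_finsetSum]
    intro k _
    have := Ctx.pd_meas u (dir k)
    unfold kg; fun_prop
  simp_rw [h3]
  rw [lintegral_const_mul' _ _ ofReal_ne_top, lintegral_finsetSum]
  · rfl
  · exact fun k _ => (km k).lintegral_prod_right'

lemma TT_dl {m : ℕ} {p R : ℝ} (hp : 0 < p) {G : Spc m → ℝ} (hG : Measurable G) :
    TT G p R ≤ ∫⁻ h in Metric.closedBall (0 : Spc m) 1, ofReal (‖h‖ ^ (-R)) *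
      ∫⁻ x in cube m, ‖dl h G x‖ₑ ^ p := by
  have h1 : ∀ z ∈ cube m, ∫⁻ w in cube m, kg G p R z w ≤
      ∫⁻ h in Metric.closedBall (0 : Spc m) 1, ofReal (‖h‖ ^ (-R)) * ‖dl h G z‖ₑ ^ p := by
    intro z hz
    rw [← lintegral_indicator (meas_cube m), ← lintegral_indicator Metric.isClosed_closedBall.measurableSet,
      ← lintegral_add_left_eq_self _ z]
    refine lintegral_mono fun h => ?_
    by_cases hh : z + h ∈ cube m
    · have : h ∈ Metric.closedBall (0 : Spc m) 1 := by
        have := Kdist (cube_sub m hz) (cube_sub m hh)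
        simpa using this
      rw [indicator_of_mem hh, indicator_of_mem this, kg, ← ofReal_norm,
        ofReal_rpow_of_nonneg (norm_nonneg _) hp.le, ← ofReal_mul (by positivity),
        Real.rpow_neg (norm_nonneg _), dl, Real.norm_eq_abs, abs_sub_comm, sub_add_cancel_left, norm_neg, div_eq_inv_mul]
    · rw [indicator_of_notMem hh]; exact zero_le
  refine (setLIntegral_mono' (meas_cube m) h1).trans (le_of_eq ?_)
  rw [lintegral_lintegral_swap]
  · exact lintegral_congr fun h => lintegral_const_mul' _ _ ofReal_ne_top
  · have : Measurable fun q : Spc m × Spc m => G (q.1 + q.2) := hG.comp (by fun_prop)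
    have h3 : Measurable fun q : Spc m × Spc m => ‖dl q.2 G q.1‖ₑ ^ p := by
      unfold dl; fun_prop
    have h4 : Measurable fun q : Spc m × Spc m => ofReal (‖q.2‖ ^ (-R)) := by fun_prop
    exact (h4.mul h3).aemeasurable

lemma mz_bd {m : ℕ} {p : ℝ} (hp : 1 < p) {G : Spc m → ℝ} (hG : Measurable G) (hper : Per G)
    (hi : IntegrableOn G (cube m)) (h0 : ∫ x in cube m, G x = 0) {A : ℝ≥0∞}
    (hA : ∀ h : Spc m, ‖h‖ ≤ 1 → ∫⁻ x in cube m, ‖dl h G x‖ₑ ^ p ≤ A) : ∫⁻ x in cube m, ‖G x‖ₑ ^ p ≤ A := by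
  have hpr : IsProbabilityMeasure (volume.restrict (cube m)) := instProbT m
  have hp0 : 0 < p := by linarith
  have hm : Measurable fun q : Spc m × Spc m => ‖dl q.2 G q.1‖ₑ := by
    have : Measurable fun q : Spc m × Spc m => G (q.1 + q.2) := hG.comp (by fun_prop)
    unfold dl; fun_prop
  have h1 : ∀ x, ‖G x‖ₑ ^ p ≤ ∫⁻ h in cube m, ‖dl h G x‖ₑ ^ p := by
    intro x
    have e1 : ∫ h in cube m, dl h G x = - G x := by
      unfold dl
      have i1 : IntegrableOn (fun h => G (x + h)) (cube m) := by
        have h5 := memLp_shift (r := 1) (by simp) hper hG (memLp_one_iff_integrable.2 hi) x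
        simp_rw [add_comm x]
        exact memLp_one_iff_integrable.1 h5
      rw [integral_sub i1 (integrable_const _)]
      have : ∫ h in cube m, G (x + h) = 0 := by
        simp_rw [add_comm x]; rw [int_per hper x, h0]
      rw [this]; simp
    have e2 : ‖G x‖ₑ ≤ ∫⁻ h in cube m, ‖dl h G x‖ₑ := by
      have := enorm_integral_le_lintegral_enorm (μ := volume.restrict (cube m)) fun h => dl h G x
      rwa [e1, enorm_neg] at this
    exact (ENNReal.rpow_le_rpow e2 hp0.le).trans (jen _ hp (hm.comp measurable_prodMk_left).aemeasurable)
  refine (lintegral_mono h1).trans ?_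
  rw [lintegral_lintegral_swap (hm.pow_const p).aemeasurable]
  calc _ ≤ ∫⁻ h in cube m, A := setLIntegral_mono' (meas_cube m) fun h hh => hA h (by
        have := Kdist (a := 0) ⟨le_rfl, zero_le_one⟩ (cube_sub m hh)
        simpa using this)
    _ = A := by simp

namespace Ctx
variable {m : ℕ} {V : Spc m → ℝ} {β σ p : ℝ} {ψ0 : Spc m → ℝ} {Tmax : ℝ≥0∞} {ψ : ℝ → Spc m → ℝ}

lemma TT0 (H : Ctx m V β σ p ψ0 Tmax ψ) (k : Option (Fin m)) : TT (pd (dir k) ψ0) p (m + 1 + (σ - 1) * p) < ⊤ := by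
  have h := H.h1.1.1.2.2.2.2
  rw [H.WN] at h
  have h2 : gagl (σ - 1) p (grd ψ0) < ⊤ := lt_of_le_of_lt le_add_self h
  have hp0 := H.p0
  rw [gagl, ENNReal.rpow_lt_top_iff_of_pos (by positivity)] at h2
  refine lt_of_le_of_lt ?_ h2
  refine lintegral_mono fun x => lintegral_mono fun y => ?_
  refine ofReal_le_ofReal (div_le_div_of_nonneg_right (Real.rpow_le_rpow (abs_nonneg _) ?_ hp0.le) (by positivity))
  have := (grd ψ0 x - grd ψ0 y).le_opNorm (dir k)
  exact this.trans (mul_le_of_le_one_right (norm_nonneg _) (norm_dir k))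

lemma sp (H : Ctx m V β σ p ψ0 Tmax ψ) : ∃ s, (m:ℝ) + 1 < s * p ∧ s < σ - 1 := by
  have h := H.h2.2.2.1
  obtain ⟨s, h1, h3⟩ := exists_between (show ((m:ℝ) + 1) / p < σ - 1 by linarith)
  exact ⟨s, (div_lt_iff₀ H.p0).1 h1, h3⟩

lemma psi0_C1 (H : Ctx m V β σ p ψ0 Tmax ψ) : ContDiff ℝ 1 ψ0 := by
  obtain ⟨s, h1, h3⟩ := H.sp
  have hk : ∀ k, Continuous (pd (dir k) ψ0) := fun k =>
    mor_cont H.diff0 H.per0 (dir k) (memLp_int H.p1.le (H.pd0_memLp _)) H.p1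
      (h1.trans (mul_lt_mul_of_pos_right h3 H.p0)) (H.TT0 k)
  refine contDiff_one_iff_fderiv.2 ⟨H.diff0, ?_⟩
  rw [continuous_iff_continuousAt]
  intro x
  rw [ContinuousAt, tendsto_iff_norm_sub_tendsto_zero]
  have h4 : Tendsto (fun y => ∑ k, |pd (dir k) ψ0 y - pd (dir k) ψ0 x|) (𝓝 x) (𝓝 0) := by
    have : Continuous fun y => ∑ k, |pd (dir k) ψ0 y - pd (dir k) ψ0 x| :=
      continuous_finsetSum _ fun k _ => ((hk k).sub continuous_const).abs
    simpa using this.tendsto x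
  exact squeeze_zero (fun _ => norm_nonneg _) (fun y => clm_norm_le (fderiv ℝ ψ0 y - fderiv ℝ ψ0 x)) h4

lemma partb (H : Ctx m V β σ p ψ0 Tmax ψ) : ∃ K : ℝ≥0∞, K < ⊤ ∧ ∀ t ∈ Ioo0 Tmax, WNorm σ p (ψ t) ≤ K := by
  obtain ⟨s, hs, hs3⟩ := H.sp
  have hp0 := H.p0
  have hp1 := H.p1
  have hsig := H.sig1
  have hsig2 := H.h2.2.2.2
  obtain ⟨s', hs1, hs2⟩ := exists_between (show σ - 1 < 1 by linarith)
  obtain ⟨C, hC, hE⟩ := H.E3 (show 0 < s' by linarith) hs2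
  obtain ⟨S, hS, hS1, -⟩ := H.np_psi
  set R : ℝ := m + 1 + (σ - 1) * p with hR
  have hR0 : 0 < R := by have : 0 < (σ - 1) * p := mul_pos (by linarith) hp0
                         positivity
  set I0 : Option (Fin m) → ℝ≥0∞ := fun k => ∫⁻ h in Metric.closedBall (0 : Spc m) 1, ofReal (‖h‖ ^ (-R)) *
      ∫⁻ x in cube m, ‖dl h (pd (dir k) ψ0) x‖ₑ ^ p with hI0
  have hI0t : ∀ k, I0 k < ⊤ := fun k =>
    mor_int H.diff0 H.per0 (dir k) (memLp_int hp1.le (H.pd0_memLp _)) hp1 hs hs3 (H.TT0 k)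
  have hε : 0 < (s' - (σ - 1)) * p := mul_pos (by linarith) hp0
  set I1 : ℝ≥0∞ := ∫⁻ h in Metric.closedBall (0 : Spc m) 1, ofReal (‖h‖ ^ ((s' - (σ - 1)) * p - (m + 1))) with hI1
  have hI1t : I1 < ⊤ := rad_in m hε
  set D : ℝ≥0∞ := ofReal C ^ p * 2 ^ (p - 1) with hD
  have hDt : D < ⊤ := ENNReal.mul_lt_top (ENNReal.rpow_lt_top_of_nonneg hp0.le ofReal_ne_top)
    (ENNReal.rpow_lt_top_of_nonneg (by linarith) (by simp))
  have mem0 : ∀ k (h : Spc m), MemLp (dl h (pd (dir k) ψ0)) (ofReal p) (volume.restrict (cube m)) :=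
    fun k h => (memLp_shift ofReal_ne_top (H.per0.pd _) (pd_meas _ _) (H.pd0_memLp (dir k)) h).sub
      (H.pd0_memLp (dir k))
  have key : ∀ t ∈ Ioo0 Tmax, ∀ k (h : Spc m), ‖h‖ ≤ 1 → ∫⁻ x in cube m, ‖dl h (pd (dir k) (ψ t)) x‖ₑ ^ p ≤
      D * ((∫⁻ x in cube m, ‖dl h (pd (dir k) ψ0) x‖ₑ ^ p) + ofReal (‖h‖ ^ s') ^ p) := by
    intro t ht k h hh
    have sn := H.snap ht
    rw [lint_np hp0 (per_memLp ((sn.per.pd _).dl h) (cont_dl (C1_pd_cont sn.c1 _) h) _), lint_np hp0 (mem0 k h)]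
    refine (ENNReal.rpow_le_rpow (ofReal_le_ofReal (hE t ht k h hh)) hp0.le).trans ?_
    rw [ofReal_mul hC.le, ofReal_add (np_nonneg _ _) (by positivity),
      ENNReal.mul_rpow_of_nonneg _ _ hp0.le, hD, mul_assoc]
    exact mul_le_mul' le_rfl (ENNReal.rpow_add_le_mul_rpow_add_rpow _ _ hp1.le)
  have kT : ∀ t ∈ Ioo0 Tmax, ∀ k, TT (pd (dir k) (ψ t)) p R ≤ D * (I0 k + I1) := by
    intro t ht k
    refine (TT_dl hp0 (pd_meas _ _)).trans ?_
    have hm1 : Measurable fun h : Spc m => ofReal (‖h‖ ^ ((s' - (σ - 1)) * p - (m + 1))) := by fun_prop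
    rw [hI0, hI1, ← lintegral_add_right _ hm1, ← lintegral_const_mul' _ _ hDt.ne]
    refine setLIntegral_mono' Metric.isClosed_closedBall.measurableSet fun h hh => ?_
    refine (mul_le_mul' le_rfl (key t ht k h (by simpa using hh))).trans ?_
    rw [mul_left_comm]
    refine mul_le_mul' le_rfl ?_
    rw [mul_add]
    refine add_le_add le_rfl ?_
    rw [ofReal_rpow_of_nonneg (by positivity) hp0.le, ← ofReal_mul (by positivity)]
    refine ofReal_le_ofReal ?_
    by_cases h0 : h = 0
    · rw [h0, norm_zero, Real.zero_rpow (by linarith), zero_mul]; positivity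
    · have hpos : 0 < ‖h‖ := norm_pos_iff.2 h0
      rw [← Real.rpow_mul hpos.le, ← Real.rpow_add hpos]
      refine le_of_eq ?_
      congr 1; rw [hR]; ring
  set A : Option (Fin m) → ℝ≥0∞ := fun k => D * (ofReal (2 * np p (pd (dir k) ψ0)) ^ p + 1) with hA
  have hAt : ∀ k, A k < ⊤ := fun k => ENNReal.mul_lt_top hDt (ENNReal.add_lt_top.2
    ⟨ENNReal.rpow_lt_top_of_nonneg hp0.le ofReal_ne_top, by simp⟩)
  have kA : ∀ t ∈ Ioo0 Tmax, ∀ k, ∫⁻ x in cube m, ‖pd (dir k) (ψ t) x‖ₑ ^ p ≤ A k := by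
    intro t ht k
    have sn := H.snap ht
    have ii := per_int (sn.per.pd (dir k)) (C1_pd_cont sn.c1 _)
    refine mz_bd hp1 (pd_meas _ _) (sn.per.pd _) ii (ibp0 sn.per sn.diff _ ii) fun h hh => (key t ht k h hh).trans ?_
    rw [hA, lint_np hp0 (mem0 k h)]
    refine mul_le_mul' le_rfl (add_le_add (ENNReal.rpow_le_rpow (ofReal_le_ofReal
      (np_dl_le hp1.le (H.per0.pd _) (pd_meas _ _) (H.pd0_memLp _) h)) hp0.le) ?_)
    refine ENNReal.rpow_le_one (ofReal_le_one.2 (Real.rpow_le_one (norm_nonneg _) hh (by linarith))) hp0.le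
  set B : ℝ≥0∞ := ofReal ((m + 1) ^ (p - 1)) * ∑ k, D * (I0 k + I1) with hB
  have hBt : B < ⊤ := ENNReal.mul_lt_top ofReal_lt_top (ENNReal.sum_lt_top.2 fun k _ =>
    ENNReal.mul_lt_top hDt (ENNReal.add_lt_top.2 ⟨hI0t k, hI1t⟩))
  refine ⟨ofReal S + ∑ k, A k ^ (1/p) + B ^ (1/p), ?_, fun t ht => ?_⟩
  · refine ENNReal.add_lt_top.2 ⟨ENNReal.add_lt_top.2 ⟨ofReal_lt_top, ENNReal.sum_lt_top.2 fun k _ => ?_⟩, ?_⟩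
    · exact ENNReal.rpow_lt_top_of_nonneg (by positivity) (hAt k).ne
    · exact ENNReal.rpow_lt_top_of_nonneg (by positivity) hBt.ne
  · have sn := H.snap ht
    rw [H.WN]
    refine add_le_add (add_le_add ?_ ?_) ?_
    · rw [LpN_eq hp0 (per_memLp sn.per sn.diff.continuous _)]
      exact ofReal_le_ofReal (hS1 t ⟨ht.1.le, ht.2⟩)
    · have e1 : eLpNorm (fun x => ‖grd (ψ t) x‖) (ofReal p) (μT m) ≤
          eLpNorm (∑ k, fun x => |pd (dir k) (ψ t) x|) (ofReal p) (μT m) := by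
        refine eLpNorm_mono fun x => ?_
        rw [norm_norm, Finset.sum_apply]
        exact (clm_norm_le (grd (ψ t) x)).trans (le_abs_self _)
      refine e1.trans ((eLpNorm_sum_le (fun k _ => (pd_meas (ψ t) (dir k)).abs.aestronglyMeasurable)
        (ENNReal.one_le_ofReal.2 hp1.le)).trans (Finset.sum_le_sum fun k _ => ?_))
      rw [eLpNorm_eq_lintegral_rpow_enorm_toReal (by simpa using hp0) (by simp), ENNReal.toReal_ofReal hp0.le]
      refine ENNReal.rpow_le_rpow (le_trans (le_of_eq ?_) (kA t ht k)) (by positivity)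
      unfold μT
      exact lintegral_congr fun x => by simp
    · unfold gagl
      exact ENNReal.rpow_le_rpow ((gagl_le hp1.le _).trans (mul_le_mul' le_rfl
        (Finset.sum_le_sum fun k _ => kT t ht k))) (by positivity)

end Ctx

lemma marg_mul_le {m : ℕ} {a f : Spc m → ℝ} {B : ℝ} (ha : ∀ x, |a x| ≤ B) (hf : Per f) (hc : Continuous f) (x1 : ℝ) :
    |marg (fun x => a x * f x) x1| ≤ B * marg (fun x => |f x|) x1 := by
  unfold marg
  rw [← integral_const_mul]
  have i := (cube1_int (hf.comp fun t => |t|) hc.abs x1).const_mul B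
  rw [← Real.norm_eq_abs]
  refine norm_integral_le_of_norm_le i (Eventually.of_forall fun y => ?_)
  rw [Real.norm_eq_abs, abs_mul]
  exact mul_le_mul_of_nonneg_right (ha _) (abs_nonneg _)

namespace Ctx
variable {m : ℕ} {V : Spc m → ℝ} {β σ p : ℝ} {ψ0 : Spc m → ℝ} {Tmax : ℝ≥0∞} {ψ : ℝ → Spc m → ℝ}

lemma parta (H : Ctx m V β σ p ψ0 Tmax ψ) : ∃ CF : ℝ, 0 < CF ∧ ∀ t ∈ Ico0 Tmax,
      LpN p (Fop V (ψ t)) ≤ ofReal CF * WNorm σ p (ψ t) := by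
  obtain ⟨B, -, hB0, -, hB, -⟩ := H.V_bd
  obtain ⟨M, hM, hMb⟩ := H.sup_bd
  obtain ⟨m0, hm0, hml⟩ := H.marg_low
  have hp0 := H.p0
  have hp1 := H.p1
  choose L hL0 hL using fun k : Option (Fin m) => per_bdd ((H.hVp.pd (dir k)).pd (dir k)) (C1_pd_cont (pd_C1 H.hV (dir k)) (dir k))
  set Λ := ∑ k, L k with hΛ
  have hΛ0 : 0 ≤ Λ := Finset.sum_nonneg fun k _ => hL0 k
  set K := (m + 1) * B + Λ + B + M / m0 * (2 * B + Λ) + 1 with hK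
  have hK0 : 0 < K := by positivity
  refine ⟨4 * K, by positivity, fun t ht => ?_⟩
  set u := ψ t with hu
  have c1 : ContDiff ℝ 1 u := by
    rcases ht.1.eq_or_lt with h | h
    · have : u = ψ0 := by rw [hu, ← h]; exact funext H.sol.init
      rw [this]; exact H.psi0_C1
    · exact (H.snap ⟨h, ht.2⟩).c1
  have per : Per u := H.per ht
  have hc := c1.continuous
  have pos : ∀ x, 0 ≤ u x := H.pos ht
  have hmar : ∀ x1, 0 < marg u x1 := fun x1 => hm0.trans_le (hml t ht x1)
  have hW : ContDiff ℝ 1 (pd (e1 m) V) := pd_C1 H.hV _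
  have dc : Continuous (pd (e1 m) u) := C1_pd_cont c1 _
  have dper := per.pd (e1 m)
  set a1 : ℝ → ℝ := marg (fun x => |pd (e1 m) u x|) with ha1
  set a0 : ℝ → ℝ := marg (fun x => |u x|) with ha0
  have a1n : ∀ x, 0 ≤ a1 x := fun x => integral_nonneg fun _ => abs_nonneg _
  have a0n : ∀ x, 0 ≤ a0 x := fun x => integral_nonneg fun _ => abs_nonneg _
  have hphi' : ∀ x1, ∃ d, HasDerivAt (phiF V u) d x1 ∧ |d| ≤ (2 * B * a1 x1 + Λ * a0 x1) / m0 := by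
    intro x1
    have hN := marg_deriv ((H.hVp.pd (e1 m)).op per fun a b => a * b) (hW.mul c1) x1
    have hD := marg_deriv per c1 x1
    have hq := hN.fun_div hD (hmar x1).ne'
    refine ⟨_, hq, ?_⟩
    have e1' : (pd (e1 m) fun x => pd (e1 m) V x * u x) =
        fun x => pd (e1 m) V x * pd (e1 m) u x + pd (e1 m) (pd (e1 m) V) x * u x := funext fun x =>
      pd_mul' (hW.differentiable (by simp) x) (c1.differentiable (by simp) x) _
    have e2 : marg (pd (e1 m) fun x => pd (e1 m) V x * u x) x1 =
        marg (fun x => pd (e1 m) V x * pd (e1 m) u x) x1 + marg (fun x => pd (e1 m) (pd (e1 m) V) x * u x) x1 := by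
      rw [e1']
      exact integral_add (cube1_int ((H.hVp.pd (e1 m)).op dper fun a b => a * b) (hW.continuous.mul dc) x1)
        (cube1_int (((H.hVp.pd (e1 m)).pd (e1 m)).op per fun a b => a * b) ((C1_pd_cont hW _).mul hc) x1)
    have b1 := marg_mul_le (hB none) dper dc x1
    have b2 : |marg (fun x => pd (e1 m) (pd (e1 m) V) x * u x) x1| ≤ Λ * a0 x1 :=
      marg_mul_le (fun x => (hL none x).trans (Finset.single_le_sum (fun k _ => hL0 k) (Finset.mem_univ none))) per hc x1
    have b3 : |marg (pd (e1 m) u) x1| ≤ a1 x1 := by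
      have := marg_mul_le (a := fun _ => 1) (B := 1) (by simp) dper dc x1
      simpa using this
    have b4 := phi_bd (hB none) per hc pos (hmar x1)
    have e3 : ∀ N D N' D' : ℝ, D ≠ 0 → (N' * D - N * D') / D ^ 2 = (N' - N / D * D') / D := by
      intro N D N' D' h; field_simp
    rw [e3 _ _ _ _ (hmar x1).ne', abs_div, abs_of_pos (hmar x1)]
    have b5 : |marg (pd (e1 m) fun x => pd (e1 m) V x * u x) x1 - phiF V u x1 * marg (pd (e1 m) u) x1| ≤
        2 * B * a1 x1 + Λ * a0 x1 := by
      rw [e2]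
      have b6 : |phiF V u x1 * marg (pd (e1 m) u) x1| ≤ B * a1 x1 := by
        rw [abs_mul]; exact mul_le_mul b4 b3 (abs_nonneg _) hB0
      have b7 : |marg (fun x => pd (e1 m) V x * pd (e1 m) u x) x1| ≤ B * a1 x1 := b1
      rw [abs_le] at *
      constructor <;> linarith [b6.1, b6.2, b7.1, b7.2, b2.1, b2.2]
    exact div_le_div₀ (by have := a1n x1; have := a0n x1; positivity) b5 hm0 (hml t ht x1)
  have pt : ∀ x, |Fop V u x| ≤ K * (‖grd u x‖ + |u x| + (a1 x.1 + a0 x.1)) := by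
    intro x
    obtain ⟨d, hd, hdb⟩ := hphi' x.1
    have g0 := norm_nonneg (grd u x)
    have n1 := a1n x.1
    have n0 := a0n x.1
    have u0 := abs_nonneg (u x)
    have gk : ∀ k, |pd (dir k) u x| ≤ ‖grd u x‖ := fun k =>
      ((grd u x).le_opNorm (dir k)).trans (mul_le_of_le_one_right g0 (norm_dir k))
    have hdf : HasFDerivAt (fun z : Spc m => phiF V u z.1) (d • ContinuousLinearMap.fst ℝ ℝ (Fin m → ℝ)) x :=
      hd.comp_hasFDerivAt x hasFDerivAt_fst
    have q1 : pd (e1 m) (fun z => phiF V u z.1 * u z) x = phiF V u x.1 * pd (e1 m) u x + d * u x := by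
      rw [pd_mul' hdf.differentiableAt (c1.differentiable (by simp) x)]
      congr 2
      rw [pd, hdf.fderiv]; simp [e1]
    have t1 : |gradDot V u x| ≤ (m + 1) * B * ‖grd u x‖ := by
      rw [gradDot_eq]
      refine (Finset.abs_sum_le_sum_abs _ _).trans ?_
      have : ∀ k ∈ Finset.univ, |pd (dir k) V x * pd (dir k) u x| ≤ B * ‖grd u x‖ := fun k _ => by
        rw [abs_mul]; exact mul_le_mul (hB k x) (gk k) (abs_nonneg _) hB0
      refine (Finset.sum_le_card_nsmul _ _ _ this).trans (le_of_eq ?_)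
      simp; ring
    have t2 : |lap V x * u x| ≤ Λ * |u x| := by
      rw [abs_mul, lap_eq]
      exact mul_le_mul_of_nonneg_right ((Finset.abs_sum_le_sum_abs _ _).trans (Finset.sum_le_sum fun k _ => hL k x)) u0
    have t3 : |phiF V u x.1 * pd (e1 m) u x| ≤ B * ‖grd u x‖ := by
      rw [abs_mul]
      exact mul_le_mul (phi_bd (hB none) per hc pos (hmar x.1)) (gk none) (abs_nonneg _) hB0
    have t4 : |d * u x| ≤ M / m0 * (2 * B + Λ) * (a1 x.1 + a0 x.1) := by
      have uM : |u x| ≤ M := by rw [abs_of_nonneg (pos x)]; exact hMb t ht x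
      rw [abs_mul]
      calc _ ≤ (2 * B * a1 x.1 + Λ * a0 x.1) / m0 * M := mul_le_mul hdb uM u0 (by positivity)
        _ = M / m0 * (2 * B * a1 x.1 + Λ * a0 x.1) := by ring
        _ ≤ M / m0 * ((2 * B + Λ) * (a1 x.1 + a0 x.1)) := by
          refine mul_le_mul_of_nonneg_left ?_ (by positivity)
          have := mul_nonneg hB0 n0
          have := mul_nonneg hΛ0 n1
          nlinarith
        _ = _ := by ring
    have tt : |Fop V u x| ≤ |gradDot V u x| + |lap V x * u x| + (|phiF V u x.1 * pd (e1 m) u x| + |d * u x|) := by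
      rw [Fop, q1]
      exact (abs_sub _ _).trans (add_le_add (abs_add_le _ _) (abs_add_le _ _))
    have z1 : 0 ≤ M / m0 * (2 * B + Λ) := by positivity
    have z2 : (0:ℝ) ≤ m * B := by positivity
    have k1 : (m + 1) * B + B ≤ K := by rw [hK]; linarith
    have k2 : Λ ≤ K := by rw [hK]; linarith
    have k3 : M / m0 * (2 * B + Λ) ≤ K := by rw [hK]; linarith
    have := mul_le_mul_of_nonneg_right k1 g0
    have := mul_le_mul_of_nonneg_right k2 u0
    have := mul_le_mul_of_nonneg_right k3 (add_nonneg n1 n0)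
    linarith
  have mgm : ∀ f : Spc m → ℝ, Per f → Continuous f → LpN p f ≤ WNorm σ p u →
      AEStronglyMeasurable (fun x : Spc m => marg (fun z => |f z|) x.1) (μT m) ∧
      LpN p (fun x : Spc m => marg (fun z => |f z|) x.1) ≤ WNorm σ p u := by
    intro f hf hcf hle
    have hcm : Continuous fun x : Spc m => marg (fun z => |f z|) x.1 :=
      (marg_cont (hf.comp fun t => |t|) hcf.abs).comp continuous_fst
    refine ⟨hcm.aestronglyMeasurable, le_trans ?_ hle⟩
    rw [LpN_eq hp0 (per_memLp (marg_per (hf.comp fun t => |t|)) hcm _), LpN_eq hp0 (per_memLp hf hcf _)]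
    exact ofReal_le_ofReal (np_marg hp1.le hf hcf)
  have w0 : LpN p u ≤ WNorm σ p u := by rw [H.WN, add_assoc]; exact le_self_add
  have w1 : eLpNorm (fun x => ‖grd u x‖) (ofReal p) (μT m) ≤ WNorm σ p u := by
    rw [H.WN]; exact le_add_self.trans le_self_add
  have w2 : LpN p (pd (e1 m) u) ≤ WNorm σ p u := by
    refine le_trans (eLpNorm_mono fun x => ?_) w1
    rw [norm_norm]
    exact ((grd u x).le_opNorm (e1 m)).trans (mul_le_of_le_one_right (norm_nonneg _) (norm_dir none))
  obtain ⟨m1, l1⟩ := mgm _ dper dc w2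
  obtain ⟨m2, l2⟩ := mgm _ per hc w0
  have hq1 := ENNReal.one_le_ofReal.2 hp1.le
  have mg : AEStronglyMeasurable (fun x => ‖grd u x‖) (μT m) := (c1.continuous_fderiv (by simp)).norm.aestronglyMeasurable
  have mu : AEStronglyMeasurable (fun x => |u x|) (μT m) := hc.abs.aestronglyMeasurable
  have fin := eLpNorm_le_mul_eLpNorm_of_ae_le_mul (μ := μT m) (f := Fop V u)
    (g := ((fun x => ‖grd u x‖) + fun x => |u x|) + ((fun x : Spc m => a1 x.1) + fun x => a0 x.1)) (c := K)
    (Eventually.of_forall fun x => (pt x).trans (mul_le_mul_of_nonneg_left (le_abs_self _) hK0.le)) (ofReal p)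
  refine fin.trans ?_
  have w3 : eLpNorm (fun x => |u x|) (ofReal p) (μT m) ≤ WNorm σ p u :=
    le_trans (eLpNorm_mono fun x => by simp) w0
  have sum := (eLpNorm_add_le (mg.add mu) (m1.add m2) hq1).trans
    (add_le_add ((eLpNorm_add_le mg mu hq1).trans (add_le_add w1 w3)) ((eLpNorm_add_le m1 m2 hq1).trans (add_le_add l1 l2)))
  refine (mul_le_mul' le_rfl sum).trans (le_of_eq ?_)
  rw [mul_comm 4 K, ofReal_mul hK0.le, mul_assoc]
  congr 1
  rw [show ofReal 4 = 4 by norm_num]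
  ring

end Ctx

lemma partc (Tmax : ℝ≥0∞) (γ : ℝ → ℝ) (h0 : ∀ s ∈ Ioo0 Tmax, 0 ≤ γ s) (hi : IntegrableOn γ (Ioo0 Tmax)) :
      ∃ δ : ℝ, 0 < δ ∧ ∀ u ζ : ℝ → ℝ,
        ContinuousOn u (Ico0 Tmax) → (∀ t ∈ Ico0 Tmax, 0 ≤ u t) →
        ContinuousOn ζ (Ico0 Tmax) → (∀ t ∈ Ico0 Tmax, 0 ≤ ζ t) →
        (∀ t ∈ Ico0 Tmax, u t ≤ ζ t + ∫ s in Set.Ioc (0 : ℝ) t, γ (t - s) * u s) →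
        ∀ t ∈ Ico0 Tmax, u t ≤ 2 * sSup (ζ '' Set.Icc 0 t) * Real.exp (δ * t) := by
  have hm : MeasurableSet (Ioo0 Tmax) :=
    (measurableSet_lt measurable_const measurable_id).inter (measurableSet_lt ENNReal.measurable_ofReal measurable_const)
  have lim : Tendsto (fun δ : ℝ => ∫ s in Ioo0 Tmax, γ s * Real.exp (-(δ * s))) atTop (𝓝 (∫ s in Ioo0 Tmax, (0:ℝ))) := by
    refine tendsto_integral_filter_of_dominated_convergence γ (Eventually.of_forall fun δ => ?_) ?_ hi ?_
    · exact hi.1.mul (by fun_prop : Continuous fun s : ℝ => Real.exp (-(δ * s))).aestronglyMeasurable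
    · filter_upwards [eventually_ge_atTop 0] with δ hδ
      filter_upwards [ae_restrict_mem hm] with s hs
      rw [Real.norm_eq_abs, abs_mul, abs_of_nonneg (h0 s hs), Real.abs_exp]
      exact mul_le_of_le_one_right (h0 s hs) (Real.exp_le_one_iff.2 (neg_nonpos.2 (mul_nonneg hδ hs.1.le)))
    · filter_upwards [ae_restrict_mem hm] with s hs
      have : Tendsto (fun δ : ℝ => Real.exp (-(δ * s))) atTop (𝓝 0) :=
        Real.tendsto_exp_neg_atTop_nhds_zero.comp (tendsto_id.atTop_mul_const hs.1)
      simpa using this.const_mul (γ s)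
  rw [integral_zero] at lim
  obtain ⟨δ, hδ1, hδ⟩ := ((lim.eventually (ge_mem_nhds (show (0:ℝ) < 1/2 by norm_num))).and (eventually_gt_atTop 0)).exists
  refine ⟨δ, hδ, fun u ζ hu u0 hζ ζ0 hle t ht => ?_⟩
  have sub : Icc 0 t ⊆ Ico0 Tmax := fun s hs => ⟨hs.1, (ofReal_le_ofReal hs.2).trans_lt ht.2⟩
  set Z := sSup (ζ '' Icc 0 t) with hZ
  have bz : BddAbove (ζ '' Icc 0 t) := (isCompact_Icc.image_of_continuousOn (hζ.mono sub)).bddAbove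
  have hZb : ∀ s ∈ Icc 0 t, ζ s ≤ Z := fun s hs => le_csSup bz (mem_image_of_mem _ hs)
  have hZ0 : 0 ≤ Z := (ζ0 t ht).trans (hZb t ⟨ht.1, le_rfl⟩)
  obtain ⟨s0, hs0, hmax⟩ := isCompact_Icc.exists_isMaxOn (nonempty_Icc.2 ht.1)
    ((hu.mono sub).mul (by fun_prop : Continuous fun s : ℝ => Real.exp (-(δ * s))).continuousOn)
  set W := u s0 * Real.exp (-(δ * s0)) with hW
  have hW0 : 0 ≤ W := mul_nonneg (u0 s0 (sub hs0)) (Real.exp_pos _).le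
  have hb : ∀ r ∈ Icc 0 t, u r ≤ W * Real.exp (δ * r) := by
    intro r hr
    have h1 : u r * Real.exp (-(δ * r)) ≤ W := hmax hr
    calc u r = u r * Real.exp (-(δ * r)) * Real.exp (δ * r) := by
          rw [mul_assoc, ← Real.exp_add, neg_add_cancel, Real.exp_zero, mul_one]
      _ ≤ _ := mul_le_mul_of_nonneg_right h1 (Real.exp_pos _).le
  set f : ℝ → ℝ := fun s => γ s * Real.exp (-(δ * s)) with hf
  have fi : IntegrableOn f (Ioo0 Tmax) := by
    refine Integrable.mono hi (hi.1.mul (by fun_prop : Continuous fun s : ℝ => Real.exp (-(δ * s))).aestronglyMeasurable) ?_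
    filter_upwards [ae_restrict_mem hm] with s hs
    rw [hf, norm_mul, Real.norm_eq_abs (Real.exp _), Real.abs_exp]
    exact mul_le_of_le_one_right (norm_nonneg _) (Real.exp_le_one_iff.2 (neg_nonpos.2 (mul_nonneg hδ.le hs.1.le)))
  have sub2 : Ioc 0 s0 ⊆ Ioo0 Tmax := fun s hs => ⟨hs.1, (ofReal_le_ofReal (hs.2.trans hs0.2)).trans_lt ht.2⟩
  have I1 : ∫ s in Ioc 0 s0, f s ≤ 1 / 2 := by
    refine le_trans (setIntegral_mono_set fi ?_ (Eventually.of_forall sub2)) hδ1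
    filter_upwards [ae_restrict_mem hm] with s hs using mul_nonneg (h0 s hs) (Real.exp_pos _).le
  have ii : IntervalIntegrable f volume 0 s0 := (intervalIntegrable_iff_integrableOn_Ioc_of_le hs0.1).2 (fi.mono_set sub2)
  have I2 : ∫ r in Ioc 0 s0, f (s0 - r) = ∫ s in Ioc 0 s0, f s := by
    rw [← intervalIntegral.integral_of_le hs0.1, ← intervalIntegral.integral_of_le hs0.1,
      intervalIntegral.integral_comp_sub_left f s0, sub_self, sub_zero]
  have i2 : IntegrableOn (fun r => f (s0 - r)) (Ioc 0 s0) := by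
    have := (ii.comp_sub_left s0).symm
    rw [sub_self, sub_zero] at this
    exact (intervalIntegrable_iff_integrableOn_Ioc_of_le hs0.1).1 this
  have I3 : ∫ s in Ioc 0 s0, γ (s0 - s) * u s ≤ W * Real.exp (δ * s0) * ∫ r in Ioc 0 s0, f (s0 - r) := by
    rw [← integral_const_mul, integral_Ioc_eq_integral_Ioo, integral_Ioc_eq_integral_Ioo]
    have hmem : ∀ r ∈ Ioo 0 s0, s0 - r ∈ Ioo0 Tmax ∧ r ∈ Icc 0 t := fun r hr =>
      ⟨sub2 ⟨by linarith [hr.2], by linarith [hr.1]⟩, hr.1.le, hr.2.le.trans hs0.2⟩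
    refine integral_mono_of_nonneg ?_ ((i2.mono_set Ioo_subset_Ioc_self).const_mul _) ?_
    · filter_upwards [ae_restrict_mem measurableSet_Ioo] with r hr
      exact mul_nonneg (h0 _ (hmem r hr).1) (u0 _ (sub (hmem r hr).2))
    · filter_upwards [ae_restrict_mem measurableSet_Ioo] with r hr
      refine (mul_le_mul_of_nonneg_left (hb r (hmem r hr).2) (h0 _ (hmem r hr).1)).trans (le_of_eq ?_)
      have : Real.exp (δ * r) = Real.exp (δ * s0) * Real.exp (-(δ * (s0 - r))) := by
        rw [← Real.exp_add]; congr 1; ring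
      rw [this, hf]; ring
  have I4 : u s0 ≤ Z + W * Real.exp (δ * s0) * (1 / 2) := by
    refine (hle s0 (sub hs0)).trans (add_le_add (hZb s0 hs0) (I3.trans ?_))
    rw [I2]
    exact mul_le_mul_of_nonneg_left I1 (by positivity)
  have I5 : u s0 = W * Real.exp (δ * s0) := by
    rw [hW, mul_assoc, ← Real.exp_add, neg_add_cancel, Real.exp_zero, mul_one]
  have I6 : W ≤ W * Real.exp (δ * s0) := le_mul_of_one_le_right hW0 (Real.one_le_exp (mul_nonneg hδ.le hs0.1))
  exact (hb t ⟨ht.1, le_rfl⟩).trans (mul_le_mul_of_nonneg_right (by linarith) (Real.exp_pos _).le)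

theorem polynomial_bound_apriori_and_gronwall
    (m : ℕ) (V : Spc m → ℝ) (β σ p : ℝ) (ψ0 : Spc m → ℝ)
    (Tmax : ℝ≥0∞) (ψ : ℝ → Spc m → ℝ)
    (hV : ContDiff ℝ 2 V) (hVper : IsPeriodic V) (hβ : 0 < β)
    (h1 : Hyp1 σ p ψ0) (h2 : Hyp2 m σ p)
    (hψ : IsMaximalLpSolution V β σ p ψ0 Tmax ψ) :
    (∃ CF : ℝ, 0 < CF ∧ ∀ t ∈ Ico0 Tmax,
      LpN p (Fop V (ψ t)) ≤ ENNReal.ofReal CF * WNorm σ p (ψ t)) ∧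
    (∃ K : ℝ≥0∞, K < ⊤ ∧ ∀ t ∈ Ioo0 Tmax, WNorm σ p (ψ t) ≤ K) ∧
    (∀ γ : ℝ → ℝ, (∀ s ∈ Ioo0 Tmax, 0 ≤ γ s) → AntitoneOn γ (Ioo0 Tmax) →
      IntegrableOn γ (Ioo0 Tmax) →
      ∃ δ : ℝ, 0 < δ ∧ ∀ u ζ : ℝ → ℝ,
        ContinuousOn u (Ico0 Tmax) → (∀ t ∈ Ico0 Tmax, 0 ≤ u t) →
        ContinuousOn ζ (Ico0 Tmax) → (∀ t ∈ Ico0 Tmax, 0 ≤ ζ t) →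
        (∀ t ∈ Ico0 Tmax, u t ≤ ζ t + ∫ s in Set.Ioc (0 : ℝ) t, γ (t - s) * u s) →
        ∀ t ∈ Ico0 Tmax, u t ≤ 2 * sSup (ζ '' Set.Icc 0 t) * Real.exp (δ * t)) := by
  have H : Ctx m V β σ p ψ0 Tmax ψ := ⟨hV, (per_iff _).1 hVper, hβ, h1, h2, hψ.1⟩
  exact ⟨H.parta, H.partb, fun γ hγ _ hi => partc Tmax γ hγ hi⟩
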